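/- arXiv:1107.2102 — 2 statements merged into one kernel-verified Lean document; each statement's English description precedes it below -/
import Mathlib

section
/- Let (R,𝔪) be a complete Noetherian local ring, M a finitely generated R-module of dimension d, and 𝔞₁, 𝔞₂ ideals of R. Then there exists an ideal 𝔟 of R such that Att H^d_𝔟(M) = Att H^d_{𝔞₁}(M) ∩ Att H^d_{𝔞₂}(M). -/
noncomputable section
open CategoryTheory

namespace Paper

variable (R : Type) [CommRing R]

/-- The `i`-th local cohomology of the `R`-module `M` with respect to the ideal `I`. -/
abbrev H (I : Ideal R) (i : ℕ) (M : Type) [AddCommGroup M] [Module R M] : ModuleCat R :=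
  (localCohomology I i).obj (ModuleCat.of R M)

/-- `N` is a `p`-secondary submodule of `M`: it is nonzero, every `r : R` acts on it either
surjectively or nilpotently, and `p` is the radical of its annihilator. -/
def IsSecondaryFor {M : Type} [AddCommGroup M] [Module R M]
    (N : Submodule R M) (p : Ideal R) : Prop :=
  N ≠ ⊥ ∧
  (∀ r : R, (∀ m ∈ N, ∃ n ∈ N, r • n = m) ∨ (∃ k : ℕ, ∀ m ∈ N, r ^ k • m = 0)) ∧
  N.annihilator.radical = p

/-- A minimal secondary representation of the module `M`. -/
structure MinSecRep (M : Type) [AddCommGroup M] [Module R M] where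
  n : ℕ
  S : Fin n → Submodule R M
  p : Fin n → Ideal R
  prime : ∀ i, (p i).IsPrime
  sec : ∀ i, IsSecondaryFor R (S i) (p i)
  sum : (⨆ i, S i) = ⊤
  inj : Function.Injective p
  irred : ∀ j, ¬ (S j ≤ ⨆ i ∈ ({j}ᶜ : Set (Fin n)), S i)

/-- `M` is representable: it is a (finite) sum of secondary submodules. -/
def IsRepresentable (M : Type) [AddCommGroup M] [Module R M] : Prop :=
  ∃ (n : ℕ) (S : Fin n → Submodule R M) (p : Fin n → Ideal R),
    (∀ i, (p i).IsPrime) ∧ (∀ i, IsSecondaryFor R (S i) (p i)) ∧ (⨆ i, S i) = ⊤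

/-- The set of attached primes of `M`: the primes occurring in a minimal secondary
representation of `M`. -/
def attached (M : Type) [AddCommGroup M] [Module R M] : Set (Ideal R) :=
  {q | ∃ (rep : MinSecRep R M) (i : Fin rep.n), rep.p i = q}

/-- The coheight (dimension of `R/I`): Krull dimension of the set of primes containing `I`. -/
def coheight (I : Ideal R) : WithBot ℕ∞ :=
  Order.krullDim {p : Ideal R // p.IsPrime ∧ I ≤ p}

/-- The Krull dimension of the ring `R`. -/
def ringDim : WithBot ℕ∞ := Order.krullDim {p : Ideal R // p.IsPrime}

/-- The Krull dimension of (the support of) the finitely generated module `M`. -/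
def dimMod (M : Type) [AddCommGroup M] [Module R M] : WithBot ℕ∞ :=
  coheight R (Module.annihilator R M)

/-- The dimension of the localized module `M_q`: chains of primes in the support of `M`
contained in `q`. -/
def dimModAt (M : Type) [AddCommGroup M] [Module R M] (q : Ideal R) : WithBot ℕ∞ :=
  Order.krullDim {p : Ideal R // p.IsPrime ∧ Module.annihilator R M ≤ p ∧ p ≤ q}

/-- The support of a finitely generated module: primes containing the annihilator. -/
def supp (M : Type) [AddCommGroup M] [Module R M] : Set (Ideal R) :=
  {p | p.IsPrime ∧ Module.annihilator R M ≤ p}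

/-- `Min M`: minimal primes of the support of `M`. -/
def minSupp (M : Type) [AddCommGroup M] [Module R M] : Set (Ideal R) :=
  (Module.annihilator R M).minimalPrimes

/-- `Assh M`: primes in the support of maximal coheight. -/
def assh (M : Type) [AddCommGroup M] [Module R M] : Set (Ideal R) :=
  {p | p ∈ supp R M ∧ coheight R p = dimMod R M}

open RingTheory.Sequence in
/-- Depth of `M` with respect to the ideal `J`: supremum of the lengths of `M`-regular
sequences contained in `J`. -/
def depthOn (J : Ideal R) (M : Type) [AddCommGroup M] [Module R M] : ℕ∞ :=
  ⨆ l ∈ {l : List R | (∀ x ∈ l, x ∈ J) ∧ IsRegular M l}, (l.length : ℕ∞)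

/-- `M` is a Cohen–Macaulay module over the local ring `R`: depth = dimension. -/
def IsCMLocalMod [IsLocalRing R] (M : Type) [AddCommGroup M] [Module R M] : Prop :=
  (depthOn R (IsLocalRing.maximalIdeal R) M : WithBot ℕ∞) = dimMod R M

/-- `R` is a Cohen–Macaulay local ring: it is local and its depth (w.r.t. its Jacobson
radical, which is the maximal ideal) equals its Krull dimension. -/
def IsCMLocalRing : Prop :=
  IsLocalRing R ∧ ((depthOn R ((⊥ : Ideal R).jacobson) R : WithBot ℕ∞) = ringDim R)

/-- `R` is a Cohen–Macaulay ring: all of its localizations at primes are CM local rings. -/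
def IsCMRing : Prop :=
  ∀ (p : Ideal R) [p.IsPrime], IsCMLocalRing (Localization.AtPrime p)

/-- `M` is an equidimensional module: every minimal prime of its support has coheight equal
to the dimension of `M`. -/
def IsEquidim (M : Type) [AddCommGroup M] [Module R M] : Prop :=
  ∀ q ∈ minSupp R M, coheight R q = dimMod R M

/-- `R` is catenary: any two saturated chains of primes with the same endpoints have the
same length. -/
def IsCatenary : Prop :=
  ∀ (c₁ c₂ : LTSeries {p : Ideal R // p.IsPrime}),
    c₁.head = c₂.head → c₁.last = c₂.last →
    (∀ i : Fin c₁.length, c₁.toFun i.castSucc ⋖ c₁.toFun i.succ) →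
    (∀ i : Fin c₂.length, c₂.toFun i.castSucc ⋖ c₂.toFun i.succ) →
    c₁.length = c₂.length

/-- `R` is universally catenary: every finitely generated `R`-algebra is catenary. -/
def IsUnivCatenary : Prop :=
  ∀ (A : Type) [CommRing A] [Algebra R A], Algebra.FiniteType R A → IsCatenary A

/-- `x` is a uniform local cohomological annihilator of `M`: `x` avoids all minimal primes
of `M` and, for every maximal ideal `m`, kills `H^i_m(M)` for all `i < dim M_m`. -/
def IsULCA (M : Type) [AddCommGroup M] [Module R M] (x : R) : Prop :=
  (∀ p ∈ minSupp R M, x ∉ p) ∧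
  ∀ (m : Ideal R), m.IsMaximal → ∀ i : ℕ, (i : WithBot ℕ∞) < dimModAt R M m →
    ∀ y : H R m i M, x • y = 0

/-- `M` has a uniform local cohomological annihilator. -/
def HasULCA (M : Type) [AddCommGroup M] [Module R M] : Prop := ∃ x, IsULCA R M x

/-- `R/p` has a uniform local cohomological annihilator (local case): some `x ∉ p` kills
`H^i_𝔪(R/p)` for all `i < dim R/p`. -/
def HasULCAQuot [IsLocalRing R] (p : Ideal R) : Prop :=
  ∃ x ∉ p, ∀ i : ℕ, (i : WithBot ℕ∞) < coheight R p →
    ∀ y : H R (IsLocalRing.maximalIdeal R) i (R ⧸ p), x • y = 0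

/-- `M` is generalized Cohen–Macaulay over the local ring `R`: a power of the maximal ideal
kills all local cohomology below the dimension. -/
def IsGCM [IsLocalRing R] (M : Type) [AddCommGroup M] [Module R M] : Prop :=
  ∃ n : ℕ, ∀ i : ℕ, (i : WithBot ℕ∞) < dimMod R M →
    ∀ a ∈ (IsLocalRing.maximalIdeal R) ^ n,
      ∀ y : H R (IsLocalRing.maximalIdeal R) i M, a • y = 0

end Paper

noncomputable section
open CategoryTheory

namespace TopLC

open Abelian

variable {R : Type} [CommRing R]

/-- The projection `R ⧸ J → R ⧸ K` for `J ≤ K`. -/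
def quotMap {J K : Ideal R} (h : J ≤ K) : ModuleCat.of R (R ⧸ J) ⟶ ModuleCat.of R (R ⧸ K) :=
  ModuleCat.ofHom (Submodule.mapQ J K LinearMap.id h)

lemma quotMap_refl (J : Ideal R) : quotMap (le_refl J) = 𝟙 _ := by
  ext
  rfl

lemma quotMap_comp {J K L : Ideal R} (h : J ≤ K) (h' : K ≤ L) :
    quotMap h ≫ quotMap h' = quotMap (h.trans h') := by
  ext
  rfl

/-- Precomposition with `R ⧸ J → R ⧸ K` on `Ext`. -/
def extRes {J K : Ideal R} (h : J ≤ K) (i : ℕ) (A : Type) [AddCommGroup A] [Module R A] :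
    Ext (ModuleCat.of R (R ⧸ K)) (ModuleCat.of R A) i →ₗ[R]
      Ext (ModuleCat.of R (R ⧸ J)) (ModuleCat.of R A) i :=
  (Ext.mk₀ (quotMap h)).precompOfLinear R _ (zero_add i)

section

variable (A : Type) [AddCommGroup A] [Module R A]
variable {B : Type} [AddCommGroup B] [Module R B]
variable {C : Type} [AddCommGroup C] [Module R C]

lemma extRes_apply {J K : Ideal R} (h : J ≤ K) (i : ℕ)
    (e : Ext (ModuleCat.of R (R ⧸ K)) (ModuleCat.of R A) i) :
    extRes h i A e = (Ext.mk₀ (quotMap h)).comp e (zero_add i) := rfl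

lemma extRes_extRes {J K L : Ideal R} (h : J ≤ K) (h' : K ≤ L) (i : ℕ)
    (e : Ext (ModuleCat.of R (R ⧸ L)) (ModuleCat.of R A) i) :
    extRes h i A (extRes h' i A e) = extRes (h.trans h') i A e := by
  simp [extRes_apply, ← quotMap_comp h h']

lemma extRes_refl {J : Ideal R} (i : ℕ)
    (e : Ext (ModuleCat.of R (R ⧸ J)) (ModuleCat.of R A) i) :
    extRes le_rfl i A e = e := by
  simp [extRes_apply, quotMap_refl]

/-- The transition maps of the system `Ext (R ⧸ I ^ n) A`. -/
def trans (I : Ideal R) (i : ℕ) (n m : ℕ) (h : n ≤ m) :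
    Ext (ModuleCat.of R (R ⧸ I ^ n)) (ModuleCat.of R A) i →ₗ[R]
      Ext (ModuleCat.of R (R ⧸ I ^ m)) (ModuleCat.of R A) i :=
  extRes (Ideal.pow_le_pow_right h) i A

instance (I : Ideal R) (i : ℕ) :
    DirectedSystem (fun n => Ext (ModuleCat.of R (R ⧸ I ^ n)) (ModuleCat.of R A) i)
      (fun n m h => trans A I i n m h) where
  map_self _ _ := extRes_refl _ _ _
  map_map _ _ _ _ _ _ := extRes_extRes _ _ _ _ _

/-- Local cohomology as the direct limit of the modules `Ext (R ⧸ I ^ n) A`. -/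
def LC (I : Ideal R) (i : ℕ) : Type :=
  Module.DirectLimit (fun n => Ext (ModuleCat.of R (R ⧸ I ^ n)) (ModuleCat.of R A) i)
    (trans A I i)

instance (I : Ideal R) (i : ℕ) : AddCommGroup (LC A I i) :=
  inferInstanceAs (AddCommGroup (Module.DirectLimit _ _))

instance (I : Ideal R) (i : ℕ) : Module R (LC A I i) :=
  inferInstanceAs (Module R (Module.DirectLimit _ _))

namespace LC

/-- The class in local cohomology of an element of `Ext (R ⧸ I ^ n) A`. -/
def mk (I : Ideal R) (i n : ℕ) :
    Ext (ModuleCat.of R (R ⧸ I ^ n)) (ModuleCat.of R A) i →ₗ[R] LC A I i :=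
  Module.DirectLimit.of R ℕ _ (trans A I i) n

variable {A}
variable {I : Ideal R} {i : ℕ}

lemma mk_extRes {n m : ℕ} (h : n ≤ m) (e : Ext (ModuleCat.of R (R ⧸ I ^ n)) (ModuleCat.of R A) i) :
    mk A I i m (extRes (Ideal.pow_le_pow_right h) i A e) = mk A I i n e :=
  Module.DirectLimit.of_f (f := trans A I i) (hij := h)

lemma exists_mk (x : LC A I i) : ∃ n e, mk A I i n e = x :=
  Module.DirectLimit.exists_of x

lemma mk_eq_zero {n : ℕ} {e : Ext (ModuleCat.of R (R ⧸ I ^ n)) (ModuleCat.of R A) i}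
    (h : mk A I i n e = 0) :
    ∃ (m : ℕ) (hm : n ≤ m), extRes (Ideal.pow_le_pow_right hm) i A e = 0 :=
  Module.DirectLimit.of.zero_exact h

/-- Postcomposition with an `Ext` class on local cohomology. -/
def post (I : Ideal R) {i j k : ℕ} (β : Ext (ModuleCat.of R A) (ModuleCat.of R B) j)
    (h : i + j = k) : LC A I i →ₗ[R] LC B I k :=
  Module.DirectLimit.lift R ℕ _ (trans A I i)
    (fun n => mk B I k n ∘ₗ β.postcompOfLinear R _ h) (by
      intro n m hnm e
      simp only [LinearMap.comp_apply, Ext.postcompOfLinear, LinearMap.flip_apply,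
        Ext.bilinearCompOfLinear_apply_apply]
      rw [← mk_extRes hnm, extRes_apply, trans, extRes_apply, Ext.comp_assoc _ _ _ _ _ (by lia)])

lemma post_mk {j k n : ℕ} (β : Ext (ModuleCat.of R A) (ModuleCat.of R B) j)
    (h : i + j = k) (e) : post I β h (mk A I i n e) = mk B I k n (e.comp β h) :=
  Module.DirectLimit.lift_of _ _ _

/-- The map on local cohomology induced by an inclusion of ideals. -/
def incl {a b : Ideal R} (hab : b ≤ a) (i : ℕ) (A : Type) [AddCommGroup A] [Module R A] :
    LC A a i →ₗ[R] LC A b i :=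
  Module.DirectLimit.lift R ℕ _ (trans A a i)
    (fun n => mk A b i n ∘ₗ extRes (Ideal.pow_right_mono hab n) i A) (by
      intro n m hnm e
      simp only [LinearMap.comp_apply]
      rw [← mk_extRes hnm, trans, extRes_extRes, extRes_extRes])

lemma incl_mk {a b : Ideal R} (hab : b ≤ a) {n : ℕ} (e) :
    incl hab i A (mk A a i n e) = mk A b i n (extRes (Ideal.pow_right_mono hab n) i A e) :=
  Module.DirectLimit.lift_of _ _ _

lemma incl_post {a b : Ideal R} (hab : b ≤ a) {j k : ℕ}
    (β : Ext (ModuleCat.of R A) (ModuleCat.of R B) j)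
    (h : i + j = k) (x : LC A a i) : incl hab k B (post a β h x) = post b β h (incl hab i A x) := by
  obtain ⟨n, e, rfl⟩ := exists_mk x
  rw [incl_mk, post_mk, post_mk, incl_mk, extRes_apply, extRes_apply,
    Ext.comp_assoc _ _ _ _ _ (by lia)]

/-- Functoriality of local cohomology. -/
def map (I : Ideal R) (i : ℕ) (f : A →ₗ[R] B) : LC A I i →ₗ[R] LC B I i :=
  post I (Ext.mk₀ (ModuleCat.ofHom f)) (add_zero i)

lemma map_mk (f : A →ₗ[R] B) {n : ℕ} (e) :
    map I i f (mk A I i n e) = mk B I i n (e.comp (Ext.mk₀ (ModuleCat.ofHom f)) (add_zero i)) :=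
  post_mk _ _ _

lemma incl_map {a b : Ideal R} (hab : b ≤ a) (f : A →ₗ[R] B) (x : LC A a i) :
    incl hab i B (map a i f x) = map b i f (incl hab i A x) :=
  incl_post _ _ _ _

lemma map_id (x : LC A I i) : map I i LinearMap.id x = x := by
  obtain ⟨n, e, rfl⟩ := exists_mk x
  rw [map_mk]
  congr 1
  exact Ext.comp_mk₀_id e

lemma map_comp (g : B →ₗ[R] C) (f : A →ₗ[R] B) (x : LC A I i) :
    map I i (g ∘ₗ f) x = map I i g (map I i f x) := by
  obtain ⟨n, e, rfl⟩ := exists_mk x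
  simp [map_mk]

lemma map_smul_id (r : R) (x : LC A I i) :
    map I i (r • LinearMap.id : A →ₗ[R] A) x = r • x := by
  obtain ⟨n, e, rfl⟩ := exists_mk x
  rw [map_mk, ← _root_.map_smul, Ext.smul_eq_comp_mk₀]
  rfl

lemma map_zero (x : LC A I i) : map I i (0 : A →ₗ[R] B) x = 0 := by
  obtain ⟨n, e, rfl⟩ := exists_mk x
  simp [map_mk]

/-- Local cohomology preserves linear equivalences. -/
def congr (I : Ideal R) (i : ℕ) (e : A ≃ₗ[R] B) : LC A I i ≃ₗ[R] LC B I i :=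
  LinearEquiv.ofLinearMap (map I i e.toLinearMap) (map I i e.symm.toLinearMap)
    (by ext x; simp [← map_comp, map_id]) (by ext x; simp [← map_comp, map_id])

section les

variable {f : A →ₗ[R] B} {g : B →ₗ[R] C}

lemma shortExact (hf : Function.Injective f) (hfg : Function.Exact f g)
    (hg : Function.Surjective g) :
    (ShortComplex.mk (ModuleCat.ofHom f) (ModuleCat.ofHom g) (by
      ext x; exact hfg.apply_apply_eq_zero x)).ShortExact where
  exact := (ShortComplex.ShortExact.moduleCat_exact_iff_function_exact _).2 hfg
  mono_f := (ModuleCat.mono_iff_injective _).2 hf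
  epi_g := (ModuleCat.epi_iff_surjective _).2 hg

/-- The connecting homomorphism. -/
def δ (I : Ideal R) (i : ℕ) (hf : Function.Injective f) (hfg : Function.Exact f g)
    (hg : Function.Surjective g) : LC C I i →ₗ[R] LC A I (i + 1) :=
  post I (shortExact hf hfg hg).extClass rfl

lemma exact₂ (hf : Function.Injective f) (hfg : Function.Exact f g)
    (hg : Function.Surjective g) : Function.Exact (map I i f) (map I i g) := by
  intro x
  constructor
  · intro h
    obtain ⟨n, e, rfl⟩ := exists_mk x
    rw [map_mk] at h
    obtain ⟨m, hm, h⟩ := mk_eq_zero h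
    rw [← mk_extRes hm]
    rw [extRes_apply, ← Ext.comp_assoc_of_third_deg_zero] at h
    obtain ⟨y, hy⟩ := Ext.covariant_sequence_exact₂ _ (shortExact hf hfg hg) _ h
    refine ⟨mk A I i m y, ?_⟩
    rw [map_mk, extRes_apply]
    exact congrArg _ hy
  · rintro ⟨y, rfl⟩
    rw [← map_comp, hfg.linearMap_comp_eq_zero, map_zero]

lemma exact₃ (hf : Function.Injective f) (hfg : Function.Exact f g)
    (hg : Function.Surjective g) : Function.Exact (map I i g) (δ I i hf hfg hg) := by
  intro x
  constructor
  · intro h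
    obtain ⟨n, e, rfl⟩ := exists_mk x
    rw [δ, post_mk] at h
    obtain ⟨m, hm, h⟩ := mk_eq_zero h
    rw [← mk_extRes hm]
    rw [extRes_apply, ← Ext.comp_assoc _ _ _ (zero_add i) rfl (by lia)] at h
    obtain ⟨y, hy⟩ := Ext.covariant_sequence_exact₃ _ (shortExact hf hfg hg) _ rfl h
    refine ⟨mk B I i m y, ?_⟩
    rw [map_mk, extRes_apply]
    exact congrArg _ hy
  · rintro ⟨y, rfl⟩
    obtain ⟨n, e, rfl⟩ := exists_mk y
    rw [δ, map_mk, post_mk, Ext.comp_assoc_of_second_deg_zero]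
    have := (shortExact hf hfg hg).comp_extClass
    simp only at this
    rw [this, Ext.comp_zero, _root_.map_zero]

lemma exact₁ (hf : Function.Injective f) (hfg : Function.Exact f g)
    (hg : Function.Surjective g) : Function.Exact (δ I i hf hfg hg) (map I (i + 1) f) := by
  intro x
  constructor
  · intro h
    obtain ⟨n, e, rfl⟩ := exists_mk x
    rw [map_mk] at h
    obtain ⟨m, hm, h⟩ := mk_eq_zero h
    rw [← mk_extRes hm]
    rw [extRes_apply, ← Ext.comp_assoc _ _ _ (zero_add (i + 1)) rfl (by lia)] at h
    obtain ⟨y, hy⟩ := Ext.covariant_sequence_exact₁ _ (shortExact hf hfg hg) _ h rfl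
    refine ⟨mk C I i m y, ?_⟩
    rw [δ, post_mk, extRes_apply]
    exact congrArg _ hy
  · rintro ⟨y, rfl⟩
    obtain ⟨n, e, rfl⟩ := exists_mk y
    rw [δ, post_mk, map_mk, Ext.comp_assoc_of_third_deg_zero]
    have := (shortExact hf hfg hg).extClass_comp
    simp only at this
    rw [this, Ext.comp_zero, _root_.map_zero]

lemma incl_δ {a b : Ideal R} (hab : b ≤ a) (hf : Function.Injective f) (hfg : Function.Exact f g)
    (hg : Function.Surjective g) (x : LC C a i) :
    incl hab (i + 1) A (δ a i hf hfg hg x) = δ b i hf hfg hg (incl hab i C x) :=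
  incl_post _ _ _ _

end les

lemma exists_pow_smul_eq_zero (x : LC A I i) : ∃ n, ∀ r ∈ I ^ n, r • x = 0 := by
  obtain ⟨n, e, rfl⟩ := exists_mk x
  refine ⟨n, fun r hr => ?_⟩
  rw [← _root_.map_smul]
  have : r • 𝟙 (ModuleCat.of R (R ⧸ I ^ n)) = 0 := by
    ext
    change r • (1 : R ⧸ I ^ n) = 0
    rw [Algebra.smul_def, mul_one]
    exact Ideal.Quotient.eq_zero_iff_mem.2 hr
  have h2 : r • e = (Ext.mk₀ (r • 𝟙 (ModuleCat.of R (R ⧸ I ^ n)))).comp e (zero_add i) := by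
    rw [Ext.mk₀_smul, Ext.smul_comp, Ext.mk₀_id_comp]
  rw [h2, this]
  simp

lemma eq_zero_of_injective [Injective (ModuleCat.of R A)] (x : LC A I (i + 1)) : x = 0 := by
  obtain ⟨n, e, rfl⟩ := exists_mk x
  rw [Ext.eq_zero_of_injective e, _root_.map_zero]

lemma eq_zero_of_top (x : LC A (⊤ : Ideal R) i) : x = 0 := by
  obtain ⟨n, h⟩ := exists_pow_smul_eq_zero x
  rw [Ideal.top_pow] at h
  simpa using h 1 trivial

end LC
end

end TopLC

end

noncomputable section
open CategoryTheory

namespace TopLC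

open Abelian

variable {R : Type} [CommRing R]
variable {A : Type} [AddCommGroup A] [Module R A]
variable {B : Type} [AddCommGroup B] [Module R B]

lemma exists_extension {J : Type} [AddCommGroup J] [Module R J] [Module.Injective R J]
    (f : A →ₗ[R] B) (g : A →ₗ[R] J) (h : LinearMap.ker f ≤ LinearMap.ker g) :
    ∃ k : B →ₗ[R] J, ∀ x, k (f x) = g x := by
  obtain ⟨k, hk⟩ := Module.Injective.out (R := R) (Q := J)
    ((LinearMap.ker f).liftQ f le_rfl)
    (LinearMap.ker_eq_bot.1 (Submodule.ker_liftQ_eq_bot _ _ _ le_rfl))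
    ((LinearMap.ker f).liftQ g h)
  exact ⟨k, fun x => by simpa using hk (Submodule.Quotient.mk x)⟩

lemma exists_injective_embedding (A : Type) [AddCommGroup A] [Module R A] :
    ∃ (J : Type) (_ : AddCommGroup J) (_ : Module R J) (_ : Module.Injective R J)
      (f : A →ₗ[R] J), Function.Injective f := by
  let P := Injective.under (ModuleCat.of R A)
  refine ⟨P, inferInstance, inferInstance, ?_, (Injective.ι (ModuleCat.of R A)).hom, ?_⟩
  · have : Injective (ModuleCat.of R P) := inferInstanceAs (Injective P)
    exact Module.injective_module_of_injective_object R P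
  · exact (ModuleCat.mono_iff_injective _).1 inferInstance

/-- The submodule of elements annihilated by a power of `I`. -/
def gam (I : Ideal R) (A : Type) [AddCommGroup A] [Module R A] : Submodule R A where
  carrier := {a | ∃ n, ∀ r ∈ I ^ n, r • a = 0}
  zero_mem' := ⟨0, by simp⟩
  add_mem' := by
    rintro a b ⟨n, hn⟩ ⟨m, hm⟩
    refine ⟨n + m, fun r hr => ?_⟩
    rw [smul_add, hn r (Ideal.pow_le_pow_right (by lia) hr),
      hm r (Ideal.pow_le_pow_right (by lia) hr), add_zero]
  smul_mem' := by
    rintro c a ⟨n, hn⟩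
    exact ⟨n, fun r hr => by rw [smul_comm, hn r hr, smul_zero]⟩

namespace LC

variable {I : Ideal R} {i : ℕ}

/-- Evaluation at `1`. -/
def evalOne (J : Ideal R) (A : Type) [AddCommGroup A] [Module R A] :
    Ext (ModuleCat.of R (R ⧸ J)) (ModuleCat.of R A) 0 →ₗ[R] A :=
  LinearMap.applyₗ (1 : R ⧸ J) ∘ₗ (ModuleCat.homLinearEquiv (S := R)).toLinearMap ∘ₗ
    (Ext.linearEquiv₀ (R := R)).toLinearMap

lemma evalOne_mk₀ (J : Ideal R) (f : ModuleCat.of R (R ⧸ J) ⟶ ModuleCat.of R A) :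
    evalOne J A (Ext.mk₀ f) = f.hom (1 : R ⧸ J) := by
  have : (Ext.linearEquiv₀ (R := R)) (Ext.mk₀ f) = f := by
    rw [← LinearEquiv.eq_symm_apply]; simp
  simp only [evalOne, LinearMap.comp_apply, LinearEquiv.coe_coe, this]
  rfl

/-- The map from local cohomology in degree zero to the module. -/
def eps (I : Ideal R) (A : Type) [AddCommGroup A] [Module R A] : LC A I 0 →ₗ[R] A :=
  Module.DirectLimit.lift R ℕ _ (trans A I 0) (fun n => evalOne (I ^ n) A) (by
    intro n m hnm e
    obtain ⟨f, rfl⟩ := (Ext.mk₀_bijective _ _).2 e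
    rw [trans, extRes_apply, Ext.mk₀_comp_mk₀, evalOne_mk₀, evalOne_mk₀]
    rfl)

lemma eps_mk {n : ℕ} (f : ModuleCat.of R (R ⧸ I ^ n) ⟶ ModuleCat.of R A) :
    eps I A (mk A I 0 n (Ext.mk₀ f)) = f.hom (1 : R ⧸ I ^ n) :=
  (Module.DirectLimit.lift_of _ _ _).trans (evalOne_mk₀ _ f)

lemma exists_mk₀ (x : LC A I 0) :
    ∃ (n : ℕ) (f : ModuleCat.of R (R ⧸ I ^ n) ⟶ ModuleCat.of R A),
      mk A I 0 n (Ext.mk₀ f) = x := by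
  obtain ⟨n, e, rfl⟩ := exists_mk x
  obtain ⟨f, rfl⟩ := (Ext.mk₀_bijective _ _).2 e
  exact ⟨n, f, rfl⟩

lemma eps_injective : Function.Injective (eps I A) := by
  rw [← LinearMap.ker_eq_bot, LinearMap.ker_eq_bot']
  intro x hx
  obtain ⟨n, f, rfl⟩ := exists_mk₀ x
  rw [eps_mk] at hx
  have : f = 0 := by
    ext
    exact hx
  rw [this]
  simp

lemma eps_mem (x : LC A I 0) : eps I A x ∈ gam I A := by
  obtain ⟨n, h⟩ := exists_pow_smul_eq_zero x
  exact ⟨n, fun r hr => by rw [← _root_.map_smul, h r hr, _root_.map_zero]⟩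

lemma exists_eps_eq {a : A} (ha : a ∈ gam I A) : ∃ x, eps I A x = a := by
  obtain ⟨n, hn⟩ := ha
  let f : (R ⧸ I ^ n) →ₗ[R] A := Submodule.liftQ _ (LinearMap.toSpanSingleton R A a) (by
    intro r hr
    simpa using hn r hr)
  refine ⟨mk A I 0 n (Ext.mk₀ (ModuleCat.ofHom f)), ?_⟩
  rw [eps_mk]
  change LinearMap.toSpanSingleton R A a 1 = a
  simp

lemma eps_map (f : A →ₗ[R] B) (x : LC A I 0) : eps I B (map I 0 f x) = f (eps I A x) := by
  obtain ⟨n, g, rfl⟩ := exists_mk₀ x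
  rw [map_mk, Ext.mk₀_comp_mk₀, eps_mk, eps_mk]
  rfl

lemma eps_incl {a b : Ideal R} (hab : b ≤ a) (x : LC A a 0) :
    eps b A (incl hab 0 A x) = eps a A x := by
  obtain ⟨n, g, rfl⟩ := exists_mk₀ x
  rw [incl_mk, extRes_apply, Ext.mk₀_comp_mk₀, eps_mk, eps_mk]
  rfl

lemma eq_zero_of_module_injective {J : Type} [AddCommGroup J] [Module R J] [Module.Injective R J]
    (x : LC J I (i + 1)) : x = 0 :=
  have := Module.injective_object_of_injective_module R J
  eq_zero_of_injective x

end LC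

lemma exists_pow_smul_eq_zero_of_le_gam {I : Ideal R} [Module.Finite R A] (h : gam I A = ⊤) :
    ∃ n, ∀ r ∈ I ^ n, ∀ a : A, r • a = 0 := by
  obtain ⟨s, hs⟩ := (Module.Finite.fg_top : (⊤ : Submodule R A).FG)
  have : ∀ a : A, ∃ n, ∀ r ∈ I ^ n, r • a = 0 := fun a => by
    have : a ∈ gam I A := h ▸ trivial
    exact this
  choose n hn using this
  refine ⟨s.sup n, fun r hr a => ?_⟩
  have ha : a ∈ Submodule.span R (s : Set A) := hs ▸ trivial
  induction ha using Submodule.span_induction with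
  | mem x hx => exact hn x r (Ideal.pow_le_pow_right (Finset.le_sup hx) hr)
  | zero => simp
  | add x y _ _ hx hy => rw [smul_add, hx, hy, add_zero]
  | smul c x _ hx => rw [smul_comm, hx, smul_zero]

section Noetherian

variable [IsNoetherianRing R]

/-- Artin–Rees for two ideals. -/
lemma exists_pow_inf_le (I c : Ideal R) (n : ℕ) : ∃ m, I ^ m ⊓ c ≤ I ^ n * c := by
  obtain ⟨k, hk⟩ := Ideal.exists_pow_inf_eq_pow_smul I (M := R) c
  refine ⟨n + k, ?_⟩
  have := hk (n + k) (by lia)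
  rw [Nat.add_sub_cancel, smul_eq_mul, Ideal.mul_top] at this
  rw [this]
  exact Ideal.mul_mono le_rfl inf_le_right

instance gam_injective (I : Ideal R) {J : Type} [AddCommGroup J] [Module R J]
    [Module.Injective R J] : Module.Injective R (gam I J) := by
  apply Module.Baer.injective
  intro c g
  have hfin : Module.Finite R (LinearMap.range g) := inferInstance
  obtain ⟨n, hn⟩ := exists_pow_smul_eq_zero_of_le_gam (I := I) (A := LinearMap.range g) (by
    rw [eq_top_iff]
    rintro ⟨⟨a, ha⟩, ha'⟩ -
    obtain ⟨n, hn⟩ := ha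
    exact ⟨n, fun r hr => by ext; exact hn r hr⟩)
  have hn' : ∀ r ∈ I ^ n, ∀ x, g (r • x) = 0 := fun r hr x => by
    have := hn r hr ⟨g x, x, rfl⟩
    rw [map_smul]
    exact congrArg Subtype.val this
  obtain ⟨m, hm⟩ := exists_pow_inf_le I c n
  have key : ∀ x (hx : x ∈ c), x ∈ I ^ m → g ⟨x, hx⟩ = 0 := by
    intro x hx hxm
    have h1 : x ∈ I ^ n * c := hm ⟨hxm, hx⟩
    have h2 : ∀ y ∈ I ^ n * c, ∃ hy : y ∈ c, g ⟨y, hy⟩ = 0 := by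
      intro y hy
      induction hy using Submodule.mul_induction_on' with
      | mem_mul_mem r hr z hz => exact ⟨c.mul_mem_left r hz, hn' r hr ⟨z, hz⟩⟩
      | add y _ z _ h h' =>
        obtain ⟨hy, hy'⟩ := h
        obtain ⟨hz, hz'⟩ := h'
        refine ⟨c.add_mem hy hz, ?_⟩
        have := map_add g ⟨y, hy⟩ ⟨z, hz⟩
        rw [hy', hz', add_zero] at this
        exact this
    exact (h2 x h1).2
  obtain ⟨k, hk⟩ := exists_extension (R := R) (J := J) ((I ^ m).mkQ ∘ₗ c.subtype)
    ((gam I J).subtype ∘ₗ g) (by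
      rintro ⟨x, hx⟩ h
      simp only [LinearMap.mem_ker, LinearMap.comp_apply, Submodule.subtype_apply,
        Submodule.mkQ_apply, Submodule.Quotient.mk_eq_zero] at h
      simp [key x hx h])
  refine ⟨(k ∘ₗ (I ^ m).mkQ).codRestrict (gam I J) (fun x => ⟨m, fun r hr => ?_⟩), ?_⟩
  · rw [← map_smul]
    simp only [LinearMap.comp_apply]
    have : (I ^ m).mkQ (r • x) = 0 :=
      (Submodule.Quotient.mk_eq_zero _).2 ((I ^ m).mul_mem_right x hr)
    rw [this, map_zero]
  · intro x hx
    ext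
    exact hk ⟨x, hx⟩

namespace LC

variable {I : Ideal R}

lemma eq_zero_of_torsion (i : ℕ) : ∀ (A : Type) [AddCommGroup A] [Module R A]
    (_ : gam I A = ⊤) (x : LC A I (i + 1)), x = 0 := by
  induction i with
  | zero =>
    intro A _ _ hA x
    obtain ⟨J, _, _, _, f, hf⟩ := exists_injective_embedding (R := R) A
    have hmem : ∀ a, f a ∈ gam I J := fun a => by
      obtain ⟨n, hn⟩ : a ∈ gam I A := hA ▸ trivial
      exact ⟨n, fun r hr => by rw [← _root_.map_smul, hn r hr, _root_.map_zero]⟩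
    let f' := f.codRestrict (gam I J) hmem
    have hf' : Function.Injective f' := fun a b h => hf (congrArg Subtype.val h)
    have hex := LinearMap.exact_map_mkQ_range f'
    have hsurj := Submodule.mkQ_surjective (LinearMap.range f')
    obtain ⟨y, rfl⟩ := (exact₁ (I := I) (i := 0) hf' hex hsurj x).1
      (eq_zero_of_module_injective _)
    obtain ⟨z, hz⟩ := hsurj (eps I _ y)
    obtain ⟨w, hw⟩ := exists_eps_eq (I := I) (a := z) (by
      obtain ⟨n, hn⟩ := z.2
      exact ⟨n, fun r hr => by ext; exact hn r hr⟩)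
    rw [exact₃ (I := I) (i := 0) hf' hex hsurj y]
    exact ⟨w, eps_injective (by rw [eps_map, hw, hz])⟩
  | succ i ih =>
    intro A _ _ hA x
    obtain ⟨J, _, _, _, f, hf⟩ := exists_injective_embedding (R := R) A
    have hmem : ∀ a, f a ∈ gam I J := fun a => by
      obtain ⟨n, hn⟩ : a ∈ gam I A := hA ▸ trivial
      exact ⟨n, fun r hr => by rw [← _root_.map_smul, hn r hr, _root_.map_zero]⟩
    let f' := f.codRestrict (gam I J) hmem
    have hf' : Function.Injective f' := fun a b h => hf (congrArg Subtype.val h)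
    have hex := LinearMap.exact_map_mkQ_range f'
    have hsurj := Submodule.mkQ_surjective (LinearMap.range f')
    obtain ⟨y, rfl⟩ := (exact₁ (I := I) (i := i + 1) hf' hex hsurj x).1
      (eq_zero_of_module_injective _)
    rw [ih _ ?_ y, _root_.map_zero]
    rw [eq_top_iff]
    intro q _
    obtain ⟨z, rfl⟩ := hsurj q
    obtain ⟨n, hn⟩ := z.2
    exact ⟨n, fun r hr => by
      rw [← _root_.map_smul, show r • z = 0 by ext; exact hn r hr, _root_.map_zero]⟩

lemma injective_decomposition {J : Type} [AddCommGroup J] [Module R J] [Module.Injective R J]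
    (a₁ a₂ : Ideal R) (i : ℕ) (y : LC J (a₁ ⊓ a₂) i) :
    ∃ y₁ y₂, y = incl inf_le_left i J y₁ + incl inf_le_right i J y₂ := by
  cases i with
  | succ i => exact ⟨0, 0, by rw [eq_zero_of_module_injective y]; simp⟩
  | zero =>
    obtain ⟨n, hn⟩ := eps_mem y
    obtain ⟨m, hm⟩ := exists_pow_inf_le a₁ (a₂ ^ n) n
    rw [← mul_pow] at hm
    obtain ⟨k, hk⟩ := exists_extension (R := R) (J := J)
      ((a₁ ^ m).mkQ.prod (a₂ ^ n).mkQ) (LinearMap.toSpanSingleton R J (eps _ J y)) (by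
        intro r hr
        simp only [LinearMap.mem_ker, LinearMap.prod_apply, Function.prod_apply, Prod.mk_eq_zero,
          Submodule.mkQ_apply, Submodule.Quotient.mk_eq_zero] at hr
        rw [LinearMap.mem_ker, LinearMap.toSpanSingleton_apply]
        exact hn r (Ideal.pow_right_mono Ideal.mul_le_inf n (hm ⟨hr.1, hr.2⟩)))
    have h1 : k (Submodule.Quotient.mk 1, 0) ∈ gam a₁ J := ⟨m, fun r hr => by
      rw [← _root_.map_smul, Prod.smul_mk, ← Submodule.Quotient.mk_smul,
        (Submodule.Quotient.mk_eq_zero _).2 (by simpa using hr), smul_zero, Prod.mk_zero_zero,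
        _root_.map_zero]⟩
    have h2 : k (0, Submodule.Quotient.mk 1) ∈ gam a₂ J := ⟨n, fun r hr => by
      rw [← _root_.map_smul, Prod.smul_mk, ← Submodule.Quotient.mk_smul,
        (Submodule.Quotient.mk_eq_zero _).2 (by simpa using hr), smul_zero, Prod.mk_zero_zero,
        _root_.map_zero]⟩
    obtain ⟨y₁, hy₁⟩ := exists_eps_eq h1
    obtain ⟨y₂, hy₂⟩ := exists_eps_eq h2
    refine ⟨y₁, y₂, eps_injective ?_⟩
    rw [_root_.map_add, eps_incl, eps_incl, hy₁, hy₂, ← _root_.map_add]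
    have := hk 1
    simp only [LinearMap.toSpanSingleton_apply, one_smul] at this
    rw [← this]
    simp

/-- Middle exactness of the Mayer–Vietoris sequence. -/
lemma exists_of_incl_eq (a₁ a₂ : Ideal R) (i : ℕ) : ∀ (A : Type) [AddCommGroup A] [Module R A]
    (u : LC A a₁ i) (v : LC A a₂ i)
    (_ : incl (inf_le_left : a₁ ⊓ a₂ ≤ a₁) i A u = incl inf_le_right i A v),
    ∃ w : LC A (a₁ ⊔ a₂) i, incl le_sup_left i A w = u ∧ incl le_sup_right i A w = v := by
  induction i with
  | zero =>
    intro A _ _ u v h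
    have huv : eps a₁ A u = eps a₂ A v := by
      rw [← eps_incl (inf_le_left : a₁ ⊓ a₂ ≤ a₁), h, eps_incl]
    obtain ⟨n, hn⟩ := eps_mem u
    obtain ⟨m, hm⟩ := eps_mem v
    obtain ⟨w, hw⟩ := exists_eps_eq (I := a₁ ⊔ a₂) (a := eps a₁ A u) (by
      refine ⟨n + m, fun r hr => ?_⟩
      have := Ideal.sup_pow_add_le_pow_sup_pow hr
      obtain ⟨x, hx, y, hy, rfl⟩ := Submodule.mem_sup.1 this
      rw [add_smul, hn x hx, huv, hm y hy, add_zero])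
    exact ⟨w, eps_injective (by rw [eps_incl, hw]), eps_injective (by rw [eps_incl, hw, huv])⟩
  | succ i ih =>
    intro A _ _ u v h
    obtain ⟨J, _, _, _, f, hf⟩ := exists_injective_embedding (R := R) A
    have hex := LinearMap.exact_map_mkQ_range f
    have hsurj := Submodule.mkQ_surjective (LinearMap.range f)
    obtain ⟨u, rfl⟩ := (exact₁ hf hex hsurj u).1 (eq_zero_of_module_injective _)
    obtain ⟨v, rfl⟩ := (exact₁ hf hex hsurj v).1 (eq_zero_of_module_injective _)
    rw [incl_δ, incl_δ, ← sub_eq_zero, ← map_sub] at h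
    obtain ⟨y, hy⟩ := (exact₃ hf hex hsurj _).1 h
    obtain ⟨y₁, y₂, rfl⟩ := injective_decomposition a₁ a₂ i y
    obtain ⟨w, hw₁, hw₂⟩ := ih _ (u - map a₁ i (LinearMap.range f).mkQ y₁)
      (v + map a₂ i (LinearMap.range f).mkQ y₂) (by
        rw [map_sub, _root_.map_add, incl_map, incl_map, sub_eq_iff_eq_add, add_assoc,
          ← sub_eq_iff_eq_add', ← hy, _root_.map_add, add_comm])
    refine ⟨δ _ i hf hex hsurj w, ?_, ?_⟩
    · rw [incl_δ, hw₁, map_sub, (exact₃ hf hex hsurj).apply_apply_eq_zero, sub_zero]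
    · rw [incl_δ, hw₂, _root_.map_add, (exact₃ hf hex hsurj).apply_apply_eq_zero, add_zero]

end LC

end Noetherian

end TopLC

end

noncomputable section
open CategoryTheory

namespace TopLC

variable {R : Type} [CommRing R]

section dim

/-- Every prime in the support of `A` has coheight less than `n`. -/
def DimLT (R : Type) [CommRing R] (A : Type) [AddCommGroup A] [Module R A] (n : ℕ) : Prop :=
  ∀ p ∈ Module.support R A, Order.coheight p < (n : ℕ∞)

variable {A : Type} [AddCommGroup A] [Module R A]
variable {B : Type} [AddCommGroup B] [Module R B]
variable {C : Type} [AddCommGroup C] [Module R C]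

lemma DimLT.of_injective {n : ℕ} (h : DimLT R B n) (f : A →ₗ[R] B) (hf : Function.Injective f) :
    DimLT R A n :=
  fun p hp => h p (Module.support_subset_of_injective f hf hp)

lemma DimLT.of_surjective {n : ℕ} (h : DimLT R A n) (f : A →ₗ[R] B)
    (hf : Function.Surjective f) : DimLT R B n :=
  fun p hp => h p (Module.support_subset_of_surjective f hf hp)

lemma mem_support_quotient {p : Ideal R} {q : PrimeSpectrum R} :
    q ∈ Module.support R (R ⧸ p) ↔ p ≤ q.asIdeal := by
  rw [Module.mem_support_iff_of_finite, Ideal.annihilator_quotient]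

/-- The quotient of `A` by multiplication by `x`. -/
abbrev ModBy (x : R) (A : Type) [AddCommGroup A] [Module R A] : Type :=
  A ⧸ LinearMap.range (x • LinearMap.id : A →ₗ[R] A)

lemma mem_of_mem_support_modBy {x : R} {q : PrimeSpectrum R}
    (hq : q ∈ Module.support R (ModBy x A)) : x ∈ q.asIdeal := by
  refine Module.annihilator_le_of_mem_support hq ?_
  rw [Module.mem_annihilator]
  intro y
  obtain ⟨y, rfl⟩ := Submodule.mkQ_surjective _ y
  rw [← map_smul]
  exact (Submodule.Quotient.mk_eq_zero _).2 ⟨y, rfl⟩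

lemma smul_injective_quotient {p : Ideal R} [p.IsPrime] {x : R} (hx : x ∉ p) :
    Function.Injective (x • LinearMap.id : (R ⧸ p) →ₗ[R] (R ⧸ p)) := by
  rw [← LinearMap.ker_eq_bot, LinearMap.ker_eq_bot']
  intro y hy
  obtain ⟨y, rfl⟩ := Ideal.Quotient.mk_surjective y
  have : Ideal.Quotient.mk p (x * y) = 0 := hy
  rw [Ideal.Quotient.eq_zero_iff_mem] at this ⊢
  exact (Ideal.IsPrime.mem_or_mem ‹_› this).resolve_left hx

lemma DimLT.modBy {p : Ideal R} [p.IsPrime] {n : ℕ} (h : DimLT R (R ⧸ p) (n + 1)) {x : R}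
    (hx : x ∉ p) : DimLT R (ModBy x (R ⧸ p)) n := by
  intro q hq
  have hxq := mem_of_mem_support_modBy hq
  have hpq := mem_support_quotient.1
    (Module.support_subset_of_surjective _ (Submodule.mkQ_surjective _) hq)
  have hlt : (⟨p, inferInstance⟩ : PrimeSpectrum R) < q :=
    lt_of_le_of_ne hpq (by rintro rfl; exact hx hxq)
  have h1 := Order.coheight_add_one_le hlt
  have h2 := h ⟨p, inferInstance⟩ (mem_support_quotient.2 le_rfl)
  have h3 := h1.trans_lt h2
  push_cast at h3
  exact lt_of_add_lt_add_right h3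

lemma dimLT_zero_iff {A : Type} [AddCommGroup A] [Module R A] :
    DimLT R A 0 ↔ Subsingleton A := by
  rw [← Module.support_eq_empty_iff (R := R), Set.eq_empty_iff_forall_notMem]
  simp [DimLT]

lemma eq_maximalIdeal_of_coheight_lt_one [IsLocalRing R] {p : PrimeSpectrum R}
    (h : Order.coheight p < 1) : p.asIdeal = IsLocalRing.maximalIdeal R := by
  rw [Order.lt_one_iff, Order.coheight_eq_zero] at h
  exact le_antisymm (IsLocalRing.le_maximalIdeal p.2.ne_top)
    (h (b := IsLocalRing.closedPoint R) (IsLocalRing.le_maximalIdeal p.2.ne_top))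

end dim

namespace LC

variable {I : Ideal R} {i : ℕ}

section

variable {A : Type} [AddCommGroup A] [Module R A]

lemma eq_zero_of_subsingleton [Subsingleton A] (x : LC A I i) : x = 0 := by
  rw [← map_id x, Subsingleton.elim (LinearMap.id : A →ₗ[R] A) 0, map_zero]

lemma eq_zero_of_equiv {B : Type} [AddCommGroup B] [Module R B] (e : A ≃ₗ[R] B)
    (h : ∀ y : LC B I i, y = 0) (x : LC A I i) : x = 0 :=
  (congr I i e).injective ((h _).trans (h _).symm)

lemma exists_δ_eq_of_smul_eq_zero {x : R} (hx : Function.Injective (x • LinearMap.id : A →ₗ[R] A))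
    {z : LC A I (i + 1)} (hz : x • z = 0) :
    ∃ y, δ I i hx (LinearMap.exact_map_mkQ_range _) (Submodule.mkQ_surjective _) y = z :=
  (exact₁ hx _ _ _).1 (by rw [map_smul_id, hz])

lemma smul_injective_of_modBy {x : R} (hx : Function.Injective (x • LinearMap.id : A →ₗ[R] A))
    (h : ∀ y : LC (ModBy x A) I i, y = 0)
    {z : LC A I (i + 1)} (hz : x • z = 0) : z = 0 := by
  obtain ⟨y, rfl⟩ := exists_δ_eq_of_smul_eq_zero hx hz
  rw [h y, _root_.map_zero]

lemma smul_surjective_of_modBy {x : R} (hx : Function.Injective (x • LinearMap.id : A →ₗ[R] A))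
    (h : ∀ y : LC (ModBy x A) I i, y = 0) (z : LC A I i) : ∃ w, x • w = z := by
  obtain ⟨w, hw⟩ := (exact₂ hx (LinearMap.exact_map_mkQ_range _)
    (Submodule.mkQ_surjective _) z).1 (h _)
  exact ⟨w, by rw [← hw, map_smul_id]⟩

lemma eq_zero_of_forall_smul_injective {x : R} (hx : x ∈ I)
    (h : ∀ z : LC A I i, x • z = 0 → z = 0) (z : LC A I i) : z = 0 := by
  obtain ⟨n, hn⟩ := exists_pow_smul_eq_zero z
  have h1 := hn _ (Ideal.pow_mem_pow hx n)
  clear hn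
  induction n with
  | zero => simpa using h1
  | succ n ih =>
    rw [pow_succ', mul_smul] at h1
    exact ih (h _ h1)

lemma gam_eq_top_of_le {p : Ideal R} (h : I ≤ p) : gam I (R ⧸ p) = ⊤ := by
  rw [eq_top_iff]
  intro y _
  obtain ⟨y, rfl⟩ := Ideal.Quotient.mk_surjective y
  refine ⟨1, fun r hr => ?_⟩
  rw [pow_one] at hr
  exact Ideal.Quotient.eq_zero_iff_mem.2 (p.mul_mem_right y (h hr))

end

variable [IsNoetherianRing R]

/-- Grothendieck vanishing. -/
theorem eq_zero_of_dimLT (I : Ideal R) (n : ℕ) : ∀ (A : Type) [AddCommGroup A] [Module R A]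
    [Module.Finite R A] (_ : DimLT R A n) (i : ℕ) (_ : n ≤ i) (x : LC A I i), x = 0 := by
  induction n with
  | zero =>
    intro A _ _ _ h i _ x
    have := dimLT_zero_iff.1 h
    exact eq_zero_of_subsingleton x
  | succ n ih =>
    intro A _ _ _ h i hi x
    obtain ⟨j, rfl⟩ : ∃ j, i = j + 1 := ⟨i - 1, by lia⟩
    have hj : n ≤ j := by lia
    revert h x
    induction ‹Module.Finite R A› using IsNoetherianRing.induction_on_isQuotientEquivQuotientPrime R
      with
    | subsingleton N => exact fun _ x => eq_zero_of_subsingleton x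
    | quotient N p e =>
      intro h x
      refine eq_zero_of_equiv e ?_ x
      replace h := h.of_surjective e.toLinearMap e.surjective
      by_cases hI : I ≤ p.asIdeal
      · exact eq_zero_of_torsion _ _ (gam_eq_top_of_le hI)
      · obtain ⟨r, hr, hrp⟩ := SetLike.not_le_iff_exists.1 hI
        have hp := p.2
        exact eq_zero_of_forall_smul_injective hr fun z hz =>
          smul_injective_of_modBy (smul_injective_quotient hrp)
            (fun y => ih _ (h.modBy hrp) j hj y) hz
    | exact N₁ N₂ N₃ f g hf hg hfg h₁ h₃ =>
      intro h x
      obtain ⟨y, rfl⟩ := (exact₂ hf hfg hg x).1 (h₃ (h.of_surjective g hg) _)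
      rw [h₁ (h.of_injective f hf) y, _root_.map_zero]

lemma map_surjective_of_dimLT {A B : Type} [AddCommGroup A] [Module R A] [Module.Finite R A]
    [AddCommGroup B] [Module R B] {d : ℕ}
    (h : DimLT R A (d + 1)) (f : A →ₗ[R] B) (hf : Function.Surjective f) :
    Function.Surjective (map I d f) := by
  intro y
  have hex : Function.Exact (LinearMap.ker f).subtype f := f.exact_subtype_ker_map
  exact (exact₃ (Submodule.injective_subtype _) hex hf y).1
    (eq_zero_of_dimLT I (d + 1) _ (h.of_injective _ (Submodule.injective_subtype _)) _ le_rfl _)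

/-- In the top degree local cohomology for a smaller ideal is a quotient. -/
theorem incl_surjective [IsLocalRing R] {a b : Ideal R} (hab : b ≤ a) (ha : a ≠ ⊤) (d : ℕ) :
    ∀ (A : Type) [AddCommGroup A] [Module R A]
      [Module.Finite R A] (_ : DimLT R A (d + 1)) (y : LC A b d), ∃ x, incl hab d A x = y := by
  induction d with
  | zero =>
    intro A _ _ _ h
    induction ‹Module.Finite R A› using IsNoetherianRing.induction_on_isQuotientEquivQuotientPrime R
      with
    | subsingleton N => exact fun y => ⟨0, by rw [eq_zero_of_subsingleton y, _root_.map_zero]⟩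
    | quotient N p e =>
      intro y
      replace h := h.of_surjective e.toLinearMap e.surjective
      have hp : p.asIdeal = IsLocalRing.maximalIdeal R :=
        eq_maximalIdeal_of_coheight_lt_one (by simpa using h p (mem_support_quotient.2 le_rfl))
      obtain ⟨x, hx⟩ := exists_eps_eq (I := a) (a := eps b N y) (by
        have := gam_eq_top_of_le (I := a) (p := p.asIdeal) (hp ▸ IsLocalRing.le_maximalIdeal ha)
        obtain ⟨n, hn⟩ : e (eps b N y) ∈ gam a _ := this ▸ trivial
        exact ⟨n, fun r hr => e.injective (by rw [_root_.map_smul, hn r hr, _root_.map_zero])⟩)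
      exact ⟨x, eps_injective (by rw [eps_incl, hx])⟩
    | exact N₁ N₂ N₃ f g hf hg hfg h₁ h₃ =>
      intro y
      obtain ⟨z, hz⟩ := h₃ (h.of_surjective g hg) (map b _ g y)
      obtain ⟨w, rfl⟩ := map_surjective_of_dimLT h g hg z
      obtain ⟨u, hu⟩ := (exact₂ hf hfg hg (y - incl hab _ _ w)).1 (by
        rw [map_sub, ← hz, incl_map, sub_self])
      obtain ⟨v, rfl⟩ := h₁ (h.of_injective f hf) u
      exact ⟨map a _ f v + w, by rw [_root_.map_add, incl_map, hu, sub_add_cancel]⟩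
  | succ d ih =>
    intro A _ _ _ h
    induction ‹Module.Finite R A› using IsNoetherianRing.induction_on_isQuotientEquivQuotientPrime R
      with
    | subsingleton N => exact fun y => ⟨0, by rw [eq_zero_of_subsingleton y, _root_.map_zero]⟩
    | quotient N p e =>
      replace h := h.of_surjective e.toLinearMap e.surjective
      have hp := p.2
      suffices H : ∀ y : LC (R ⧸ p.asIdeal) b (d + 1), ∃ x, incl hab _ _ x = y by
        intro y
        obtain ⟨x, hx⟩ := H (map b _ e.toLinearMap y)
        refine ⟨map a _ e.symm.toLinearMap x, ?_⟩
        rw [incl_map, hx, ← map_comp]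
        simp [map_id]
      intro y
      by_cases hI : b ≤ p.asIdeal
      · exact ⟨0, by rw [eq_zero_of_torsion _ _ (gam_eq_top_of_le hI) y, _root_.map_zero]⟩
      · obtain ⟨r, hr, hrp⟩ := SetLike.not_le_iff_exists.1 hI
        obtain ⟨n, hn⟩ := exists_pow_smul_eq_zero y
        have hrn : r ^ n ∉ p.asIdeal := fun h => hrp (hp.mem_of_pow_mem n h)
        obtain ⟨z, rfl⟩ := exists_δ_eq_of_smul_eq_zero (smul_injective_quotient hrn)
          (hn _ (Ideal.pow_mem_pow hr n))
        obtain ⟨w, rfl⟩ := ih _ (h.modBy hrn) z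
        exact ⟨_, incl_δ hab _ _ _ w⟩
    | exact N₁ N₂ N₃ f g hf hg hfg h₁ h₃ =>
      intro y
      obtain ⟨z, hz⟩ := h₃ (h.of_surjective g hg) (map b _ g y)
      obtain ⟨w, rfl⟩ := map_surjective_of_dimLT h g hg z
      obtain ⟨u, hu⟩ := (exact₂ hf hfg hg (y - incl hab _ _ w)).1 (by
        rw [map_sub, ← hz, incl_map, sub_self])
      obtain ⟨v, rfl⟩ := h₁ (h.of_injective f hf) u
      exact ⟨map a _ f v + w, by rw [_root_.map_add, incl_map, hu, sub_add_cancel]⟩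

end LC

end TopLC

end

noncomputable section
open CategoryTheory

namespace TopLC

variable {R : Type} [CommRing R]

/-- Every module has an injective hull. -/
lemma exists_injective_hull (k : Type) [AddCommGroup k] [Module R k] :
    ∃ (E : Type) (_ : AddCommGroup E) (_ : Module R E) (_ : Module.Injective R E)
      (f : k →ₗ[R] E), Function.Injective f ∧
        ∀ e : E, e ≠ 0 → ∃ r : R, r • e ∈ LinearMap.range f ∧ r • e ≠ 0 := by
  obtain ⟨J, _, _, _, f, hf⟩ := exists_injective_embedding (R := R) k
  let Z : Set (Submodule R J) := {E | LinearMap.range f ≤ E ∧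
    ∀ e ∈ E, e ≠ 0 → ∃ r : R, r • e ∈ LinearMap.range f ∧ r • e ≠ 0}
  obtain ⟨E, hSE, hE⟩ := zorn_le_nonempty₀ Z (by
    intro c hc hchain y hy
    refine ⟨sSup c, ⟨(hc hy).1.trans (le_sSup hy), fun e he => ?_⟩, fun z hz => le_sSup hz⟩
    obtain ⟨z, hz, hez⟩ := (Submodule.mem_sSup_of_directed ⟨y, hy⟩ hchain.directedOn).1 he
    exact (hc hz).2 e hez) (LinearMap.range f) ⟨le_rfl, fun e he h0 => ⟨1, by simpa using he,
      by simpa using h0⟩⟩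
  let W : Set (Submodule R J) := {C | ∀ c ∈ C, c ∈ E → c = 0}
  obtain ⟨C, -, hC⟩ := zorn_le_nonempty₀ W (by
    intro c hc hchain y hy
    refine ⟨sSup c, fun e he => ?_, fun z hz => le_sSup hz⟩
    obtain ⟨z, hz, hez⟩ := (Submodule.mem_sSup_of_directed ⟨y, hy⟩ hchain.directedOn).1 he
    exact hc hz e hez) ⊥ (fun c hc _ => by simpa using hc)
  have hj : ∀ e : E, C.mkQ e = 0 → e = 0 := fun e he =>
    Subtype.ext (hC.1 e (by simpa using he) e.2)
  obtain ⟨h, hh⟩ := exists_extension (C.mkQ ∘ₗ E.subtype) E.subtype (by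
    intro e he
    rw [hj e he]
    exact zero_mem _)
  have hess : ∀ y : J ⧸ C, y ≠ 0 → ∃ (r : R) (e : E), e ≠ 0 ∧ r • y = C.mkQ e := by
    intro y hy
    obtain ⟨c, rfl⟩ := C.mkQ_surjective y
    have hc : c ∉ C := fun h => hy (by simpa using h)
    have : C ⊔ Submodule.span R {c} ∉ W := fun hW => hc (hC.2 hW le_sup_left
      (Submodule.mem_sup_right (Submodule.mem_span_singleton_self c)))
    simp only [W, Set.mem_ofPred_eq, not_forall] at this
    obtain ⟨e, he, heE, h0⟩ := this
    obtain ⟨a, ha, b, hb, rfl⟩ := Submodule.mem_sup.1 he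
    obtain ⟨r, rfl⟩ := Submodule.mem_span_singleton.1 hb
    refine ⟨r, ⟨_, heE⟩, fun h => h0 (congrArg Subtype.val h), ?_⟩
    have : C.mkQ a = 0 := by simpa using ha
    simp only [map_add, map_smul, this, zero_add]
  have hrange : LinearMap.range h ≤ E := by
    refine hE.2 ⟨hSE.trans fun e he => ⟨C.mkQ e, hh ⟨e, he⟩⟩, ?_⟩ fun e he => ⟨C.mkQ e, hh ⟨e, he⟩⟩
    rintro _ ⟨y, rfl⟩ hy
    obtain ⟨r, e, he, hre⟩ := hess y (by rintro rfl; simp at hy)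
    obtain ⟨s, hs, hs0⟩ := hE.1.2 e e.2 (by simpa using he)
    have h1 : (s * r) • h y = s • (e : J) := by
      rw [mul_smul, ← map_smul, hre]
      exact congrArg (s • ·) (hh e)
    exact ⟨s * r, h1 ▸ hs, h1 ▸ hs0⟩
  let ρ : J →ₗ[R] E := LinearMap.codRestrict E (h ∘ₗ C.mkQ) fun x => hrange ⟨_, rfl⟩
  have hρ : ∀ e : E, ρ e = e := fun e => Subtype.ext (hh e)
  refine ⟨E, inferInstance, inferInstance, ⟨fun X Y _ _ _ _ g hg u => ?_⟩,
    f.codRestrict E fun x => hSE ⟨x, rfl⟩, fun a b hab => hf (congrArg Subtype.val hab), ?_⟩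
  · obtain ⟨v, hv⟩ := Module.Injective.out g hg (E.subtype ∘ₗ u)
    exact ⟨ρ ∘ₗ v, fun x => by rw [LinearMap.comp_apply, hv]; exact hρ _⟩
  · intro e he
    obtain ⟨r, ⟨x, hx⟩, hr0⟩ := hE.1.2 e e.2 (by simpa using he)
    exact ⟨r, ⟨x, Subtype.ext hx⟩, fun h => hr0 (congrArg Subtype.val h)⟩

lemma exists_residue_hull (R : Type) [CommRing R] [IsLocalRing R] :
    ∃ (E : Type) (_ : AddCommGroup E) (_ : Module R E) (_ : Module.Injective R E)
      (f : (R ⧸ IsLocalRing.maximalIdeal R) →ₗ[R] E), Function.Injective f ∧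
        ∀ e : E, (∀ r ∈ IsLocalRing.maximalIdeal R, r • e = 0) → e ∈ LinearMap.range f := by
  obtain ⟨E, i1, i2, i3, f, hf, h⟩ :=
    exists_injective_hull (R := R) (R ⧸ IsLocalRing.maximalIdeal R)
  refine ⟨E, i1, i2, i3, f, hf, fun e he => ?_⟩
  by_cases h0 : e = 0
  · rw [h0]; exact zero_mem _
  obtain ⟨r, hr, hr0⟩ := h e h0
  have hu : IsUnit r := by
    by_contra hr'
    exact hr0 (he r ((IsLocalRing.mem_maximalIdeal r).2 hr'))
  obtain ⟨u, rfl⟩ := hu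
  simpa [smul_smul] using Submodule.smul_mem _ (↑u⁻¹ : R) hr

end TopLC

end

noncomputable section
open CategoryTheory

namespace TopLC

variable {R : Type} [CommRing R]
variable {A : Type} [AddCommGroup A] [Module R A]
variable {B : Type} [AddCommGroup B] [Module R B]
variable {C : Type} [AddCommGroup C] [Module R C]

/-- The length of the localization of `A` at the prime `p`. -/
def lam (p : PrimeSpectrum R) (A : Type) [AddCommGroup A] [Module R A] : ℕ∞ :=
  Module.length (Localization p.asIdeal.primeCompl) (LocalizedModule p.asIdeal.primeCompl A)

lemma lam_eq_add (p : PrimeSpectrum R) {f : A →ₗ[R] B} {g : B →ₗ[R] C}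
    (hf : Function.Injective f) (hfg : Function.Exact f g) (hg : Function.Surjective g) :
    lam p B = lam p A + lam p C :=
  Module.length_eq_add_of_exact (LocalizedModule.map p.asIdeal.primeCompl f)
    (LocalizedModule.map p.asIdeal.primeCompl g)
    (LocalizedModule.map_injective _ f hf) (LocalizedModule.map_surjective _ g hg)
    (LocalizedModule.map_exact p.asIdeal.primeCompl f g hfg)

lemma lam_le_of_injective (p : PrimeSpectrum R) (f : A →ₗ[R] B) (hf : Function.Injective f) :
    lam p A ≤ lam p B := by
  rw [lam_eq_add p hf (LinearMap.exact_map_mkQ_range f) (Submodule.mkQ_surjective _)]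
  exact le_self_add

lemma lam_le_of_surjective (p : PrimeSpectrum R) (f : A →ₗ[R] B) (hf : Function.Surjective f) :
    lam p B ≤ lam p A := by
  rw [lam_eq_add p (Submodule.subtype_injective _) (LinearMap.exact_subtype_ker_map f) hf]
  exact le_add_self

lemma lam_congr (p : PrimeSpectrum R) (e : A ≃ₗ[R] B) : lam p A = lam p B :=
  le_antisymm (lam_le_of_injective p e.toLinearMap e.injective)
    (lam_le_of_surjective p e.toLinearMap e.surjective)

lemma lam_le_add_of_exact (p : PrimeSpectrum R) {f : A →ₗ[R] B} {g : B →ₗ[R] C}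
    (hfg : Function.Exact f g) : lam p B ≤ lam p A + lam p C := by
  rw [lam_eq_add p (Submodule.subtype_injective _) (LinearMap.exact_subtype_ker_map g.rangeRestrict)
    g.surjective_rangeRestrict, LinearMap.ker_rangeRestrict, hfg.linearMap_ker_eq]
  exact add_le_add (lam_le_of_surjective p _ f.surjective_rangeRestrict)
    (lam_le_of_injective p _ (Submodule.subtype_injective _))

lemma lam_eq_zero_iff {p : PrimeSpectrum R} : lam p A = 0 ↔ p ∉ Module.support R A := by
  rw [lam, Module.length_eq_zero_iff, Module.notMem_support_iff]

lemma lam_quotient_self (p : PrimeSpectrum R) : lam p (R ⧸ p.asIdeal) = 1 := by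
  rw [lam, Module.length_eq_one_iff, isSimpleModule_iff_toSpanSingleton_surjective]
  refine ⟨Module.mem_support_iff.1 (mem_support_quotient.2 le_rfl), fun x hx y => ?_⟩
  induction x using LocalizedModule.induction_on with | _ a s
  induction y using LocalizedModule.induction_on with | _ b t
  obtain ⟨a, rfl⟩ := Ideal.Quotient.mk_surjective a
  obtain ⟨b, rfl⟩ := Ideal.Quotient.mk_surjective b
  have ha : a ∉ p.asIdeal := by
    intro ha
    rw [Ideal.Quotient.eq_zero_iff_mem.2 ha, LocalizedModule.zero_mk] at hx
    exact hx rfl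
  refine ⟨Localization.mk (s * b) (t * ⟨a, ha⟩), ?_⟩
  rw [LinearMap.toSpanSingleton_apply, LocalizedModule.mk_smul_mk, LocalizedModule.mk_eq]
  refine ⟨1, ?_⟩
  simp only [one_smul, Submonoid.smul_def, Submonoid.coe_mul, Algebra.smul_def,
    Ideal.Quotient.algebraMap_eq, ← map_mul]
  congr 1
  ring

lemma lam_lt_top [IsNoetherianRing R] [Module.Finite R A] (p : PrimeSpectrum R)
    (h : ∀ q ∈ Module.support R A, q ≤ p → q = p) : lam p A < ⊤ := by
  revert h
  induction ‹Module.Finite R A› using IsNoetherianRing.induction_on_isQuotientEquivQuotientPrime R with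
  | subsingleton N =>
    intro _
    rw [lam_eq_zero_iff.2]
    · simp
    · rw [Module.support_eq_empty]; simp
  | quotient N q e =>
    intro h
    rw [lam_congr p e]
    by_cases hq : q ≤ p
    · obtain rfl := h q (by rw [e.support_eq]; exact mem_support_quotient.2 le_rfl) hq
      rw [lam_quotient_self]
      exact ENat.natCast_lt_top 1
    · rw [lam_eq_zero_iff.2]
      · simp
      · exact fun h' => hq (mem_support_quotient.1 h')
  | exact N₁ N₂ N₃ f g hf hg hfg h₁ h₃ =>
    intro h
    rw [lam_eq_add p hf hfg hg]
    exact WithTop.add_lt_top.2 ⟨h₁ fun q hq => h q (Module.support_subset_of_injective f hf hq),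
      h₃ fun q hq => h q (Module.support_subset_of_surjective g hg hq)⟩

section mapQ

variable {P : Submodule R A} {Q : Submodule R B} {S : Submodule R C}
variable {f : A →ₗ[R] B} {g : B →ₗ[R] C}

lemma mapQ_injective (h : P ≤ Q.comap f) (h' : ∀ a, f a ∈ Q → a ∈ P) :
    Function.Injective (P.mapQ Q f h) := by
  rw [← LinearMap.ker_eq_bot, LinearMap.ker_eq_bot']
  intro a
  obtain ⟨a, rfl⟩ := P.mkQ_surjective a
  simpa using h' a

lemma mapQ_surjective (h : P ≤ Q.comap f) (h' : Function.Surjective f) :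
    Function.Surjective (P.mapQ Q f h) := by
  intro b
  obtain ⟨b, rfl⟩ := Q.mkQ_surjective b
  obtain ⟨a, rfl⟩ := h' b
  exact ⟨P.mkQ a, rfl⟩

lemma mapQ_exact (hf : P ≤ Q.comap f) (hg : Q ≤ S.comap g) (h : ∀ a, g (f a) ∈ S)
    (h' : ∀ b, g b ∈ S → ∃ a, b - f a ∈ Q) :
    Function.Exact (P.mapQ Q f hf) (Q.mapQ S g hg) := by
  intro b
  constructor
  · obtain ⟨b, rfl⟩ := Q.mkQ_surjective b
    intro hb
    obtain ⟨a, ha⟩ := h' b (by simpa using hb)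
    refine ⟨P.mkQ a, ?_⟩
    rw [← sub_eq_zero, ← neg_eq_zero, neg_sub]
    rw [← Submodule.Quotient.mk_eq_zero] at ha
    exact ha
  · rintro ⟨a, rfl⟩
    obtain ⟨a, rfl⟩ := P.mkQ_surjective a
    simpa using h a

end mapQ

lemma range_smul_le_comap (x : R) (f : A →ₗ[R] B) :
    LinearMap.range (x • LinearMap.id : A →ₗ[R] A) ≤
      (LinearMap.range (x • LinearMap.id : B →ₗ[R] B)).comap f := by
  rintro _ ⟨a, rfl⟩
  exact ⟨f a, by simp⟩

/-- If `A ⊆ B` has cokernel of finite length at `p`, then multiplication by `x` has the same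
multiplicity on `A` and `B`. -/
lemma lam_modBy_eq (p : PrimeSpectrum R) {x : R} (f : A →ₗ[R] B) (hf : Function.Injective f)
    (hx : Function.Injective (x • LinearMap.id : B →ₗ[R] B))
    (hfin : lam p (B ⧸ LinearMap.range f) < ⊤) : lam p (ModBy x B) = lam p (ModBy x A) := by
  let P : Submodule R B := LinearMap.range (x • f)
  have h1 : LinearMap.range f ≤ P.comap (x • LinearMap.id : B →ₗ[R] B) := by
    rintro _ ⟨a, rfl⟩
    exact ⟨a, rfl⟩
  have h2 : P ≤ (LinearMap.range (x • LinearMap.id : B →ₗ[R] B)).comap LinearMap.id := by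
    rintro _ ⟨a, rfl⟩
    exact ⟨f a, rfl⟩
  have h3 : LinearMap.range (x • LinearMap.id : A →ₗ[R] A) ≤ P.comap f := by
    rintro _ ⟨a, rfl⟩
    exact ⟨a, by simp⟩
  have h4 : P ≤ (LinearMap.range f).comap LinearMap.id := by
    rintro _ ⟨a, rfl⟩
    exact ⟨x • a, by simp⟩
  have e1 := lam_eq_add p (f := Submodule.mapQ _ _ _ h1) (g := Submodule.mapQ _ _ _ h2)
    (mapQ_injective _ fun b ⟨a, ha⟩ => ⟨a, hx ha⟩)
    (mapQ_exact _ _ (fun a => ⟨a, rfl⟩) fun b ⟨a, ha⟩ => ⟨a, by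
      have : b = x • a := ha.symm
      simp [this]⟩)
    (mapQ_surjective _ Function.surjective_id)
  have e2 := lam_eq_add p (f := Submodule.mapQ _ _ _ h3) (g := Submodule.mapQ _ _ _ h4)
    (mapQ_injective _ fun b ⟨a, ha⟩ => ⟨a, hf (by rw [← ha]; simp)⟩)
    (mapQ_exact _ _ (fun a => ⟨a, rfl⟩) fun b ⟨a, ha⟩ => ⟨a, by
      have : b = f a := ha.symm
      simp [this]⟩)
    (mapQ_surjective _ Function.surjective_id)
  rw [e1, add_comm (lam p (ModBy x A))] at e2
  exact (WithTop.add_left_inj hfin.ne).1 e2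

lemma lam_modBy_eq_add (p : PrimeSpectrum R) {x : R} {f : A →ₗ[R] B} {g : B →ₗ[R] C}
    (hf : Function.Injective f) (hfg : Function.Exact f g) (hg : Function.Surjective g)
    (hx : Function.Injective (x • LinearMap.id : C →ₗ[R] C)) :
    lam p (ModBy x B) = lam p (ModBy x A) + lam p (ModBy x C) :=
  lam_eq_add p (f := Submodule.mapQ _ _ f (range_smul_le_comap x f))
    (g := Submodule.mapQ _ _ g (range_smul_le_comap x g))
    (mapQ_injective _ (by
      rintro a ⟨b, hb⟩
      have hb' : x • b = f a := hb
      have : g b = 0 := hx (by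
        change x • g b = x • 0
        rw [← map_smul, hb', hfg.apply_apply_eq_zero, smul_zero])
      obtain ⟨c, rfl⟩ := (hfg b).1 this
      exact ⟨c, hf (by rw [← hb']; simp)⟩))
    (mapQ_exact _ _ (fun a => ⟨0, by simp [hfg.apply_apply_eq_zero]⟩) (by
      rintro b ⟨c, hc⟩
      obtain ⟨c, rfl⟩ := hg c
      have hc' : x • g c = g b := hc
      obtain ⟨a, ha⟩ := (hfg (b - x • c)).1 (by simp [hc'])
      exact ⟨a, c, by simp [ha]⟩))
    (mapQ_surjective _ hg)

end TopLC

end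

noncomputable section
open CategoryTheory

namespace TopLC

variable {R : Type} [CommRing R]
variable {X : Type} [AddCommGroup X] [Module R X]
variable {Y : Type} [AddCommGroup Y] [Module R Y]

/-- `X` is a torsion-free module over `R ⧸ q`. -/
structure TorsionFreeOver (q : Ideal R) (X : Type) [AddCommGroup X] [Module R X] : Prop where
  killed : ∀ r ∈ q, ∀ u : X, r • u = 0
  eq_zero : ∀ r ∉ q, ∀ u : X, r • u = 0 → u = 0

lemma TorsionFreeOver.of_injective {q : Ideal R} (h : TorsionFreeOver q Y) (f : X →ₗ[R] Y)
    (hf : Function.Injective f) : TorsionFreeOver q X where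
  killed r hr u := hf (by rw [map_smul, h.killed r hr, map_zero])
  eq_zero r hr u hu := hf (by rw [map_zero, h.eq_zero r hr (f u) (by rw [← map_smul, hu, map_zero])])

lemma TorsionFreeOver.smul_injective {q : Ideal R} (h : TorsionFreeOver q X) {x : R} (hx : x ∉ q) :
    Function.Injective (x • LinearMap.id : X →ₗ[R] X) := by
  rw [← LinearMap.ker_eq_bot, LinearMap.ker_eq_bot']
  exact fun u hu => h.eq_zero x hx u hu

/-- A nonzero element of a torsion-free module spans a copy of `R ⧸ q`. -/
lemma TorsionFreeOver.exists_injective {q : Ideal R} (h : TorsionFreeOver q X) {u : X}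
    (hu : u ≠ 0) : ∃ f : (R ⧸ q) →ₗ[R] X, Function.Injective f ∧ f 1 = u := by
  refine ⟨Submodule.liftQ q (LinearMap.toSpanSingleton R X u) fun r hr => by
    simpa using h.killed r hr u, ?_, ?_⟩
  · rw [← LinearMap.ker_eq_bot, LinearMap.ker_eq_bot']
    intro a ha
    obtain ⟨a, rfl⟩ := Ideal.Quotient.mk_surjective a
    by_contra hne
    exact hu (h.eq_zero a (fun h => hne (Ideal.Quotient.eq_zero_iff_mem.2 h)) u ha)
  · exact one_smul R u

lemma TorsionFreeOver.one_le_lam {q : PrimeSpectrum R} (h : TorsionFreeOver q.asIdeal X)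
    [Nontrivial X] : 1 ≤ lam q X := by
  obtain ⟨u, hu⟩ := exists_ne (0 : X)
  obtain ⟨f, hf, -⟩ := h.exists_injective hu
  rw [← lam_quotient_self q]
  exact lam_le_of_injective q f hf

lemma one_le_lam_modBy {q q₁ : PrimeSpectrum R} (hq : q ≤ q₁) {x : R} (hx : x ∈ q₁.asIdeal) :
    1 ≤ lam q₁ (ModBy x (R ⧸ q.asIdeal)) := by
  rw [← lam_quotient_self q₁]
  refine lam_le_of_surjective q₁ (Submodule.liftQ _
    (Submodule.mapQ q.asIdeal q₁.asIdeal LinearMap.id hq) ?_) ?_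
  · rintro _ ⟨a, rfl⟩
    obtain ⟨a, rfl⟩ := Ideal.Quotient.mk_surjective a
    exact Ideal.Quotient.eq_zero_iff_mem.2 (Ideal.mul_mem_right a _ hx)
  · intro a
    obtain ⟨a, rfl⟩ := Ideal.Quotient.mk_surjective a
    exact ⟨Submodule.mkQ _ (Ideal.Quotient.mk _ a), rfl⟩

variable [IsNoetherianRing R]

lemma exists_saturation {q : PrimeSpectrum R} (h : TorsionFreeOver q.asIdeal X) [Module.Finite R X]
    {u : X} (hu : u ≠ 0) : ∃ X₁ : Submodule R X, lam q X₁ = 1 ∧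
      TorsionFreeOver q.asIdeal (X ⧸ X₁) ∧
      ∀ q₁ : PrimeSpectrum R, (∀ p, q < p → p ≤ q₁ → p = q₁) → ∀ x ∉ q.asIdeal,
        lam q₁ (ModBy x X₁) = lam q₁ (ModBy x (R ⧸ q.asIdeal)) := by
  let X₁ : Submodule R X :=
    { carrier := {k | ∃ s ∉ q.asIdeal, s • k ∈ Submodule.span R {u}}
      zero_mem' := ⟨1, q.2.one_notMem, by simp⟩
      add_mem' := by
        rintro a b ⟨s, hs, ha⟩ ⟨t, ht, hb⟩
        refine ⟨s * t, fun h => (q.2.mem_or_mem h).elim hs ht, ?_⟩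
        rw [smul_add]
        refine add_mem ?_ ?_
        · rw [mul_comm, mul_smul]; exact Submodule.smul_mem _ t ha
        · rw [mul_smul]; exact Submodule.smul_mem _ s hb
      smul_mem' := by
        rintro r a ⟨s, hs, ha⟩
        exact ⟨s, hs, by rw [smul_comm]; exact Submodule.smul_mem _ r ha⟩ }
  have huX : u ∈ X₁ := ⟨1, q.2.one_notMem, by simp⟩
  have h₁ : TorsionFreeOver q.asIdeal X₁ := h.of_injective X₁.subtype (Submodule.subtype_injective _)
  obtain ⟨f, hf, hfu⟩ := h₁.exists_injective (u := ⟨u, huX⟩) (fun h => hu (congrArg Subtype.val h))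
  have hsupp : ∀ p ∈ Module.support R (X₁ ⧸ LinearMap.range f), q < p := by
    intro p hp
    have hann := Module.annihilator_le_of_mem_support hp
    have hqp : q ≤ p := fun r hr => hann (by
      rw [Module.mem_annihilator]
      intro y
      obtain ⟨y, rfl⟩ := Submodule.mkQ_surjective _ y
      rw [← map_smul, h₁.killed r hr, map_zero])
    refine lt_of_le_of_ne hqp ?_
    rintro rfl
    obtain ⟨y, hy⟩ := Module.mem_support_iff_exists_annihilator.1 hp
    obtain ⟨⟨y, s, hs, hsy⟩, rfl⟩ := Submodule.mkQ_surjective _ y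
    refine hs (hy ?_)
    rw [Submodule.mem_annihilator_span_singleton, ← map_smul, Submodule.mkQ_apply,
      Submodule.Quotient.mk_eq_zero]
    obtain ⟨r, hr⟩ := Submodule.mem_span_singleton.1 hsy
    exact ⟨r • 1, Subtype.ext (by rw [map_smul, hfu]; exact hr)⟩
  refine ⟨X₁, ?_, ⟨?_, ?_⟩, ?_⟩
  · rw [lam_eq_add q hf (LinearMap.exact_map_mkQ_range f) (Submodule.mkQ_surjective _),
      lam_quotient_self, lam_eq_zero_iff.2 fun h => lt_irrefl _ (hsupp q h), add_zero]
  · intro r hr y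
    obtain ⟨y, rfl⟩ := X₁.mkQ_surjective y
    rw [← map_smul, h.killed r hr, map_zero]
  · intro r hr y hy
    obtain ⟨y, rfl⟩ := X₁.mkQ_surjective y
    rw [← map_smul, Submodule.mkQ_apply, Submodule.Quotient.mk_eq_zero] at hy
    obtain ⟨s, hs, hsy⟩ := hy
    rw [Submodule.mkQ_apply, Submodule.Quotient.mk_eq_zero]
    exact ⟨s * r, fun h => (q.2.mem_or_mem h).elim hs hr, by rwa [mul_smul]⟩
  · intro q₁ hq₁ x hx
    exact lam_modBy_eq q₁ f hf (h₁.smul_injective hx)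
      (lam_lt_top q₁ fun p hp hpq => hq₁ p (hsupp p hp) hpq)

lemma TorsionFreeOver.le_lam_modBy {q q₁ : PrimeSpectrum R} (h : TorsionFreeOver q.asIdeal X)
    [Module.Finite R X] [Nontrivial X] (hq₁ : ∀ p, q < p → p ≤ q₁ → p = q₁) {x : R}
    (hx : x ∉ q.asIdeal) : lam q₁ (ModBy x (R ⧸ q.asIdeal)) ≤ lam q₁ (ModBy x X) := by
  obtain ⟨u, hu⟩ := exists_ne (0 : X)
  obtain ⟨X₁, -, htf, hX₁⟩ := exists_saturation h hu
  rw [lam_modBy_eq_add q₁ X₁.subtype_injective (LinearMap.exact_subtype_mkQ X₁)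
    X₁.mkQ_surjective (htf.smul_injective hx), hX₁ q₁ hq₁ x hx]
  exact le_self_add

lemma lam_modBy_lt_top {q q₁ : PrimeSpectrum R} (hq₁ : ∀ p, q < p → p ≤ q₁ → p = q₁) {x : R}
    (hx : x ∉ q.asIdeal) : lam q₁ (ModBy x (R ⧸ q.asIdeal)) < ⊤ := by
  refine lam_lt_top q₁ fun p hp hpq => hq₁ p (lt_of_le_of_ne ?_ ?_) hpq
  · exact mem_support_quotient.1 (Module.support_subset_of_surjective _
      (Submodule.mkQ_surjective _) hp)
  · rintro rfl
    exact hx (mem_of_mem_support_modBy hp)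

lemma TorsionFreeOver.lam_le_one {q q₁ : PrimeSpectrum R} (h : TorsionFreeOver q.asIdeal X)
    [Module.Finite R X] (hqq : q ≤ q₁) (hq₁ : ∀ p, q < p → p ≤ q₁ → p = q₁) {x : R}
    (hx : x ∉ q.asIdeal) (hx₁ : x ∈ q₁.asIdeal)
    (hle : lam q₁ (ModBy x X) ≤ lam q₁ (ModBy x (R ⧸ q.asIdeal))) : lam q X ≤ 1 := by
  cases subsingleton_or_nontrivial X
  · rw [lam_eq_zero_iff.2 (by rw [Module.support_eq_empty]; simp)]
    exact zero_le
  obtain ⟨u, hu⟩ := exists_ne (0 : X)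
  obtain ⟨X₁, h1, htf, hX₁⟩ := exists_saturation h hu
  have hsum := lam_modBy_eq_add q₁ X₁.subtype_injective (LinearMap.exact_subtype_mkQ X₁)
    X₁.mkQ_surjective (htf.smul_injective hx)
  rw [hX₁ q₁ hq₁ x hx] at hsum
  rw [lam_eq_add q X₁.subtype_injective (LinearMap.exact_subtype_mkQ X₁) X₁.mkQ_surjective, h1]
  cases subsingleton_or_nontrivial (X ⧸ X₁)
  · rw [lam_eq_zero_iff.2 (by rw [Module.support_eq_empty]; simp), add_zero]
  exfalso
  have h2 := htf.le_lam_modBy hq₁ hx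
  have h3 := one_le_lam_modBy hqq hx₁
  have h4 := lam_modBy_lt_top hq₁ hx
  rw [hsum] at hle
  lift lam q₁ (ModBy x (R ⧸ q.asIdeal)) to ℕ using h4.ne with l
  have := (add_le_add (le_refl (l : ℕ∞)) h2).trans hle
  norm_cast at this h3
  lia

end TopLC

end

noncomputable section
open CategoryTheory IsLocalRing

namespace TopLC

variable {R : Type} [CommRing R]

lemma isPrecomplete_pi (I : Ideal R) [IsPrecomplete I R] (k : ℕ) :
    IsPrecomplete I (Fin k → R) where
  prec' f hf := by
    have key : ∀ i, ∃ L : R, ∀ n, f n i ≡ L [SMOD (I ^ n • ⊤ : Submodule R R)] := fun i =>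
      IsPrecomplete.prec' (I := I) (fun n => f n i) fun {m n} hmn => by
        have := SModEq.map (hf hmn) (LinearMap.proj i : (Fin k → R) →ₗ[R] R)
        rw [Submodule.map_smul''] at this
        exact this.mono (Submodule.smul_mono le_rfl le_top)
    choose L hL using key
    refine ⟨L, fun n => ?_⟩
    rw [SModEq.sub_mem, pi_eq_sum_univ' (f n - L)]
    refine Submodule.sum_mem _ fun i _ => Submodule.smul_mem_smul ?_ trivial
    have := SModEq.sub_mem.1 (hL i n)
    rwa [smul_eq_mul, Ideal.mul_top] at this

/-- A Hausdorff module over an adically complete ring which is finitely generated modulo the ideal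
of definition is finitely generated. -/
lemma finite_of_finite_quotient {A : Type} [AddCommGroup A] [Module R A] (I : Ideal R)
    [IsPrecomplete I R] [IsHausdorff I A] [Module.Finite R (A ⧸ (I • ⊤ : Submodule R A))] :
    Module.Finite R A := by
  obtain ⟨k, g, hg⟩ := Module.Finite.exists_fin' R (A ⧸ (I • ⊤ : Submodule R A))
  obtain ⟨f, hf⟩ := Module.projective_lifting_property
    (Submodule.mkQ (I • ⊤ : Submodule R A)) g (Submodule.mkQ_surjective _)
  have := isPrecomplete_pi I k
  exact Module.Finite.of_surjective f (surjective_of_mkQ_comp_surjective (I := I) (by rwa [hf]))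

lemma finite_of_exact [IsNoetherianRing R] {A B C : Type} [AddCommGroup A] [Module R A]
    [AddCommGroup B] [Module R B] [AddCommGroup C] [Module R C] {f : A →ₗ[R] B} {g : B →ₗ[R] C}
    [Module.Finite R A] [Module.Finite R C] (h : Function.Exact f g) : Module.Finite R B := by
  have : Module.Finite R (LinearMap.ker g) := by
    rw [h.linearMap_ker_eq]; infer_instance
  have : Module.Finite R (B ⧸ LinearMap.ker g) := Module.Finite.equiv g.quotKerEquivRange.symm
  exact Module.Finite.of_submodule_quotient (LinearMap.ker g)

variable {E : Type} [AddCommGroup E] [Module R E]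

/-- Homs into an injective module turn exact sequences into exact sequences. -/
lemma exact_lcomp [Module.Injective R E] {A B C : Type} [AddCommGroup A] [Module R A]
    [AddCommGroup B] [Module R B] [AddCommGroup C] [Module R C] {f : A →ₗ[R] B} {g : B →ₗ[R] C}
    (h : Function.Exact f g) :
    Function.Exact (LinearMap.lcomp R E g) (LinearMap.lcomp R E f) := by
  intro k
  constructor
  · intro hk
    obtain ⟨l, hl⟩ := exists_extension g k (by
      rw [h.linearMap_ker_eq]
      rintro _ ⟨a, rfl⟩
      exact LinearMap.congr_fun hk a)
    exact ⟨l, LinearMap.ext hl⟩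
  · rintro ⟨l, rfl⟩
    ext a
    simp [h.apply_apply_eq_zero]

namespace LC

variable {A : Type} [AddCommGroup A] [Module R A]

lemma smul_eq_zero_of_killed {I : Ideal R} {i : ℕ} {r : R} (hr : ∀ a : A, r • a = 0)
    (z : LC A I i) : r • z = 0 := by
  rw [← map_smul_id, show (r • LinearMap.id : A →ₗ[R] A) = 0 from LinearMap.ext hr, map_zero]

lemma smul_surjective_of_notMem [IsNoetherianRing R] (I : Ideal R)
    {q : Ideal R} [q.IsPrime] {d : ℕ} (h : DimLT R (R ⧸ q) (d + 1)) {s : R} (hs : s ∉ q) (z : LC (R ⧸ q) I d) :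
    ∃ w, s • w = z :=
  smul_surjective_of_modBy (smul_injective_quotient hs)
    (eq_zero_of_dimLT I d _ (h.modBy hs) d le_rfl) z

end LC

end TopLC

end

noncomputable section
open CategoryTheory IsLocalRing

namespace TopLC

variable {R : Type} [CommRing R]

section general

variable {E : Type} [AddCommGroup E] [Module R E]
variable {A : Type} [AddCommGroup A] [Module R A]

/-- The dual of a local cohomology module of a quotient by a prime `q` is torsion-free over
`R ⧸ q` in the top degree. -/
lemma torsionFreeOver_dual [IsNoetherianRing R] (I : Ideal R) {q : Ideal R} [q.IsPrime] {d : ℕ}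
    (h : DimLT R (R ⧸ q) (d + 1)) : TorsionFreeOver q (LC (R ⧸ q) I d →ₗ[R] E) where
  killed r hr f := by
    ext z
    rw [LinearMap.smul_apply, ← map_smul, LC.smul_eq_zero_of_killed, map_zero, LinearMap.zero_apply]
    intro a
    obtain ⟨a, rfl⟩ := Ideal.Quotient.mk_surjective a
    exact Ideal.Quotient.eq_zero_iff_mem.2 (Ideal.mul_mem_right a _ hr)
  eq_zero r hr f hf := by
    ext z
    obtain ⟨w, rfl⟩ := LC.smul_surjective_of_notMem I h hr z
    rw [map_smul, ← LinearMap.smul_apply, hf, LinearMap.zero_apply, LinearMap.zero_apply]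

lemma isHausdorff_dual {I : Ideal R} {i : ℕ} : IsHausdorff I (LC A I i →ₗ[R] E) where
  haus' f hf := by
    ext z
    obtain ⟨n, hn⟩ := LC.exists_pow_smul_eq_zero z
    have h : f ∈ (I ^ n • ⊤ : Submodule R (LC A I i →ₗ[R] E)) := SModEq.zero.1 (hf n)
    clear hf
    induction h using Submodule.smul_induction_on' with
    | smul r hr g _ => rw [LinearMap.smul_apply, ← map_smul, hn r hr, map_zero, LinearMap.zero_apply]
    | add f _ g _ hf hg => rw [LinearMap.add_apply, hf, hg]; simp

/-- The dual of the connecting map for multiplication by `x` embeds `K / x K`. -/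
lemma exists_modBy_dual_injective [Module.Injective R E] (I : Ideal R) (i : ℕ) {x : R}
    (hx : Function.Injective (x • LinearMap.id : A →ₗ[R] A)) :
    ∃ f : ModBy x (LC A I (i + 1) →ₗ[R] E) →ₗ[R] (LC (ModBy x A) I i →ₗ[R] E),
      Function.Injective f := by
  have hex := exact_lcomp (E := E) (LC.exact₁ (I := I) (i := i) hx (LinearMap.exact_map_mkQ_range _)
    (Submodule.mkQ_surjective _))
  have hK : LinearMap.range (x • LinearMap.id : (LC A I (i + 1) →ₗ[R] E) →ₗ[R] _) =
      LinearMap.range (LinearMap.lcomp R E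
        (LC.map I (i + 1) (x • LinearMap.id : A →ₗ[R] A))) := by
    congr 1
    ext f z
    simp only [LinearMap.smul_apply, LinearMap.id_apply, LinearMap.lcomp_apply, LC.map_smul_id,
      map_smul]
  refine ⟨Submodule.liftQ _ _ (hK.trans hex.linearMap_ker_eq.symm).le, ?_⟩
  rw [← LinearMap.ker_eq_bot, Submodule.ker_liftQ_eq_bot]
  exact (hex.linearMap_ker_eq.trans hK.symm).le

end general

variable [IsLocalRing R] [IsNoetherianRing R]
variable {E : Type} [AddCommGroup E] [Module R E]

lemma dual_bound_zero {ι : (R ⧸ maximalIdeal R) →ₗ[R] E} (hι : Function.Injective ι)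
    (hsoc : ∀ e : E, (∀ r ∈ maximalIdeal R, r • e = 0) → e ∈ LinearMap.range ι)
    (q : PrimeSpectrum R) (hq : DimLT R (R ⧸ q.asIdeal) 1) :
    Module.Finite R (LC (R ⧸ q.asIdeal) (maximalIdeal R) 0 →ₗ[R] E) ∧
      ∀ p : PrimeSpectrum R,
        lam p (LC (R ⧸ q.asIdeal) (maximalIdeal R) 0 →ₗ[R] E) ≤ lam p (R ⧸ q.asIdeal) := by
  have hqm : q.asIdeal = maximalIdeal R :=
    eq_maximalIdeal_of_coheight_lt_one (hq q (mem_support_quotient.2 le_rfl))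
  rw [hqm]
  have hgam : gam (maximalIdeal R) (R ⧸ maximalIdeal R) = ⊤ := LC.gam_eq_top_of_le le_rfl
  obtain ⟨z, hz⟩ := LC.exists_eps_eq (I := maximalIdeal R) (A := R ⧸ maximalIdeal R) (a := 1)
    (hgam ▸ trivial)
  have hkill : ∀ r ∈ maximalIdeal R, r • z = 0 := fun r hr =>
    LC.smul_eq_zero_of_killed (fun a => by
      obtain ⟨a, rfl⟩ := Ideal.Quotient.mk_surjective a
      exact Ideal.Quotient.eq_zero_iff_mem.2 (Ideal.mul_mem_right a _ hr)) z
  let Φ : (LC (R ⧸ maximalIdeal R) (maximalIdeal R) 0 →ₗ[R] E) →ₗ[R] LinearMap.range ι :=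
    LinearMap.codRestrict _ (LinearMap.applyₗ z) fun f => hsoc _ fun r hr => by
      rw [LinearMap.applyₗ_apply_apply, ← map_smul, hkill r hr, map_zero]
  have hΦ : Function.Injective Φ := by
    rw [← LinearMap.ker_eq_bot, LinearMap.ker_eq_bot']
    intro f hf
    have hfz : f z = 0 := congrArg Subtype.val hf
    ext w
    obtain ⟨r, hr⟩ := Ideal.Quotient.mk_surjective (LC.eps _ _ w)
    have : w = r • z := LC.eps_injective (by
      rw [map_smul, hz, ← hr]
      exact (mul_one (Ideal.Quotient.mk (maximalIdeal R) r)).symm)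
    rw [this, map_smul, hfz, smul_zero, LinearMap.zero_apply]
  exact ⟨Module.Finite.of_injective Φ hΦ, fun p => (lam_le_of_injective p Φ hΦ).trans
    (lam_congr p (LinearEquiv.ofInjective ι hι)).ge⟩

variable [Module.Injective R E]

/-- If the duality bound holds for quotients by primes, it holds for all finite modules. -/
lemma dual_bound_of_quotient (d : ℕ)
    (h : ∀ q : PrimeSpectrum R, DimLT R (R ⧸ q.asIdeal) (d + 1) →
      Module.Finite R (LC (R ⧸ q.asIdeal) (maximalIdeal R) d →ₗ[R] E) ∧
      ∀ p : PrimeSpectrum R, Order.coheight p = d →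
        lam p (LC (R ⧸ q.asIdeal) (maximalIdeal R) d →ₗ[R] E) ≤ lam p (R ⧸ q.asIdeal))
    (N : Type) [AddCommGroup N] [Module R N] [Module.Finite R N] (hN : DimLT R N (d + 1)) :
    Module.Finite R (LC N (maximalIdeal R) d →ₗ[R] E) ∧
      ∀ p : PrimeSpectrum R, Order.coheight p = d →
        lam p (LC N (maximalIdeal R) d →ₗ[R] E) ≤ lam p N := by
  revert hN
  induction ‹Module.Finite R N› using IsNoetherianRing.induction_on_isQuotientEquivQuotientPrime R with
  | subsingleton N =>
    intro _
    have : Subsingleton (LC N (maximalIdeal R) d) :=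
      ⟨fun x y => (LC.eq_zero_of_subsingleton x).trans (LC.eq_zero_of_subsingleton y).symm⟩
    exact ⟨inferInstance, fun p _ => by
      rw [lam_eq_zero_iff.2 (by rw [Module.support_eq_empty]; simp)]; exact zero_le⟩
  | quotient N q e =>
    intro hN
    obtain ⟨h1, h2⟩ := h q (hN.of_surjective e.toLinearMap e.surjective)
    let c : (LC (R ⧸ q.asIdeal) (maximalIdeal R) d →ₗ[R] E) ≃ₗ[R]
        (LC N (maximalIdeal R) d →ₗ[R] E) :=
      LinearEquiv.congrLeft E R (LC.congr (maximalIdeal R) d e).symm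
    exact ⟨Module.Finite.equiv c, fun p hp => by rw [← lam_congr p c, lam_congr p e]; exact h2 p hp⟩
  | exact N₁ N₂ N₃ f g hf hg hfg h₁ h₃ =>
    intro hN
    obtain ⟨a1, b1⟩ := h₁ (hN.of_injective f hf)
    obtain ⟨a3, b3⟩ := h₃ (hN.of_surjective g hg)
    have hex := exact_lcomp (E := E) (LC.exact₂ (I := maximalIdeal R) (i := d) hf hfg hg)
    refine ⟨finite_of_exact hex, fun p hp => (lam_le_add_of_exact p hex).trans ?_⟩
    rw [lam_eq_add p hf hfg hg, add_comm]
    exact add_le_add (b1 p hp) (b3 p hp)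

variable [IsAdicComplete (maximalIdeal R) R]

/-- The dual of the top local cohomology of `N` with support in the maximal ideal is finitely
generated, and is at most as big as `N` at primes of top dimension. -/
theorem dual_bound {ι : (R ⧸ maximalIdeal R) →ₗ[R] E} (hι : Function.Injective ι)
    (hsoc : ∀ e : E, (∀ r ∈ maximalIdeal R, r • e = 0) → e ∈ LinearMap.range ι) (d : ℕ) :
    ∀ (N : Type) [AddCommGroup N] [Module R N] [Module.Finite R N] (_ : DimLT R N (d + 1)),
    Module.Finite R (LC N (maximalIdeal R) d →ₗ[R] E) ∧
      ∀ p : PrimeSpectrum R, Order.coheight p = d →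
        lam p (LC N (maximalIdeal R) d →ₗ[R] E) ≤ lam p N := by
  induction d with
  | zero =>
    intro N _ _ _ hN
    exact dual_bound_of_quotient 0 (fun q hq =>
      ⟨(dual_bound_zero hι hsoc q hq).1, fun p _ => (dual_bound_zero hι hsoc q hq).2 p⟩) N hN
  | succ d ih =>
    intro N _ _ _ hN
    refine dual_bound_of_quotient (d + 1) (fun q hq => ?_) N hN
    by_cases hlt : Order.coheight q < (d + 1 : ℕ)
    · have : Subsingleton (LC (R ⧸ q.asIdeal) (maximalIdeal R) (d + 1)) :=
        ⟨fun x y => by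
          have h0 := LC.eq_zero_of_dimLT (maximalIdeal R) (d + 1) (R ⧸ q.asIdeal)
            (fun p hp => (Order.coheight_anti (show q ≤ p from mem_support_quotient.1 hp)).trans_lt hlt) _ le_rfl
          rw [h0 x, h0 y]⟩
      exact ⟨inferInstance, fun p _ => by
        rw [lam_eq_zero_iff.2 (by rw [Module.support_eq_empty]; simp)]; exact zero_le⟩
    have hqd : Order.coheight q = ((d + 1 : ℕ) : ℕ∞) := by
      refine le_antisymm (Order.le_of_lt_add_one ?_) (not_lt.1 hlt)
      exact_mod_cast hq q (mem_support_quotient.2 le_rfl)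
    obtain ⟨q₁, hqq, hq₁⟩ := (Order.coheight_eq_coe_add_one_iff.1 (by exact_mod_cast hqd)).2.1
    have hbetween : ∀ p, q < p → p ≤ q₁ → p = q₁ := by
      intro p hp hpq
      by_contra hne
      have h1 := Order.coheight_add_one_le (lt_of_le_of_ne hpq hne)
      have h2 := Order.coheight_add_one_le hp
      rw [hq₁] at h1
      rw [hqd] at h2
      have := (add_le_add_left h1 1).trans h2
      norm_cast at this
      lia
    obtain ⟨x, hx₁, hx⟩ := SetLike.exists_of_lt (show q.asIdeal < q₁.asIdeal from hqq)
    have htf := torsionFreeOver_dual (E := E) (maximalIdeal R) hq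
    obtain ⟨hfin, hbound⟩ := ih (ModBy x (R ⧸ q.asIdeal)) (hq.modBy hx)
    obtain ⟨f, hf⟩ := exists_modBy_dual_injective (E := E) (A := R ⧸ q.asIdeal) (maximalIdeal R) d
      (smul_injective_quotient hx)
    have hmod : Module.Finite R
        (ModBy x (LC (R ⧸ q.asIdeal) (maximalIdeal R) (d + 1) →ₗ[R] E)) :=
      Module.Finite.of_injective f hf
    have := isHausdorff_dual (E := E) (A := R ⧸ q.asIdeal) (I := maximalIdeal R) (i := d + 1)
    have hmod' : Module.Finite R ((LC (R ⧸ q.asIdeal) (maximalIdeal R) (d + 1) →ₗ[R] E) ⧸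
        (maximalIdeal R • ⊤ : Submodule R (LC (R ⧸ q.asIdeal) (maximalIdeal R) (d + 1) →ₗ[R] E))) := by
      have hle : LinearMap.range (x • LinearMap.id : (LC (R ⧸ q.asIdeal) (maximalIdeal R) (d + 1)
          →ₗ[R] E) →ₗ[R] _) ≤ maximalIdeal R • ⊤ := by
        rintro _ ⟨g, rfl⟩
        exact Submodule.smul_mem_smul (le_maximalIdeal q₁.2.ne_top hx₁) trivial
      exact Module.Finite.of_surjective (Submodule.factor hle) (Submodule.factor_surjective hle)
    have hfinK := finite_of_finite_quotient (A := LC (R ⧸ q.asIdeal) (maximalIdeal R) (d + 1) →ₗ[R] E)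
      (maximalIdeal R)
    refine ⟨hfinK, fun p hp => ?_⟩
    by_cases hpq : p = q
    · subst hpq
      rw [lam_quotient_self]
      exact htf.lam_le_one hqq.le hbetween hx hx₁
        ((lam_le_of_injective q₁ f hf).trans (hbound q₁ hq₁))
    · rw [lam_eq_zero_iff.2]
      · exact zero_le
      intro hsupp
      have hle : q ≤ p := fun r hr => Module.annihilator_le_of_mem_support hsupp
        (Module.mem_annihilator.2 (htf.killed r hr))
      have := Order.coheight_add_one_le (lt_of_le_of_ne hle (Ne.symm hpq))
      rw [hp, hqd] at this
      norm_cast at this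
      lia

end TopLC

end

noncomputable section
open CategoryTheory IsLocalRing

namespace TopLC

variable {R : Type} [CommRing R] [IsLocalRing R]

lemma nontrivial_dual {E : Type} [AddCommGroup E] [Module R E] [Module.Injective R E]
    {ι : (R ⧸ maximalIdeal R) →ₗ[R] E} (hι : Function.Injective ι)
    (Q : Type) [AddCommGroup Q] [Module R Q] [Nontrivial Q] : Nontrivial (Q →ₗ[R] E) := by
  obtain ⟨y, hy⟩ := exists_ne (0 : Q)
  obtain ⟨k, hk⟩ := exists_extension (LinearMap.toSpanSingleton R Q y)
    (ι ∘ₗ Submodule.mkQ (maximalIdeal R)) (by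
      refine le_trans (le_maximalIdeal ?_) ?_
      · rw [Ideal.ne_top_iff_one]
        simpa using hy
      · intro r hr
        rw [LinearMap.mem_ker, LinearMap.comp_apply, Submodule.mkQ_apply,
          (Submodule.Quotient.mk_eq_zero _).2 hr, map_zero])
  refine ⟨k, 0, fun h => ?_⟩
  have h1 := hk 1
  rw [h, LinearMap.zero_apply, LinearMap.comp_apply] at h1
  have h2 := hι (h1.symm.trans (map_zero ι).symm)
  rw [Submodule.mkQ_apply, Submodule.Quotient.mk_eq_zero, ← Ideal.eq_top_iff_one] at h2
  exact Ideal.IsPrime.ne_top' h2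

variable [IsNoetherianRing R] [IsAdicComplete (maximalIdeal R) R]

/-- The top local cohomology of a complete local domain with support in the maximal ideal does not
map onto a nontrivial product. -/
theorem not_surjective_prod {q : PrimeSpectrum R} {d : ℕ} (hq : Order.coheight q = d)
    {Q₁ Q₂ : Type} [AddCommGroup Q₁] [Module R Q₁] [AddCommGroup Q₂] [Module R Q₂]
    [Nontrivial Q₁] [Nontrivial Q₂]
    (ψ : LC (R ⧸ q.asIdeal) (maximalIdeal R) d →ₗ[R] Q₁ × Q₂) : ¬ Function.Surjective ψ := by
  intro hψ
  obtain ⟨E, _, _, _, ι, hι, hsoc⟩ := exists_residue_hull R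
  have hdim : DimLT R (R ⧸ q.asIdeal) (d + 1) := fun p hp => by
    refine (Order.coheight_anti (show q ≤ p from mem_support_quotient.1 hp)).trans_lt ?_
    rw [hq]
    exact_mod_cast Nat.lt_succ_self d
  have htf := torsionFreeOver_dual (E := E) (maximalIdeal R) hdim
  have := nontrivial_dual (E := E) hι Q₁
  have := nontrivial_dual (E := E) hι Q₂
  have inj : ∀ {Q : Type} [AddCommGroup Q] [Module R Q]
      (g : LC (R ⧸ q.asIdeal) (maximalIdeal R) d →ₗ[R] Q), Function.Surjective g →
      Function.Injective (LinearMap.lcomp R E g) := fun g hg a b hab => by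
    ext y
    obtain ⟨z, rfl⟩ := hg y
    exact LinearMap.congr_fun hab z
  have h₁ := (htf.of_injective _ (inj (LinearMap.fst R Q₁ Q₂ ∘ₗ ψ)
    ((LinearMap.fst_surjective (R := R)).comp hψ))).one_le_lam
  have h₂ := (htf.of_injective _ (inj (LinearMap.snd R Q₁ Q₂ ∘ₗ ψ)
    ((LinearMap.snd_surjective (R := R)).comp hψ))).one_le_lam
  have hle := (dual_bound hι hsoc d _ hdim).2 q hq
  rw [lam_quotient_self] at hle
  have hprod := (lam_congr q (LinearMap.coprodEquiv R (M := Q₁) (M₂ := Q₂) (M₃ := E))).le.trans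
    ((lam_le_of_injective q _ (inj ψ hψ)).trans hle)
  rw [lam_eq_add q (LinearMap.inl_injective (R := R) (M₂ := Q₂ →ₗ[R] E)) .inl_snd
    LinearMap.snd_surjective] at hprod
  have := (add_le_add h₁ h₂).trans hprod
  norm_cast at this

/-- Nonvanishing of the top local cohomology of a complete local domain with respect to two ideals
implies nonvanishing with respect to their intersection. -/
theorem nontrivial_inf {q : PrimeSpectrum R} {d : ℕ} (hq : Order.coheight q = d)
    (a₁ a₂ : Ideal R) [Nontrivial (LC (R ⧸ q.asIdeal) a₁ d)]
    [Nontrivial (LC (R ⧸ q.asIdeal) a₂ d)] : Nontrivial (LC (R ⧸ q.asIdeal) (a₁ ⊓ a₂) d) := by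
  by_contra hnt
  rw [not_nontrivial_iff_subsingleton] at hnt
  have hMV := fun u v => LC.exists_of_incl_eq a₁ a₂ d (R ⧸ q.asIdeal) u v (Subsingleton.elim _ _)
  by_cases htop : a₁ ⊔ a₂ = ⊤
  · obtain ⟨u, hu⟩ := exists_ne (0 : LC (R ⧸ q.asIdeal) a₁ d)
    obtain ⟨w, rfl, -⟩ := hMV u 0
    have hw : ∀ (c : Ideal R) (_ : c = ⊤) (w : LC (R ⧸ q.asIdeal) c d), w = 0 := by
      rintro _ rfl w
      exact LC.eq_zero_of_top w
    exact hu (by rw [hw _ htop w, map_zero])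
  have hdim : DimLT R (R ⧸ q.asIdeal) (d + 1) := fun p hp => by
    refine (Order.coheight_anti (show q ≤ p from mem_support_quotient.1 hp)).trans_lt ?_
    rw [hq]
    exact_mod_cast Nat.lt_succ_self d
  refine not_surjective_prod hq (((LC.incl le_sup_left d (R ⧸ q.asIdeal)).prod
    (LC.incl (le_sup_right : a₂ ≤ a₁ ⊔ a₂) d _)) ∘ₗ LC.incl (le_maximalIdeal htop) d _) ?_
  rintro ⟨u, v⟩
  obtain ⟨w, hu, hv⟩ := hMV u v
  obtain ⟨z, rfl⟩ := LC.incl_surjective (le_maximalIdeal htop) Ideal.IsPrime.ne_top' d _ hdim w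
  exact ⟨z, Prod.ext hu hv⟩

end TopLC

end

noncomputable section
open CategoryTheory IsLocalRing

namespace TopLC

variable {R : Type} [CommRing R]
variable {X : Type} [AddCommGroup X] [Module R X]
variable {Y : Type} [AddCommGroup Y] [Module R Y]

lemma radical_annihilator_map_eq {N : Submodule R X} {p : Ideal R} (h : Paper.IsSecondaryFor R N p)
    (f : X →ₗ[R] Y) (hne : N.map f ≠ ⊥) : (N.map f).annihilator.radical = p := by
  rw [← h.2.2]
  apply le_antisymm
  · intro r hr
    rcases h.2.1 r with hsurj | ⟨k, hk⟩
    · exfalso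
      obtain ⟨k, hk⟩ := hr
      have hpow : ∀ (k : ℕ), ∀ m ∈ N, ∃ n ∈ N, r ^ k • n = m := by
        intro k
        induction k with
        | zero => exact fun m hm => ⟨m, hm, by simp⟩
        | succ k ih =>
          intro m hm
          obtain ⟨m', hm', rfl⟩ := hsurj m hm
          obtain ⟨n, hn, rfl⟩ := ih m' hm'
          exact ⟨n, hn, by rw [pow_succ', mul_smul]⟩
      refine hne ((Submodule.eq_bot_iff _).2 ?_)
      rintro _ ⟨m, hm, rfl⟩
      obtain ⟨n, hn, rfl⟩ := hpow k m hm
      rw [map_smul]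
      exact Submodule.mem_annihilator.1 hk _ (Submodule.mem_map_of_mem hn)
    · exact ⟨k, Submodule.mem_annihilator.2 hk⟩
  · refine Ideal.radical_mono fun r hr => Submodule.mem_annihilator.2 ?_
    rintro _ ⟨m, hm, rfl⟩
    rw [← map_smul, Submodule.mem_annihilator.1 hr m hm, map_zero]

lemma isSecondaryFor_map {N : Submodule R X} {p : Ideal R} (h : Paper.IsSecondaryFor R N p)
    (f : X →ₗ[R] Y) (hne : N.map f ≠ ⊥) : Paper.IsSecondaryFor R (N.map f) p := by
  refine ⟨hne, fun r => (h.2.1 r).imp ?_ ?_, radical_annihilator_map_eq h f hne⟩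
  · rintro hr _ ⟨m, hm, rfl⟩
    obtain ⟨n, hn, rfl⟩ := hr m hm
    exact ⟨f n, Submodule.mem_map_of_mem hn, by rw [map_smul]⟩
  · rintro ⟨k, hk⟩
    refine ⟨k, ?_⟩
    rintro _ ⟨m, hm, rfl⟩
    rw [← map_smul, hk m hm, map_zero]

/-- A quotient of a module with a minimal secondary representation has one. -/
lemma nonempty_minSecRep_of_surjective (rep : Paper.MinSecRep R X) (f : X →ₗ[R] Y)
    (hf : Function.Surjective f) : Nonempty (Paper.MinSecRep R Y) := by
  let P : Finset (Fin rep.n) → Prop := fun s => ⨆ i ∈ s, (rep.S i).map f = ⊤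
  have huniv : P Finset.univ := by
    simp only [P, Finset.mem_univ, iSup_pos]
    rw [← Submodule.map_iSup, rep.sum, Submodule.map_top, LinearMap.range_eq_top.2 hf]
  obtain ⟨s, -, hs, hmin⟩ := exists_minimal_le_of_wellFoundedLT P Finset.univ huniv
  have hirr : ∀ j ∈ s, ¬ (rep.S j).map f ≤ ⨆ i ∈ s.erase j, (rep.S i).map f := by
    intro j hj hle
    have : P (s.erase j) := by
      refine eq_top_iff.2 (hs.ge.trans (iSup₂_le fun i hi => ?_))
      by_cases hij : i = j
      · exact hij ▸ hle
      · exact le_iSup₂_of_le i (Finset.mem_erase.2 ⟨hij, hi⟩) le_rfl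
    exact Finset.notMem_erase j s (hmin this (Finset.erase_subset j s) hj)
  let e := s.equivFin.symm
  refine ⟨⟨s.card, fun i => (rep.S (e i)).map f, fun i => rep.p (e i), fun i => rep.prime _,
    fun i => isSecondaryFor_map (rep.sec _) f fun h0 => hirr _ (e i).2 (h0 ▸ bot_le), ?_,
    fun i j hij => e.injective (Subtype.ext (rep.inj hij)), fun j hj => hirr _ (e j).2
      (hj.trans (iSup₂_le fun i hi => le_iSup₂_of_le (e i : Fin rep.n)
        (Finset.mem_erase.2 ⟨fun h => hi (e.injective (Subtype.ext h)), (e i).2⟩) le_rfl))⟩⟩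
  refine eq_top_iff.2 (hs.ge.trans (iSup₂_le fun i hi => ?_))
  refine le_iSup_of_le (e.symm ⟨i, hi⟩) ?_
  rw [e.apply_symm_apply]

/-- A prime is attached to a representable module iff it is the radical of the annihilator of some
quotient. -/
lemma exists_quotient_of_mem_attached {q : Ideal R} (hq : q ∈ Paper.attached R X) :
    q.IsPrime ∧ Nonempty (Paper.MinSecRep R X) ∧
      ∃ P : Submodule R X, (Module.annihilator R (X ⧸ P)).radical = q := by
  obtain ⟨rep, j, rfl⟩ := hq
  refine ⟨rep.prime j, ⟨rep⟩, ⨆ i ∈ ({j}ᶜ : Set (Fin rep.n)), rep.S i, ?_⟩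
  set P := ⨆ i ∈ ({j}ᶜ : Set (Fin rep.n)), rep.S i with hP
  have htop : (rep.S j).map P.mkQ = ⊤ := by
    rw [eq_top_iff, ← LinearMap.range_eq_top.2 P.mkQ_surjective, ← Submodule.map_top, ← rep.sum,
      Submodule.map_iSup]
    refine iSup_le fun i => ?_
    by_cases hij : i = j
    · rw [hij]
    · refine le_trans (le_of_eq ?_) bot_le
      rw [← le_bot_iff, Submodule.map_le_iff_le_comap, Submodule.comap_bot, Submodule.ker_mkQ]
      exact le_iSup₂_of_le i hij le_rfl
  rw [← Submodule.annihilator_top, ← htop]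
  refine radical_annihilator_map_eq (rep.sec j) _ fun h0 => rep.irred j ?_
  rwa [← le_bot_iff, Submodule.map_le_iff_le_comap, Submodule.comap_bot, Submodule.ker_mkQ] at h0

lemma mem_attached_of_surjective {q : Ideal R} (hq : q.IsPrime) (rep : Paper.MinSecRep R X)
    (f : X →ₗ[R] Y) (hf : Function.Surjective f) (hY : (Module.annihilator R Y).radical = q) :
    q ∈ Paper.attached R X := by
  have htop : (⨆ i, (rep.S i).map f) = ⊤ := by
    rw [← Submodule.map_iSup, rep.sum, Submodule.map_top, LinearMap.range_eq_top.2 hf]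
  have hann : Finset.univ.inf (fun i => ((rep.S i).map f).annihilator) ≤ q := by
    rw [Finset.inf_univ_eq_iInf, ← Submodule.annihilator_iSup, htop, Submodule.annihilator_top,
      ← hY]
    exact Ideal.le_radical
  obtain ⟨i, -, hi⟩ := (Ideal.IsPrime.inf_le' hq).1 hann
  have hne : (rep.S i).map f ≠ ⊥ := by
    intro h0
    rw [h0, Submodule.annihilator_bot] at hi
    exact hq.ne_top (top_le_iff.1 hi)
  have hrad := radical_annihilator_map_eq (rep.sec i) f hne
  refine ⟨rep, i, le_antisymm ?_ ?_⟩
  · rw [← hrad]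
    exact hq.radical_le_iff.2 hi
  · rw [← hrad, ← hY, ← Submodule.annihilator_top]
    exact Ideal.radical_mono (Submodule.annihilator_mono le_top)

lemma attached_subset_of_equiv (e : X ≃ₗ[R] Y) : Paper.attached R X ⊆ Paper.attached R Y := by
  intro q hq
  obtain ⟨hprime, ⟨rep⟩, P, hP⟩ := exists_quotient_of_mem_attached hq
  obtain ⟨rep'⟩ := nonempty_minSecRep_of_surjective rep e.toLinearMap e.surjective
  exact mem_attached_of_surjective hprime rep' (P.mkQ ∘ₗ e.symm.toLinearMap)
    (P.mkQ_surjective.comp e.symm.surjective) hP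

lemma attached_eq_of_equiv (e : X ≃ₗ[R] Y) : Paper.attached R X = Paper.attached R Y :=
  (attached_subset_of_equiv e).antisymm (attached_subset_of_equiv e.symm)

end TopLC

end

noncomputable section
open CategoryTheory IsLocalRing

namespace TopLC

variable {R : Type} [CommRing R]

lemma exists_factor {A B C : Type} [AddCommGroup A] [Module R A] [AddCommGroup B] [Module R B]
    [AddCommGroup C] [Module R C] (g : A →ₗ[R] B) (hg : Function.Surjective g) (φ : A →ₗ[R] C)
    (h : ∀ x, g x = 0 → φ x = 0) : ∃ k : B →ₗ[R] C, ∀ x, k (g x) = φ x := by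
  refine ⟨(Submodule.liftQ (LinearMap.ker g) φ h) ∘ₗ
    (g.quotKerEquivOfSurjective hg).symm.toLinearMap, fun x => ?_⟩
  have : (g.quotKerEquivOfSurjective hg).symm (g x) = Submodule.Quotient.mk x := by
    rw [LinearEquiv.symm_apply_eq]
    rfl
  rw [LinearMap.comp_apply, LinearEquiv.coe_coe, this]
  rfl

lemma attached_eq_empty {X : Type} [AddCommGroup X] [Module R X] [Subsingleton X] :
    Paper.attached R X = ∅ := by
  refine Set.eq_empty_iff_forall_notMem.2 ?_
  rintro _ ⟨rep, i, -⟩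
  exact (rep.sec i).1 (Subsingleton.elim _ _)

lemma nontrivial_of_radical_annihilator {Y : Type} [AddCommGroup Y] [Module R Y]
    {q : PrimeSpectrum R} (hY : (Module.annihilator R Y).radical = q.asIdeal) : Nontrivial Y := by
  by_contra h
  rw [not_nontrivial_iff_subsingleton] at h
  refine q.2.ne_top ?_
  rw [← hY, Module.annihilator_eq_top_iff.2 h, Ideal.radical_top]

lemma radical_annihilator_or {Y : Type} [AddCommGroup Y] [Module R Y] (P : Submodule R Y)
    {q : PrimeSpectrum R} (hY : (Module.annihilator R Y).radical = q.asIdeal) :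
    (Module.annihilator R P).radical = q.asIdeal ∨
      (Module.annihilator R (Y ⧸ P)).radical = q.asIdeal := by
  have h₁ : Module.annihilator R Y ≤ Module.annihilator R P :=
    LinearMap.annihilator_le_of_injective P.subtype P.subtype_injective
  have h₂ : Module.annihilator R Y ≤ Module.annihilator R (Y ⧸ P) :=
    LinearMap.annihilator_le_of_surjective P.mkQ P.mkQ_surjective
  have hmul : Module.annihilator R P * Module.annihilator R (Y ⧸ P) ≤ q.asIdeal := by
    refine le_trans ?_ (Ideal.le_radical.trans hY.le)
    refine Ideal.mul_le.2 fun r hr s hs => Module.mem_annihilator.2 fun y => ?_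
    have hsy : s • y ∈ P := by
      rw [← Submodule.Quotient.mk_eq_zero, Submodule.Quotient.mk_smul]
      exact Module.mem_annihilator.1 hs _
    rw [mul_smul]
    exact congrArg Subtype.val (Module.mem_annihilator.1 hr ⟨s • y, hsy⟩)
  refine (q.2.mul_le.1 hmul).imp (fun h => ?_) (fun h => ?_)
  · exact le_antisymm (q.2.radical_le_iff.2 h) (hY ▸ Ideal.radical_mono h₁)
  · exact le_antisymm (q.2.radical_le_iff.2 h) (hY ▸ Ideal.radical_mono h₂)

lemma dimLT_quotient_prime {q : PrimeSpectrum R} {d : ℕ} (hq : Order.coheight q = d) :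
    DimLT R (R ⧸ q.asIdeal) (d + 1) := fun p hp =>
  (Order.coheight_anti (show q ≤ p from mem_support_quotient.1 hp)).trans_lt (by
    rw [hq]; exact_mod_cast d.lt_succ_self)

lemma dimLT_of_dimMod_eq {M : Type} [AddCommGroup M] [Module R M] {d : ℕ}
    (hdim : Paper.dimMod R M = d) : DimLT R M (d + 1) := by
  intro p hp
  refine lt_of_le_of_lt ?_ (show (d : ℕ∞) < (d + 1 : ℕ) by exact_mod_cast d.lt_succ_self)
  let S := {I : Ideal R // I.IsPrime ∧ Module.annihilator R M ≤ I}
  have hann := Module.annihilator_le_of_mem_support hp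
  have h1 : (Order.coheight (⟨p.asIdeal, p.2, hann⟩ : S) : WithBot ℕ∞) ≤ d := by
    rw [← hdim]
    exact Order.coheight_le_krullDim _
  have h2 : Order.coheight p ≤ Order.coheight (⟨p.asIdeal, p.2, hann⟩ : S) := by
    refine Order.coheight_le fun s hs => ?_
    have hle : ∀ i, p ≤ s i := fun i => hs ▸ s.monotone (Fin.zero_le i)
    let t : LTSeries S := ⟨s.length, fun i => ⟨(s i).asIdeal, (s i).2, hann.trans (hle i)⟩,
      fun i => s.step i⟩
    refine Order.length_le_coheight (p := t) ?_
    exact (Subtype.ext (congrArg PrimeSpectrum.asIdeal hs.symm) : _ = t.head).le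
  exact h2.trans (by exact_mod_cast h1)

variable [IsNoetherianRing R]

theorem mem_support_and_nontrivial (a : Ideal R) (d : ℕ) {q : PrimeSpectrum R} {M : Type}
    [AddCommGroup M] [Module R M] [Module.Finite R M] (h : DimLT R M (d + 1)) :
    ∀ {Y : Type} [AddCommGroup Y] [Module R Y] (f : LC M a d →ₗ[R] Y) (_ : Function.Surjective f)
      (_ : (Module.annihilator R Y).radical = q.asIdeal),
    q ∈ Module.support R M ∧ Nontrivial (LC (R ⧸ q.asIdeal) a d) := by
  induction ‹Module.Finite R M› using IsNoetherianRing.induction_on_isQuotientEquivQuotientPrime R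
    with
  | subsingleton N =>
    intro Y _ _ f hf hY
    obtain ⟨y, hy⟩ := @exists_ne _ (nontrivial_of_radical_annihilator hY) (0 : Y)
    obtain ⟨x, rfl⟩ := hf y
    rw [LC.eq_zero_of_subsingleton x, map_zero] at hy
    exact absurd rfl hy
  | quotient N p e =>
    intro Y _ _ f hf hY
    have hnt := nontrivial_of_radical_annihilator hY
    let φ := f ∘ₗ (LC.congr a d e).symm.toLinearMap
    have hφ : Function.Surjective φ := hf.comp (LC.congr a d e).symm.surjective
    have hp : DimLT R (R ⧸ p.asIdeal) (d + 1) := h.of_surjective e.toLinearMap e.surjective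
    have hpq : p = q := by
      refine PrimeSpectrum.ext (le_antisymm ?_ ?_)
      · rw [← hY]
        refine le_trans (fun r hr => Module.mem_annihilator.2 fun y => ?_) Ideal.le_radical
        obtain ⟨z, rfl⟩ := hφ y
        rw [← map_smul, LC.smul_eq_zero_of_killed, map_zero]
        intro b
        obtain ⟨b, rfl⟩ := Ideal.Quotient.mk_surjective b
        exact Ideal.Quotient.eq_zero_iff_mem.2 (Ideal.mul_mem_right b _ hr)
      · intro s hs
        by_contra hsp
        rw [← hY] at hs
        obtain ⟨n, hn⟩ := hs
        obtain ⟨y, hy⟩ := exists_ne (0 : Y)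
        obtain ⟨z, rfl⟩ := hφ y
        obtain ⟨w, rfl⟩ := LC.smul_surjective_of_notMem a hp
          (fun hm => hsp (p.2.mem_of_pow_mem n hm)) z
        rw [map_smul, Module.mem_annihilator.1 hn] at hy
        exact hy rfl
    subst hpq
    refine ⟨?_, hφ.nontrivial⟩
    rw [e.support_eq, mem_support_quotient]
  | exact N₁ N₂ N₃ f g hf hg hfg h₁ h₃ =>
    intro Y _ _ k hk hY
    let P : Submodule R Y := LinearMap.range (k ∘ₗ LC.map a d f)
    rcases radical_annihilator_or P hY with hP | hP
    · obtain ⟨hs, hnt⟩ := h₁ (h.of_injective f hf) (k ∘ₗ LC.map a d f).rangeRestrict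
        (LinearMap.surjective_rangeRestrict _) hP
      exact ⟨Module.support_subset_of_injective f hf hs, hnt⟩
    · have hgs := LC.map_surjective_of_dimLT (I := a) h g hg
      obtain ⟨φ, hφ⟩ := exists_factor (LC.map a d g) hgs (P.mkQ ∘ₗ k) (by
        intro x hx
        obtain ⟨w, rfl⟩ := (LC.exact₂ hf hfg hg x).1 hx
        exact (Submodule.Quotient.mk_eq_zero P).2 ⟨w, rfl⟩)
      obtain ⟨hs, hnt⟩ := h₃ (h.of_surjective g hg) φ (by
        intro y
        obtain ⟨y, rfl⟩ := P.mkQ_surjective y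
        obtain ⟨x, rfl⟩ := hk y
        exact ⟨_, hφ x⟩) hP
      exact ⟨Module.support_subset_of_surjective g hg hs, hnt⟩

lemma coheight_eq_of_nontrivial {a : Ideal R} {d : ℕ} {q : PrimeSpectrum R}
    [hnt : Nontrivial (LC (R ⧸ q.asIdeal) a d)] (hlt : Order.coheight q < (d + 1 : ℕ)) :
    Order.coheight q = d := by
  refine le_antisymm (Order.le_of_lt_add_one (by exact_mod_cast hlt)) ?_
  by_contra! h
  obtain ⟨x, hx⟩ := exists_ne (0 : LC (R ⧸ q.asIdeal) a d)
  refine hx (LC.eq_zero_of_dimLT a d _ (fun p hp => ?_) d le_rfl x)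
  exact (Order.coheight_anti (show q ≤ p from mem_support_quotient.1 hp)).trans_lt h

/-- A finite module maps nontrivially to `R ⧸ q` when `q` is minimal in its support. -/
lemma exists_ne_zero_hom {q : PrimeSpectrum R} {M : Type} [AddCommGroup M] [Module R M]
    [Module.Finite R M] (hq : q ∈ Module.support R M)
    (hmin : ∀ p ∈ Module.support R M, p ≤ q → p = q) : ∃ φ : M →ₗ[R] R ⧸ q.asIdeal, φ ≠ 0 := by
  induction ‹Module.Finite R M› using IsNoetherianRing.induction_on_isQuotientEquivQuotientPrime R
    with
  | subsingleton N => simp [Module.support_eq_empty] at hq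
  | quotient N p e =>
    obtain rfl : p = q := hmin p (by rw [e.support_eq, mem_support_quotient])
      (by rw [e.support_eq, mem_support_quotient] at hq; exact hq)
    refine ⟨e.toLinearMap, fun h0 => ?_⟩
    have : e (e.symm 1) = 0 := LinearMap.congr_fun h0 (e.symm 1)
    rw [e.apply_symm_apply] at this
    have := Ideal.Quotient.nontrivial_iff.2 p.2.ne_top
    exact one_ne_zero ‹(1 : R ⧸ p.asIdeal) = 0›
  | exact N₁ N₂ N₃ f g hf hg hfg h₁ h₃ =>
    have hsub₁ := Module.support_subset_of_injective f hf
    have hsub₃ := Module.support_subset_of_surjective g hg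
    by_cases h : q ∈ Module.support R N₃
    · obtain ⟨φ, hφ⟩ := h₃ h fun p hp => hmin p (hsub₃ hp)
      refine ⟨φ ∘ₗ g, fun h0 => hφ (LinearMap.ext fun x => ?_)⟩
      obtain ⟨x, rfl⟩ := hg x
      exact LinearMap.congr_fun h0 x
    · have h1 : q ∈ Module.support R N₁ := by
        rw [Module.support_of_exact hfg hf hg] at hq
        exact hq.resolve_right h
      obtain ⟨φ, hφ⟩ := h₁ h1 fun p hp => hmin p (hsub₁ hp)
      rw [Module.mem_support_iff_of_finite, SetLike.not_le_iff_exists] at h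
      obtain ⟨s, hs, hsq⟩ := h
      obtain ⟨t, ht⟩ : ∃ t : N₂ →ₗ[R] N₁, ∀ x, f (t x) = s • x := by
        have hmem : ∀ x, s • x ∈ LinearMap.range f := fun x => (hfg _).1 (by
          rw [map_smul, Module.mem_annihilator.1 hs])
        refine ⟨(LinearEquiv.ofInjective f hf).symm.toLinearMap ∘ₗ
          (s • LinearMap.id : N₂ →ₗ[R] N₂).codRestrict (LinearMap.range f) hmem, fun x => ?_⟩
        exact congrArg Subtype.val ((LinearEquiv.ofInjective f hf).apply_symm_apply
          ⟨s • x, hmem x⟩)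
      refine ⟨φ ∘ₗ t, fun h0 => hφ (LinearMap.ext fun x => ?_)⟩
      have htx : t (f x) = s • x := hf (by rw [ht, map_smul])
      have h2 : s • φ x = 0 := by
        rw [← map_smul, ← htx]
        exact LinearMap.congr_fun h0 (f x)
      exact smul_injective_quotient hsq (by simpa using h2)

/-- The primes of top dimension in the support with nonvanishing top local cohomology are
attached. -/
theorem mem_attached_of_nontrivial {a : Ideal R} {d : ℕ} {q : PrimeSpectrum R} {M : Type}
    [AddCommGroup M] [Module R M] [Module.Finite R M] (h : DimLT R M (d + 1))
    (hq : q ∈ Module.support R M) (hqd : Order.coheight q = d)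
    [Nontrivial (LC (R ⧸ q.asIdeal) a d)] (rep : Paper.MinSecRep R (LC M a d)) :
    q.asIdeal ∈ Paper.attached R (LC M a d) := by
  obtain ⟨φ, hφ⟩ := exists_ne_zero_hom hq fun p hp hpq => by
    by_contra hne
    have h1 := Order.coheight_add_one_le (lt_of_le_of_ne hpq hne)
    rw [hqd] at h1
    exact absurd (h p hp) (not_lt.2 (by exact_mod_cast h1))
  have hdim := dimLT_quotient_prime hqd
  obtain ⟨r, hr, hrq⟩ : ∃ r : R, Ideal.Quotient.mk q.asIdeal r ∈ LinearMap.range φ ∧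
      r ∉ q.asIdeal := by
    by_contra! hall
    refine hφ (LinearMap.ext fun x => ?_)
    obtain ⟨r, hr⟩ := Ideal.Quotient.mk_surjective (φ x)
    rw [← hr]
    exact Ideal.Quotient.eq_zero_iff_mem.2 (hall r ⟨x, hr.symm⟩)
  have hquot : DimLT R ((R ⧸ q.asIdeal) ⧸ LinearMap.range φ) d := by
    have hle : LinearMap.range (r • LinearMap.id : (R ⧸ q.asIdeal) →ₗ[R] R ⧸ q.asIdeal) ≤
        LinearMap.range φ := by
      rintro _ ⟨x, rfl⟩
      obtain ⟨x, rfl⟩ := Ideal.Quotient.mk_surjective x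
      have := (LinearMap.range φ).smul_mem x hr
      rwa [Algebra.smul_def, mul_comm, Ideal.Quotient.algebraMap_eq] at this
    exact (hdim.modBy hrq).of_surjective (Submodule.factor hle) (Submodule.factor_surjective hle)
  have hJ : Function.Surjective (LC.map a d (LinearMap.range φ).subtype) := fun y =>
    (LC.exact₂ (LinearMap.range φ).subtype_injective
      (LinearMap.exact_subtype_mkQ _) (Submodule.mkQ_surjective _) y).1
      (LC.eq_zero_of_dimLT a d _ hquot d le_rfl _)
  have hM := LC.map_surjective_of_dimLT (I := a) h φ.rangeRestrict φ.surjective_rangeRestrict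
  refine mem_attached_of_surjective q.2 rep
    (LC.map a d (LinearMap.range φ).subtype ∘ₗ LC.map a d φ.rangeRestrict) (hJ.comp hM) ?_
  apply le_antisymm
  · refine q.2.radical_le_iff.2 fun s hs => ?_
    by_contra hsq
    obtain ⟨z, hz⟩ := exists_ne (0 : LC (R ⧸ q.asIdeal) a d)
    obtain ⟨w, rfl⟩ := LC.smul_surjective_of_notMem a hdim hsq z
    exact hz (Module.mem_annihilator.1 hs w)
  · refine le_trans (fun r hr => Module.mem_annihilator.2 fun z => ?_) Ideal.le_radical
    refine LC.smul_eq_zero_of_killed (fun b => ?_) z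
    obtain ⟨b, rfl⟩ := Ideal.Quotient.mk_surjective b
    exact Ideal.Quotient.eq_zero_iff_mem.2 (Ideal.mul_mem_right b _ hr)

lemma exists_of_mem_attached {a : Ideal R} {d : ℕ} {p : Ideal R} {M : Type}
    [AddCommGroup M] [Module R M] [Module.Finite R M] (h : DimLT R M (d + 1))
    (hp : p ∈ Paper.attached R (LC M a d)) :
    ∃ q : PrimeSpectrum R, q.asIdeal = p ∧ q ∈ Module.support R M ∧ Order.coheight q = d ∧
      Nontrivial (LC (R ⧸ q.asIdeal) a d) := by
  obtain ⟨hprime, -, P, hP⟩ := exists_quotient_of_mem_attached hp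
  obtain ⟨hs, hnt⟩ := mem_support_and_nontrivial a d (q := ⟨p, hprime⟩) h P.mkQ
    P.mkQ_surjective hP
  exact ⟨⟨p, hprime⟩, rfl, hs, coheight_eq_of_nontrivial (a := a) (h _ hs), hnt⟩

theorem exists_ideal_attached_LC_inter [IsLocalRing R] [IsAdicComplete (maximalIdeal R) R]
    {M : Type} [AddCommGroup M] [Module R M] [Module.Finite R M] {d : ℕ} (h : DimLT R M (d + 1))
    (a₁ a₂ : Ideal R) : ∃ b : Ideal R, Paper.attached R (LC M b d) =
      Paper.attached R (LC M a₁ d) ∩ Paper.attached R (LC M a₂ d) := by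
  have htop : Paper.attached R (LC M (⊤ : Ideal R) d) = ∅ := by
    have : Subsingleton (LC M (⊤ : Ideal R) d) :=
      subsingleton_of_forall_eq 0 LC.eq_zero_of_top
    exact attached_eq_empty
  rcases Set.eq_empty_or_nonempty (Paper.attached R (LC M a₁ d) ∩ Paper.attached R (LC M a₂ d))
    with hempty | ⟨p, hp₁, hp₂⟩
  · exact ⟨⊤, by rw [hempty, htop]⟩
  have hne₁ : a₁ ≠ ⊤ := by
    rintro rfl
    simp [htop] at hp₁
  have hne₂ : a₂ ≠ ⊤ := by
    rintro rfl
    simp [htop] at hp₂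
  obtain ⟨-, ⟨rep₁⟩, -⟩ := exists_quotient_of_mem_attached hp₁
  obtain ⟨-, ⟨rep₂⟩, -⟩ := exists_quotient_of_mem_attached hp₂
  obtain ⟨rep⟩ := nonempty_minSecRep_of_surjective rep₁
    (LC.incl (inf_le_left : a₁ ⊓ a₂ ≤ a₁) d M) (LC.incl_surjective inf_le_left hne₁ d M h)
  refine ⟨a₁ ⊓ a₂, subset_antisymm (fun p hp => ?_) (fun p hp => ?_)⟩
  · obtain ⟨q, rfl, hs, hqd, hnt⟩ := exists_of_mem_attached h hp
    have h₁ : Nontrivial (LC (R ⧸ q.asIdeal) a₁ d) := Function.Surjective.nontrivial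
      (LC.incl_surjective (inf_le_left : a₁ ⊓ a₂ ≤ a₁) hne₁ d _ (dimLT_quotient_prime hqd))
    have h₂ : Nontrivial (LC (R ⧸ q.asIdeal) a₂ d) := Function.Surjective.nontrivial
      (LC.incl_surjective (inf_le_right : a₁ ⊓ a₂ ≤ a₂) hne₂ d _ (dimLT_quotient_prime hqd))
    exact ⟨mem_attached_of_nontrivial h hs hqd rep₁, mem_attached_of_nontrivial h hs hqd rep₂⟩
  · obtain ⟨q, rfl, hs, hqd, hnt₁⟩ := exists_of_mem_attached h hp.1
    obtain ⟨q', hq', -, -, hnt₂⟩ := exists_of_mem_attached h hp.2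
    obtain rfl : q' = q := PrimeSpectrum.ext hq'
    have := nontrivial_inf hqd a₁ a₂
    exact mem_attached_of_nontrivial h hs hqd rep

end TopLC

end

noncomputable section
open CategoryTheory Opposite

namespace TopLC

variable {R : Type} [CommRing R]

section
variable {X Y X' : ModuleCat.{0} R}

/-- Precomposition with a morphism of projective resolutions. -/
def homComplexMap {g : X' ⟶ X} {P' : ProjectiveResolution X'} {P : ProjectiveResolution X}
    (φ : ProjectiveResolution.Hom P' P g) (Y : ModuleCat.{0} R) :
    P.complex.linearYonedaObj R Y ⟶ P'.complex.linearYonedaObj R Y :=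
  (HomologicalComplex.unopFunctor _ _).map
    (((((linearYoneda R (ModuleCat.{0} R)).obj Y).rightOp.mapHomologicalComplex _).map φ.hom).op)

lemma isoExt_hom_naturality {g : X' ⟶ X} {P' : ProjectiveResolution X'}
    {P : ProjectiveResolution X} (φ : ProjectiveResolution.Hom P' P g) (Y : ModuleCat.{0} R)
    (n : ℕ) :
    ((Ext R (ModuleCat.{0} R) n).map g.op).app Y ≫ (P'.isoExt n Y).hom =
      (P.isoExt n Y).hom ≫ HomologicalComplex.homologyMap (homComplexMap φ Y) n := by
  let F := ((linearYoneda R (ModuleCat.{0} R)).obj Y).rightOp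
  have h1 := ProjectiveResolution.isoLeftDerivedObj_inv_naturality g P' P φ.hom
    (by simpa using φ.hom_f_zero_comp_π_f_zero) F n
  have h2 := HomologicalComplex.homologyOp_hom_naturality (homComplexMap φ Y) n
  have h3 := congrArg Quiver.Hom.unop h1
  have h4 := congrArg Quiver.Hom.unop h2
  have h3' : ((Ext R (ModuleCat.{0} R) n).map g.op).app Y ≫ (P'.isoLeftDerivedObj F n).inv.unop =
    (P.isoLeftDerivedObj F n).inv.unop ≫ (HomologicalComplex.homologyMap
      ((F.mapHomologicalComplex _).map φ.hom) n).unop := h3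
  have h5 : (HomologicalComplex.homologyMap ((F.mapHomologicalComplex _).map φ.hom) n).unop ≫
      (HomologicalComplex.homologyOp (P'.complex.linearYonedaObj R Y) n).inv.unop =
    (HomologicalComplex.homologyOp (P.complex.linearYonedaObj R Y) n).inv.unop ≫
      HomologicalComplex.homologyMap (homComplexMap φ Y) n := by
    have h6 : (HomologicalComplex.homologyOp (P.complex.linearYonedaObj R Y) n).hom.unop ≫
      (HomologicalComplex.homologyMap ((F.mapHomologicalComplex _).map φ.hom) n).unop =
       HomologicalComplex.homologyMap (homComplexMap φ Y) n ≫
      (HomologicalComplex.homologyOp (P'.complex.linearYonedaObj R Y) n).hom.unop := h4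
    exact (Iso.comp_inv_eq
      (HomologicalComplex.homologyOp (P'.complex.linearYonedaObj R Y) n).unop).2
      (((Iso.eq_inv_comp (HomologicalComplex.homologyOp _ n).unop).2 h6).trans
        (Category.assoc _ _ _).symm)
  exact (Category.assoc _ _ _).symm.trans ((congrArg (· ≫ _) h3').trans
    ((Category.assoc _ _ _).trans ((congrArg (_ ≫ ·) h5).trans (Category.assoc _ _ _).symm)))

/-- The cocycles in a complex of morphisms. -/
def cocycles (P : ProjectiveResolution X) (Y : ModuleCat.{0} R) (n : ℕ) :
    Submodule R (P.complex.X n ⟶ Y) :=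
  LinearMap.ker (Linear.leftComp R Y (P.complex.d (n + 1) n))

lemma mem_cocycles {P : ProjectiveResolution X} {n : ℕ} {f : P.complex.X n ⟶ Y} :
    f ∈ cocycles P Y n ↔ P.complex.d (n + 1) n ≫ f = 0 := Iff.rfl

/-- The class in `Ext` of a cocycle. -/
def extMkₗ (P : ProjectiveResolution X) (Y : ModuleCat.{0} R) (n : ℕ) :
    cocycles P Y n →ₗ[R] Abelian.Ext X Y n where
  toFun f := P.extMk f.1 (n + 1) rfl f.2
  map_add' f g := (P.add_extMk f.1 g.1 (n + 1) rfl f.2 g.2).symm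
  map_smul' r f := by
    have hf : P.complex.d (n + 1) n ≫ f.1 = 0 := f.2
    rw [RingHom.id_apply, Abelian.Ext.smul_eq_comp_mk₀]
    refine Eq.trans ?_ (P.extMk_comp_mk₀ f.1 (n + 1) rfl hf (r • 𝟙 Y)).symm
    congr 1

lemma extMkₗ_surjective (P : ProjectiveResolution X) (Y : ModuleCat.{0} R) (n : ℕ) :
    Function.Surjective (extMkₗ P Y n) := by
  intro α
  obtain ⟨f, hf, rfl⟩ := P.extMk_surjective α (n + 1) rfl
  exact ⟨⟨f, hf⟩, rfl⟩

lemma extMkₗ_eq_zero_iff {P : ProjectiveResolution X} {n : ℕ} (f : cocycles P Y n) :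
    extMkₗ P Y n f = 0 ↔ ∃ g : P.complex.X (n - 1) ⟶ Y, P.complex.d n (n - 1) ≫ g = f.1 := by
  cases n with
  | zero =>
    have hd : P.complex.d 0 (0 - 1) = 0 := P.complex.shape _ _ (by simp)
    simp only [hd, Limits.zero_comp, exists_const]
    have hf : P.complex.d 1 0 ≫ f.1 = 0 := f.2
    constructor
    · intro h
      have h' := congrArg P.extEquivCohomologyClass h
      change P.extEquivCohomologyClass (P.extMk f.1 1 rfl hf) = _ at h'
      rw [P.extEquivCohomologyClass_extMk, P.extEquivCohomologyClass_zero,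
        CochainComplex.HomComplex.CohomologyClass.mk_eq_zero_iff,
        CochainComplex.HomComplex.Cocycle.toSingleMk_mem_coboundaries_iff _ _ _ _ _ 1
          (by simp)] at h'
      obtain ⟨g, hg⟩ := h'
      rw [(CochainComplex.isZero_of_isStrictlyLE P.cochainComplex 0 1).eq_of_src g 0,
        Limits.comp_zero] at hg
      exact ((P.cochainComplexXIso (-(0 : ℕ)) 0 rfl).cancel_iso_hom_left _ _).1
        (by simpa using hg)
    · intro h
      rw [show f = 0 from Subtype.ext h.symm, map_zero]
  | succ n => exact P.extMk_eq_zero_iff f.1 _ rfl f.2 n rfl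

/-- The inclusion of the cocycles into the categorical cycles. -/
def toCycles (P : ProjectiveResolution X) (Y : ModuleCat.{0} R) (n : ℕ) :
    ModuleCat.of R (cocycles P Y n) ⟶ (P.complex.linearYonedaObj R Y).cycles n :=
  (P.complex.linearYonedaObj R Y).liftCycles (ModuleCat.ofHom (cocycles P Y n).subtype) (n + 1)
    (by simp) (by
      ext f
      exact f.2)

lemma iCycles_toCycles {P : ProjectiveResolution X} {n : ℕ} (f : cocycles P Y n) :
    (P.complex.linearYonedaObj R Y).iCycles n (toCycles P Y n f) = f.1 := by
  have h : toCycles P Y n ≫ (P.complex.linearYonedaObj R Y).iCycles n = _ :=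
    (P.complex.linearYonedaObj R Y).liftCycles_i _ _ _ _
  exact ConcreteCategory.congr_hom h f

/-- The class in the homology of a complex of morphisms of a cocycle. -/
def homologyMk (P : ProjectiveResolution X) (Y : ModuleCat.{0} R) (n : ℕ) :
    ModuleCat.of R (cocycles P Y n) ⟶ (P.complex.linearYonedaObj R Y).homology n :=
  toCycles P Y n ≫ (P.complex.linearYonedaObj R Y).homologyπ n

lemma homologyMk_surjective (P : ProjectiveResolution X) (Y : ModuleCat.{0} R) (n : ℕ) :
    Function.Surjective (homologyMk P Y n) := by
  intro x
  obtain ⟨y, rfl⟩ := (ModuleCat.epi_iff_surjective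
    ((P.complex.linearYonedaObj R Y).homologyπ n)).1 inferInstance x
  have hy : ((P.complex.linearYonedaObj R Y).iCycles n ≫
    (P.complex.linearYonedaObj R Y).d n (n + 1)) y = 0 :=
    ConcreteCategory.congr_hom ((P.complex.linearYonedaObj R Y).iCycles_d n (n + 1)) y
  refine ⟨⟨(P.complex.linearYonedaObj R Y).iCycles n y, hy⟩, ?_⟩
  refine congrArg ((P.complex.linearYonedaObj R Y).homologyπ n) ?_
  apply (ModuleCat.mono_iff_injective
    ((P.complex.linearYonedaObj R Y).iCycles n)).1 inferInstance
  exact iCycles_toCycles _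

lemma homologyMk_eq_zero_iff {P : ProjectiveResolution X} {n : ℕ} (f : cocycles P Y n) :
    homologyMk P Y n f = 0 ↔ ∃ g : P.complex.X (n - 1) ⟶ Y, P.complex.d n (n - 1) ≫ g = f.1 := by
  have hprev : (ComplexShape.up ℕ).prev n = n - 1 := by
    cases n with
    | zero => simp
    | succ n => simp
  have hex := (ShortComplex.moduleCat_exact_iff _).1 (ShortComplex.exact_of_g_is_cokernel
    (ShortComplex.mk _ _ ((P.complex.linearYonedaObj R Y).toCycles_comp_homologyπ (n - 1) n))
    ((P.complex.linearYonedaObj R Y).homologyIsCokernel (n - 1) n hprev))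
  have hinj := (ModuleCat.mono_iff_injective
    ((P.complex.linearYonedaObj R Y).iCycles n)).1 inferInstance
  constructor
  · intro h
    obtain ⟨g, hg⟩ := hex (toCycles P Y n f) h
    refine ⟨g, ?_⟩
    rw [← iCycles_toCycles f, ← show _ = toCycles P Y n f from hg]
    exact (ConcreteCategory.congr_hom
      ((P.complex.linearYonedaObj R Y).toCycles_i (n - 1) n) g).symm
  · rintro ⟨g, hg⟩
    have : (P.complex.linearYonedaObj R Y).toCycles (n - 1) n g = toCycles P Y n f := by
      apply hinj
      rw [iCycles_toCycles, ← hg]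
      exact ConcreteCategory.congr_hom ((P.complex.linearYonedaObj R Y).toCycles_i (n - 1) n) g
    change (P.complex.linearYonedaObj R Y).homologyπ n (toCycles P Y n f) = 0
    rw [← this]
    exact ConcreteCategory.congr_hom
      ((P.complex.linearYonedaObj R Y).toCycles_comp_homologyπ (n - 1) n) g

/-- Precomposition of cocycles with a morphism of projective resolutions. -/
def cocyclesMap {g : X' ⟶ X} {P' : ProjectiveResolution X'} {P : ProjectiveResolution X}
    (φ : ProjectiveResolution.Hom P' P g) {n : ℕ} (f : cocycles P Y n) : cocycles P' Y n :=
  ⟨φ.hom.f n ≫ f.1, by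
    rw [mem_cocycles, ← φ.hom.comm_assoc, mem_cocycles.1 f.2, Limits.comp_zero]⟩

lemma mk₀_comp_extMkₗ {g : X' ⟶ X} {P' : ProjectiveResolution X'} {P : ProjectiveResolution X}
    (φ : ProjectiveResolution.Hom P' P g) {n : ℕ} (f : cocycles P Y n) :
    (Abelian.Ext.mk₀ g).comp (extMkₗ P Y n f) (zero_add n) = extMkₗ P' Y n (cocyclesMap φ f) :=
  P.mk₀_comp_extMk f.1 (n + 1) rfl f.2 φ

lemma homologyMap_homologyMk {g : X' ⟶ X} {P' : ProjectiveResolution X'}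
    {P : ProjectiveResolution X} (φ : ProjectiveResolution.Hom P' P g) {n : ℕ}
    (f : cocycles P Y n) :
    HomologicalComplex.homologyMap (homComplexMap φ Y) n (homologyMk P Y n f) =
      homologyMk P' Y n (cocyclesMap φ f) := by
  have h1 : HomologicalComplex.cyclesMap (homComplexMap φ Y) n (toCycles P Y n f) =
      toCycles P' Y n (cocyclesMap φ f) := by
    apply (ModuleCat.mono_iff_injective
      ((P'.complex.linearYonedaObj R Y).iCycles n)).1 inferInstance
    rw [iCycles_toCycles]
    refine (ConcreteCategory.congr_hom
      (HomologicalComplex.cyclesMap_i (homComplexMap φ Y) n) (toCycles P Y n f)).trans ?_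
    change (homComplexMap φ Y).f n
      ((P.complex.linearYonedaObj R Y).iCycles n (toCycles P Y n f)) = _
    rw [iCycles_toCycles]
    rfl
  refine (ConcreteCategory.congr_hom
    (HomologicalComplex.homologyπ_naturality (homComplexMap φ Y) n) (toCycles P Y n f)).trans ?_
  change (P'.complex.linearYonedaObj R Y).homologyπ n
    (HomologicalComplex.cyclesMap (homComplexMap φ Y) n (toCycles P Y n f)) = _
  rw [h1]
  rfl

/-- The class of a cocycle in the derived functors of the Yoneda functor. -/
def derivedMk (P : ProjectiveResolution X) (Y : ModuleCat.{0} R) (n : ℕ) :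
    cocycles P Y n →ₗ[R] ((Ext R (ModuleCat.{0} R) n).obj (op X)).obj Y :=
  (P.isoExt n Y).toLinearEquiv.symm.toLinearMap ∘ₗ (homologyMk P Y n).hom

lemma derivedMk_surjective (P : ProjectiveResolution X) (Y : ModuleCat.{0} R) (n : ℕ) :
    Function.Surjective (derivedMk P Y n) :=
  (P.isoExt n Y).toLinearEquiv.symm.surjective.comp (homologyMk_surjective P Y n)

lemma ker_derivedMk (P : ProjectiveResolution X) (Y : ModuleCat.{0} R) (n : ℕ) :
    LinearMap.ker (derivedMk P Y n) = LinearMap.ker (extMkₗ P Y n) := by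
  ext f
  rw [LinearMap.mem_ker, LinearMap.mem_ker, extMkₗ_eq_zero_iff, ← homologyMk_eq_zero_iff]
  exact (P.isoExt n Y).toLinearEquiv.symm.map_eq_zero_iff

lemma map_derivedMk {g : X' ⟶ X} {P' : ProjectiveResolution X'} {P : ProjectiveResolution X}
    (φ : ProjectiveResolution.Hom P' P g) {n : ℕ} (f : cocycles P Y n) :
    ((Ext R (ModuleCat.{0} R) n).map g.op).app Y (derivedMk P Y n f) =
      derivedMk P' Y n (cocyclesMap φ f) := by
  apply (P'.isoExt n Y).toLinearEquiv.injective
  refine (ConcreteCategory.congr_hom (isoExt_hom_naturality φ Y n) (derivedMk P Y n f)).trans ?_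
  change HomologicalComplex.homologyMap (homComplexMap φ Y) n
    ((P.isoExt n Y).toLinearEquiv ((P.isoExt n Y).toLinearEquiv.symm (homologyMk P Y n f))) =
    (P'.isoExt n Y).toLinearEquiv ((P'.isoExt n Y).toLinearEquiv.symm
      (homologyMk P' Y n (cocyclesMap φ f)))
  rw [LinearEquiv.apply_symm_apply, LinearEquiv.apply_symm_apply, homologyMap_homologyMk]

/-- The comparison of the two versions of `Ext`. -/
def extEquiv (X Y : ModuleCat.{0} R) (n : ℕ) :
    ((Ext R (ModuleCat.{0} R) n).obj (op X)).obj Y ≃ₗ[R] Abelian.Ext X Y n :=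
  ((derivedMk (projectiveResolution X) Y n).quotKerEquivOfSurjective
    (derivedMk_surjective _ Y n)).symm ≪≫ₗ
  Submodule.quotEquivOfEq _ _ (ker_derivedMk _ Y n) ≪≫ₗ
  (extMkₗ (projectiveResolution X) Y n).quotKerEquivOfSurjective (extMkₗ_surjective _ Y n)

lemma extEquiv_derivedMk {n : ℕ} (f : cocycles (projectiveResolution X) Y n) :
    extEquiv X Y n (derivedMk (projectiveResolution X) Y n f) =
      extMkₗ (projectiveResolution X) Y n f := by
  have : ((derivedMk (projectiveResolution X) Y n).quotKerEquivOfSurjective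
    (derivedMk_surjective _ Y n)).symm (derivedMk (projectiveResolution X) Y n f) =
      Submodule.Quotient.mk f := by
    rw [LinearEquiv.symm_apply_eq]
    rfl
  simp only [extEquiv, LinearEquiv.trans_apply, this]
  rfl

lemma extEquiv_naturality (g : X' ⟶ X) {n : ℕ}
    (x : ((Ext R (ModuleCat.{0} R) n).obj (op X)).obj Y) :
    extEquiv X' Y n (((Ext R (ModuleCat.{0} R) n).map g.op).app Y x) =
      (Abelian.Ext.mk₀ g).comp (extEquiv X Y n x) (zero_add n) := by
  obtain ⟨f, rfl⟩ := derivedMk_surjective (projectiveResolution X) Y n x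
  let φ : ProjectiveResolution.Hom (projectiveResolution X') (projectiveResolution X) g :=
    ⟨ProjectiveResolution.lift g _ _, ProjectiveResolution.lift_commutes_zero g _ _⟩
  rw [map_derivedMk φ, extEquiv_derivedMk, extEquiv_derivedMk, mk₀_comp_extMkₗ φ]

end
end TopLC

end

noncomputable section
open CategoryTheory Opposite

namespace TopLC

variable {R : Type} [CommRing R] (A : Type) [AddCommGroup A] [Module R A] (I : Ideal R) (i : ℕ)

/-- The cocone exhibiting local cohomology as a colimit. -/
def cocone : Limits.Cocone (localCohomology.diagram (localCohomology.idealPowersDiagram I) i ⋙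
    (evaluation _ _).obj (ModuleCat.of R A)) :=
  ((evaluation _ _).obj (ModuleCat.of R A)).mapCocone
    (Limits.colimit.cocone (localCohomology.diagram (localCohomology.idealPowersDiagram I) i))

/-- The cocone is a colimit cocone. -/
def isColimitCocone : Limits.IsColimit (cocone A I i) :=
  Limits.isColimitOfPreserves ((evaluation _ _).obj (ModuleCat.of R A))
    (Limits.colimit.isColimit _)

lemma mk_extEquiv_map {n m : ℕ} (h : n ≤ m)
    (x : ((Ext R (ModuleCat.{0} R) i).obj (op (ModuleCat.of R (R ⧸ I ^ n)))).obj
      (ModuleCat.of R A)) :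
    LC.mk A I i m (extEquiv _ _ i (((Ext R (ModuleCat.{0} R) i).map
      (quotMap (Ideal.pow_le_pow_right h)).op).app (ModuleCat.of R A) x)) =
      LC.mk A I i n (extEquiv _ _ i x) := by
  rw [extEquiv_naturality, ← extRes_apply, LC.mk_extRes h]

/-- The cocone with point `LC`. -/
def coconeLC : Limits.Cocone (localCohomology.diagram (localCohomology.idealPowersDiagram I) i ⋙
    (evaluation _ _).obj (ModuleCat.of R A)) where
  pt := ModuleCat.of R (LC A I i)
  ι :=
    { app := fun j => ModuleCat.ofHom (LC.mk A I i (unop (unop j)) ∘ₗ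
        (extEquiv (ModuleCat.of R (R ⧸ I ^ unop (unop j))) (ModuleCat.of R A) i).toLinearMap)
      naturality := by
        intro j k f
        ext x
        have hjk : unop (unop j) ≤ unop (unop k) := f.unop.unop.down.down
        exact mk_extEquiv_map A I i hjk x }

/-- The map from the colimit to `LC`. -/
def toLC : Paper.H R I i A →ₗ[R] LC A I i :=
  ((isColimitCocone A I i).desc (coconeLC A I i)).hom

/-- The map from `Ext (R ⧸ I ^ n) A` to the colimit. -/
def ofExt (n : ℕ) : Abelian.Ext (ModuleCat.of R (R ⧸ I ^ n)) (ModuleCat.of R A) i →ₗ[R]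
    Paper.H R I i A :=
  ((cocone A I i).ι.app (op (op n))).hom ∘ₗ
    (extEquiv (ModuleCat.of R (R ⧸ I ^ n)) (ModuleCat.of R A) i).symm.toLinearMap

lemma ofExt_extEquiv (n : ℕ)
    (x : ((Ext R (ModuleCat.{0} R) i).obj (op (ModuleCat.of R (R ⧸ I ^ n)))).obj
      (ModuleCat.of R A)) :
    ofExt A I i n (extEquiv _ _ i x) = (cocone A I i).ι.app (op (op n)) x :=
  congrArg ((cocone A I i).ι.app (op (op n))) (LinearEquiv.symm_apply_apply _ x)

lemma ofExt_trans {n m : ℕ} (h : n ≤ m)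
    (e : Abelian.Ext (ModuleCat.of R (R ⧸ I ^ n)) (ModuleCat.of R A) i) :
    ofExt A I i m (trans A I i n m h e) = ofExt A I i n e := by
  obtain ⟨x, rfl⟩ := (extEquiv (ModuleCat.of R (R ⧸ I ^ n)) (ModuleCat.of R A) i).surjective e
  rw [trans, extRes_apply, ← extEquiv_naturality, ofExt_extEquiv, ofExt_extEquiv]
  exact ConcreteCategory.congr_hom ((cocone A I i).w
    (show op (op n) ⟶ op (op m) from (homOfLE h).op.op)) x

/-- The map from `LC` to the colimit. -/
def ofLC : LC A I i →ₗ[R] Paper.H R I i A :=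
  Module.DirectLimit.lift R ℕ _ _ (ofExt A I i) fun _ _ h e => ofExt_trans A I i h e

lemma ofLC_mk (n : ℕ) (e : Abelian.Ext (ModuleCat.of R (R ⧸ I ^ n)) (ModuleCat.of R A) i) :
    ofLC A I i (LC.mk A I i n e) = ofExt A I i n e :=
  Module.DirectLimit.lift_of _ _ _

lemma toLC_ι (n : ℕ)
    (x : ((Ext R (ModuleCat.{0} R) i).obj (op (ModuleCat.of R (R ⧸ I ^ n)))).obj
      (ModuleCat.of R A)) :
    toLC A I i ((cocone A I i).ι.app (op (op n)) x) = LC.mk A I i n (extEquiv _ _ i x) :=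
  ConcreteCategory.congr_hom ((isColimitCocone A I i).fac (coconeLC A I i) (op (op n))) x

/-- The two versions of local cohomology agree. -/
def equivLC : Paper.H R I i A ≃ₗ[R] LC A I i :=
  LinearEquiv.ofLinearMap (toLC A I i) (ofLC A I i)
    (by
      ext y
      obtain ⟨n, e, rfl⟩ := LC.exists_mk y
      obtain ⟨x, rfl⟩ :=
        (extEquiv (ModuleCat.of R (R ⧸ I ^ n)) (ModuleCat.of R A) i).surjective e
      rw [LinearMap.comp_apply, ofLC_mk, ofExt_extEquiv, toLC_ι]
      rfl)
    (by
      have h : ModuleCat.ofHom (ofLC A I i ∘ₗ toLC A I i) = 𝟙 (cocone A I i).pt := by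
        apply (isColimitCocone A I i).hom_ext
        intro j
        ext x
        exact (congrArg (ofLC A I i) (toLC_ι A I i (unop (unop j)) x)).trans
          ((ofLC_mk A I i _ _).trans (ofExt_extEquiv A I i _ x))
      exact congrArg ModuleCat.Hom.hom h)

end TopLC

end

/-- Over a complete Noetherian local ring, the intersection of the attached primes of two
top local cohomology modules is again the attached primes of a top local cohomology
module. -/
theorem exists_ideal_attached_top_inter (R : Type) [CommRing R] [IsNoetherianRing R]
    [IsLocalRing R] [IsAdicComplete (IsLocalRing.maximalIdeal R) R]
    (M : Type) [AddCommGroup M] [Module R M] [Module.Finite R M]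
    (d : ℕ) (hdim : Paper.dimMod R M = d) (a₁ a₂ : Ideal R) :
    ∃ b : Ideal R, Paper.attached R (Paper.H R b d M) =
      Paper.attached R (Paper.H R a₁ d M) ∩ Paper.attached R (Paper.H R a₂ d M) := by
  obtain ⟨b, hb⟩ :=
    TopLC.exists_ideal_attached_LC_inter (TopLC.dimLT_of_dimMod_eq hdim) a₁ a₂
  refine ⟨b, ?_⟩
  rw [TopLC.attached_eq_of_equiv (TopLC.equivLC M b d),
    TopLC.attached_eq_of_equiv (TopLC.equivLC M a₁ d),
    TopLC.attached_eq_of_equiv (TopLC.equivLC M a₂ d), hb]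
end
end

section
/- Let (R,𝔪) be a Noetherian local ring and M a finitely generated R-module of dimension d. Then M has a uniform local cohomological annihilator if and only if Att H^i_𝔪(M) ∩ Min M = ∅ for all i = 0,…,d−1. -/
noncomputable section
open CategoryTheory

universe v u

namespace CategoryTheory.ProjectiveResolution

open Abelian

section

variable {C : Type u} [Category.{v} C] [Abelian C] [HasExt.{v} C] {X Y : C}

lemma extMk_zero_eq_zero_iff (P : ProjectiveResolution X) (f : P.complex.X 0 ⟶ Y) (m : ℕ)
    (hm : 0 + 1 = m) (hf : P.complex.d m 0 ≫ f = 0) : P.extMk f m hm hf = 0 ↔ f = 0 := by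
  refine ⟨fun h ↦ ?_, fun h ↦ by subst h; simp⟩
  simp only [← P.extEquivCohomologyClass.apply_eq_iff_eq, extEquivCohomologyClass_extMk,
    extEquivCohomologyClass_zero, CochainComplex.HomComplex.CohomologyClass.mk_eq_zero_iff] at h
  rw [CochainComplex.HomComplex.Cocycle.toSingleMk_mem_coboundaries_iff _ _ _ _ _ 1 (by simp)] at h
  obtain ⟨g, hg⟩ := h
  have hz : P.cochainComplex.d (-((0 : ℕ) : ℤ)) 1 = 0 := by
    refine Limits.IsZero.eq_of_tgt ?_ _ _
    exact CochainComplex.isZero_of_isStrictlyLE _ 0 1 (by simp)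
  rw [hz, Limits.zero_comp] at hg
  rw [← cancel_epi (P.cochainComplexXIso (-((0 : ℕ) : ℤ)) 0 rfl).hom, ← hg, Limits.comp_zero]

lemma smul_extMk {R : Type*} [CommRing R] [Linear R C] (P : ProjectiveResolution X) {n : ℕ}
    (f : P.complex.X n ⟶ Y) (m : ℕ) (hm : n + 1 = m) (hf : P.complex.d m n ≫ f = 0) (r : R) :
    r • P.extMk f m hm hf = P.extMk (r • f) m hm (by simp [hf]) := by
  simp [Ext.smul_eq_comp_mk₀, extMk_comp_mk₀]

end

section

variable {R : Type u} [CommRing R] {C : Type*} [Category.{u} C] [Abelian C] [Linear R C]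
  {X X' : C}

/-- The map on complexes of homomorphisms into `Y` induced by a morphism of resolutions. -/
def linearYonedaObjMap {P : ProjectiveResolution X} {P' : ProjectiveResolution X'}
    (φ : P.complex ⟶ P'.complex) (Y : C) :
    P'.complex.linearYonedaObj R Y ⟶ P.complex.linearYonedaObj R Y where
  f n := ((linearYoneda R C).obj Y).map (φ.f n).op
  comm' i j _ := by
    change ((linearYoneda R C).obj Y).map (φ.f i).op ≫
      ((linearYoneda R C).obj Y).map (P.complex.d j i).op =
        ((linearYoneda R C).obj Y).map (P'.complex.d j i).op ≫
          ((linearYoneda R C).obj Y).map (φ.f j).op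
    simp only [← Functor.map_comp, ← op_comp, φ.comm]

open HomologicalComplex in
lemma isoExt_inv_naturality [EnoughProjectives C] (P : ProjectiveResolution X)
    (P' : ProjectiveResolution X') {g : X ⟶ X'} (φ : Hom P P' g) (n : ℕ) (Y : C) :
    (P'.isoExt n Y).inv ≫ ((_root_.Ext R C n).map g.op).app Y =
      homologyMap (linearYonedaObjMap φ.hom Y) n ≫ (P.isoExt n Y).inv := by
  have h := congrArg Quiver.Hom.unop (isoLeftDerivedObj_hom_naturality g P P' φ.hom
    (by simpa using φ.hom_f_zero_comp_π_f_zero) ((linearYoneda R C).obj Y).rightOp n)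
  have h' := congrArg Quiver.Hom.unop
    (homologyOp_hom_naturality (linearYonedaObjMap (R := R) φ.hom Y) n)
  change ((homologyUnop _ n).hom ≫ (P'.isoLeftDerivedObj _ n).hom.unop) ≫
    ((((linearYoneda R C).obj Y).rightOp.leftDerived n).map g).unop =
    homologyMap (linearYonedaObjMap φ.hom Y) n ≫
      ((homologyUnop _ n).hom ≫ (P.isoLeftDerivedObj _ n).hom.unop)
  exact (Category.assoc _ _ _).trans <| (congrArg _ h).trans <|
    (Category.assoc _ _ _).symm.trans <| (congrArg
      (· ≫ (P.isoLeftDerivedObj ((linearYoneda R C).obj Y).rightOp n).hom.unop) h').trans <|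
        Category.assoc _ _ _

/-- The morphism underlying a cocycle on a projective resolution. -/
def cocycle (P : ProjectiveResolution X) (n : ℕ) (Y : C) :
    (P.complex.linearYonedaObj R Y).cycles n →ₗ[R] (P.complex.X n ⟶ Y) :=
  ((P.complex.linearYonedaObj R Y).iCycles n).hom

lemma d_comp_cocycle (P : ProjectiveResolution X) (n : ℕ) (Y : C)
    (z : (P.complex.linearYonedaObj R Y).cycles n) :
    P.complex.d (n + 1) n ≫ P.cocycle n Y z = 0 :=
  congrArg (fun k ↦ k.hom z) ((P.complex.linearYonedaObj R Y).iCycles_d n (n + 1))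

lemma cocycle_injective (P : ProjectiveResolution X) (n : ℕ) (Y : C) :
    Function.Injective (P.cocycle (R := R) n Y) :=
  (ModuleCat.mono_iff_injective ((P.complex.linearYonedaObj R Y).iCycles n)).1 inferInstance

variable [HasExt.{u} C]

/-- The `Ext`-class of a cocycle on a projective resolution. -/
def cyclesToExt (P : ProjectiveResolution X) (n : ℕ) (Y : C) :
    (P.complex.linearYonedaObj R Y).cycles n →ₗ[R] Abelian.Ext X Y n where
  toFun z := P.extMk (P.cocycle n Y z) (n + 1) rfl (P.d_comp_cocycle n Y z)
  map_add' z w := by simp only [add_extMk, map_add]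
  map_smul' r z := by simp only [RingHom.id_apply, smul_extMk, map_smul]

lemma cyclesToExt_apply (P : ProjectiveResolution X) (n : ℕ) (Y : C)
    (z : (P.complex.linearYonedaObj R Y).cycles n) :
    P.cyclesToExt n Y z = P.extMk (P.cocycle n Y z) (n + 1) rfl (P.d_comp_cocycle n Y z) :=
  rfl

lemma cyclesToExt_surjective (P : ProjectiveResolution X) (n : ℕ) (Y : C) :
    Function.Surjective (P.cyclesToExt (R := R) n Y) := by
  intro a
  obtain ⟨f, hf, rfl⟩ := P.extMk_surjective a (n + 1) rfl
  let K := P.complex.linearYonedaObj R Y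
  refine ⟨K.cyclesMk f (n + 1) (by simp) hf, ?_⟩
  rw [cyclesToExt_apply]
  congr 1
  exact K.i_cyclesMk f (n + 1) (by simp) hf

lemma homologyπ_eq_zero_of_cyclesToExt_eq_zero (P : ProjectiveResolution X) (n : ℕ) (Y : C)
    (z : (P.complex.linearYonedaObj R Y).cycles n) (hz : P.cyclesToExt n Y z = 0) :
    (P.complex.linearYonedaObj R Y).homologyπ n z = 0 := by
  let K := P.complex.linearYonedaObj R Y
  rw [cyclesToExt_apply] at hz
  cases n with
  | zero =>
    rw [extMk_zero_eq_zero_iff] at hz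
    rw [P.cocycle_injective 0 Y (hz.trans (map_zero _).symm), map_zero]
  | succ n =>
    rw [extMk_eq_zero_iff _ _ _ _ _ n rfl] at hz
    obtain ⟨g, hg⟩ := hz
    have hz' : z = K.toCycles n (n + 1) g := by
      refine P.cocycle_injective (n + 1) Y (hg.symm.trans ?_)
      exact (congrArg (fun k ↦ k.hom g) (K.toCycles_i n (n + 1))).symm
    rw [hz']
    exact congrArg (fun k ↦ k.hom g) (K.toCycles_comp_homologyπ n (n + 1))

variable [EnoughProjectives C]

/-- The comparison map from `Ext` in the derived category to `Ext` as a derived functor. -/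
def extToDerivedExt (P : ProjectiveResolution X) (n : ℕ) (Y : C) :
    Abelian.Ext X Y n →ₗ[R] ((_root_.Ext R C n).obj (.op X)).obj Y :=
  (Submodule.liftQ _ (((P.complex.linearYonedaObj R Y).homologyπ n ≫ (P.isoExt n Y).inv).hom)
    (fun z hz ↦ by
      have h := P.homologyπ_eq_zero_of_cyclesToExt_eq_zero n Y z hz
      simp [h])).comp
    ((P.cyclesToExt n Y).quotKerEquivOfSurjective (P.cyclesToExt_surjective n Y)).symm.toLinearMap

lemma extToDerivedExt_cyclesToExt (P : ProjectiveResolution X) (n : ℕ) (Y : C)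
    (z : (P.complex.linearYonedaObj R Y).cycles n) :
    P.extToDerivedExt n Y (P.cyclesToExt n Y z) =
      (P.isoExt n Y).inv ((P.complex.linearYonedaObj R Y).homologyπ n z) := by
  have : ((P.cyclesToExt n Y).quotKerEquivOfSurjective (P.cyclesToExt_surjective n Y)).symm
      (P.cyclesToExt n Y z) = Submodule.Quotient.mk z := by
    rw [LinearEquiv.symm_apply_eq]
    rfl
  simp only [extToDerivedExt, LinearMap.comp_apply, LinearEquiv.coe_coe, this]
  rfl

lemma extToDerivedExt_surjective (P : ProjectiveResolution X) (n : ℕ) (Y : C) :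
    Function.Surjective (P.extToDerivedExt (R := R) n Y) := by
  intro a
  obtain ⟨b, rfl⟩ := (ModuleCat.epi_iff_surjective (P.isoExt n Y).inv).1 inferInstance a
  obtain ⟨z, rfl⟩ := (ModuleCat.epi_iff_surjective
    ((P.complex.linearYonedaObj R Y).homologyπ n)).1 inferInstance b
  exact ⟨_, P.extToDerivedExt_cyclesToExt n Y z⟩

lemma extToDerivedExt_naturality (P : ProjectiveResolution X) (P' : ProjectiveResolution X')
    (g : X ⟶ X') (n : ℕ) (Y : C) (a : Abelian.Ext X' Y n) :
    P.extToDerivedExt n Y ((Ext.mk₀ g).comp a (zero_add n)) =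
      ((_root_.Ext R C n).map g.op).app Y (P'.extToDerivedExt n Y a) := by
  obtain ⟨z, rfl⟩ := P'.cyclesToExt_surjective (R := R) n Y a
  let φ : Hom P P' g := ⟨lift g P P', by simpa using! lift_commutes_zero g P P'⟩
  let ψ := linearYonedaObjMap (R := R) φ.hom Y
  have h : (Ext.mk₀ g).comp (P'.cyclesToExt n Y z) (zero_add n) =
      P.cyclesToExt n Y (HomologicalComplex.cyclesMap ψ n z) := by
    refine (mk₀_comp_extMk (P'.cocycle n Y z) (n + 1) rfl (P'.d_comp_cocycle n Y z) φ).trans ?_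
    rw [cyclesToExt_apply]
    congr 1
    exact (congrArg (fun k ↦ k.hom z) (HomologicalComplex.cyclesMap_i ψ n)).symm
  rw [h, extToDerivedExt_cyclesToExt, extToDerivedExt_cyclesToExt]
  have h₁ := congrArg (fun k ↦ k.hom z) (HomologicalComplex.homologyπ_naturality ψ n)
  have h₂ := congrArg (fun k ↦ k.hom ((P'.complex.linearYonedaObj R Y).homologyπ n z))
    (isoExt_inv_naturality (R := R) P P' φ n Y)
  exact (congrArg (P.isoExt n Y).inv h₁).symm.trans h₂.symm

end

end CategoryTheory.ProjectiveResolution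

namespace ExtLimit

open Abelian Limits Opposite

variable {R : Type u} [CommRing R] (I : Ideal R)

/-- The module `R ⧸ I ^ n`. -/
abbrev quot (n : ℕ) : ModuleCat.{u} R :=
  (localCohomology.ringModIdeals (localCohomology.idealPowersDiagram I)).obj (op n)

/-- The projection `R ⧸ I ^ n ⟶ R ⧸ I ^ k` for `k ≤ n`. -/
def proj {k n : ℕ} (h : k ≤ n) : quot I n ⟶ quot I k :=
  (localCohomology.ringModIdeals (localCohomology.idealPowersDiagram I)).map (homOfLE h).op

lemma proj_self (n : ℕ) : proj I (le_refl n) = 𝟙 _ := by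
  exact CategoryTheory.Functor.map_id _ _

lemma proj_comp {k m n : ℕ} (h : k ≤ m) (h' : m ≤ n) :
    proj I h' ≫ proj I h = proj I (h.trans h') := by
  exact (Functor.map_comp _ _ _).symm

variable (M : ModuleCat.{u} R) (i : ℕ)

/-- The transition maps of the direct system of the modules `Ext^i(R ⧸ I ^ n, M)`. -/
def transition (k n : ℕ) (h : k ≤ n) : Ext (quot I k) M i →ₗ[R] Ext (quot I n) M i :=
  (Ext.mk₀ (proj I h)).precompOfLinear R M (zero_add i)

lemma transition_apply (k n : ℕ) (h : k ≤ n) (a : Ext (quot I k) M i) :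
    transition I M i k n h a = (Ext.mk₀ (proj I h)).comp a (zero_add i) := rfl

instance : DirectedSystem (fun n ↦ Ext (quot I n) M i) (fun k n h ↦ transition I M i k n h) where
  map_self n a := by simp [transition_apply, proj_self]
  map_map k m n h h' a := by
    rw [transition_apply, transition_apply, Ext.mk₀_comp_mk₀_assoc, proj_comp]
    rfl

/-- The direct limit of the modules `Ext^i(R ⧸ I ^ n, M)`. -/
abbrev L : Type u := Module.DirectLimit (fun n ↦ Ext (quot I n) M i) (transition I M i)

/-- The canonical map from `Ext^i(R ⧸ I ^ n, M)` to the limit. -/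
abbrev ι (n : ℕ) : Ext (quot I n) M i →ₗ[R] L I M i :=
  Module.DirectLimit.of R ℕ _ (transition I M i) n

lemma exists_ι (z : L I M i) : ∃ n a, ι I M i n a = z := Module.DirectLimit.exists_of z

lemma ι_transition (k n : ℕ) (h : k ≤ n) (a : Ext (quot I k) M i) :
    ι I M i n (transition I M i k n h a) = ι I M i k a := Module.DirectLimit.of_f

lemma ι_eq_zero {n : ℕ} {a : Ext (quot I n) M i} (h : ι I M i n a = 0) :
    ∃ m, ∃ hm : n ≤ m, transition I M i n m hm a = 0 := Module.DirectLimit.of.zero_exact h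

/-- The comparison map from `Ext^i(R ⧸ I ^ n, M)` to a term of the diagram defining local
cohomology. -/
def toDiagram (n : ℕ) : Ext (quot I n) M i →ₗ[R]
    ((localCohomology.diagram (localCohomology.idealPowersDiagram I) i).obj (op (op n))).obj M :=
  (projectiveResolution (quot I n)).extToDerivedExt i M

lemma toDiagram_surjective (n : ℕ) : Function.Surjective (toDiagram I M i n) :=
  (projectiveResolution (quot I n)).extToDerivedExt_surjective i M

lemma toDiagram_transition (k n : ℕ) (h : k ≤ n) (a : Ext (quot I k) M i) :
    toDiagram I M i n (transition I M i k n h a) =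
      (((localCohomology.diagram (localCohomology.idealPowersDiagram I) i).map
        (homOfLE h).op.op).app M).hom (toDiagram I M i k a) :=
  (projectiveResolution (quot I n)).extToDerivedExt_naturality
    (projectiveResolution (quot I k)) (proj I h) i M a

/-- The canonical map from a term of the diagram defining local cohomology. -/
def ofDiagram (n : ℕ) :
    ((localCohomology.diagram (localCohomology.idealPowersDiagram I) i).obj (op (op n))).obj M →ₗ[R]
      (localCohomology I i).obj M :=
  ((colimit.ι (localCohomology.diagram (localCohomology.idealPowersDiagram I) i)
      (op (op n))).app M).hom

/-- The comparison map from `L` to local cohomology. -/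
def toLocalCohomology : L I M i →ₗ[R] (localCohomology I i).obj M :=
  Module.DirectLimit.lift R ℕ _ _ (fun n ↦ (ofDiagram I M i n).comp (toDiagram I M i n))
    (fun k n h a ↦ by
      rw [LinearMap.comp_apply, LinearMap.comp_apply, toDiagram_transition]
      exact congrArg (fun φ ↦ (φ.app M).hom (toDiagram I M i k a)) (colimit.w
        (localCohomology.diagram (localCohomology.idealPowersDiagram I) i) (homOfLE h).op.op))

lemma toLocalCohomology_surjective : Function.Surjective (toLocalCohomology I M i) := by
  let F := localCohomology.diagram (localCohomology.idealPowersDiagram I) i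
  have hc : IsColimit (((evaluation _ _).obj M).mapCocone (colimit.cocone F)) :=
    isColimitOfPreserves _ (colimit.isColimit F)
  have h : ModuleCat.ofHom (LinearMap.range (toLocalCohomology I M i)).mkQ = 0 := by
    refine hc.hom_ext fun j ↦ ?_
    ext y
    obtain ⟨a, ha⟩ := toDiagram_surjective I M i j.unop.unop y
    refine (Submodule.Quotient.mk_eq_zero _).2 ⟨ι I M i j.unop.unop a, ?_⟩
    exact (Module.DirectLimit.lift_of ..).trans (congrArg (ofDiagram I M i j.unop.unop) ha)
  rw [← LinearMap.range_eq_top, ← Submodule.ker_mkQ (LinearMap.range _), LinearMap.ker_eq_top]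
  exact ModuleCat.hom_ext_iff.1 h

end ExtLimit

namespace ExtLimit

open Abelian Limits Opposite

variable {R : Type u} [CommRing R] (I : Ideal R)

lemma transition_comp {M N : ModuleCat.{u} R} {i j k : ℕ} (e : Ext M N j) (h : i + j = k)
    {m n : ℕ} (hmn : m ≤ n) (a : Ext (quot I m) M i) :
    transition I N k m n hmn (a.comp e h) = (transition I M i m n hmn a).comp e h :=
  (Ext.comp_assoc (Ext.mk₀ (proj I hmn)) a e (zero_add i) h (by lia)).symm

/-- The map on limits given by composition with an `Ext`-class. -/
def postcomp {M N : ModuleCat.{u} R} {i j k : ℕ} (e : Ext M N j) (h : i + j = k) :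
    L I M i →ₗ[R] L I N k :=
  Module.DirectLimit.map (fun n ↦ e.postcompOfLinear R (quot I n) h)
    (fun _ _ hmn ↦ LinearMap.ext fun a ↦ (transition_comp I e h hmn a).symm)

lemma postcomp_ι {M N : ModuleCat.{u} R} {i j k : ℕ} (e : Ext M N j) (h : i + j = k) (n : ℕ)
    (a : Ext (quot I n) M i) : postcomp I e h (ι I M i n a) = ι I N k n (a.comp e h) :=
  Module.DirectLimit.map_apply_of _ _ _

lemma exists_of_postcomp_eq_zero {M N : ModuleCat.{u} R} {i j k : ℕ} (e : Ext M N j)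
    (h : i + j = k) (z : L I M i) (hz : postcomp I e h z = 0) :
    ∃ (n : ℕ) (a : Ext (quot I n) M i), ι I M i n a = z ∧ a.comp e h = 0 := by
  obtain ⟨n, a, rfl⟩ := exists_ι I M i z
  rw [postcomp_ι] at hz
  obtain ⟨m, hm, h0⟩ := ι_eq_zero I N k hz
  exact ⟨m, transition I M i n m hm a, ι_transition .., by rw [← transition_comp, h0]⟩

lemma postcomp_mk₀_comp {M N K : ModuleCat.{u} R} (f : M ⟶ N) (g : N ⟶ K) (i : ℕ)
    (z : L I M i) : postcomp I (Ext.mk₀ g) (add_zero i) (postcomp I (Ext.mk₀ f) (add_zero i) z) =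
      postcomp I (Ext.mk₀ (f ≫ g)) (add_zero i) z := by
  obtain ⟨n, a, rfl⟩ := exists_ι I _ _ z
  rw [postcomp_ι, postcomp_ι, postcomp_ι, ← Ext.mk₀_comp_mk₀,
    Ext.comp_assoc_of_third_deg_zero]

lemma postcomp_zero {M N : ModuleCat.{u} R} {i j k : ℕ} (h : i + j = k) (z : L I M i) :
    postcomp I (0 : Ext M N j) h z = 0 := by
  obtain ⟨n, a, rfl⟩ := exists_ι I _ _ z
  rw [postcomp_ι, Ext.comp_zero, map_zero]

lemma range_postcomp_eq_ker {S : ShortComplex (ModuleCat.{u} R)} (hS : S.ShortExact) (i : ℕ) :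
    LinearMap.range (postcomp I (Ext.mk₀ S.f) (add_zero i)) =
      LinearMap.ker (postcomp I (Ext.mk₀ S.g) (add_zero i)) := by
  refine le_antisymm ?_ fun z hz ↦ ?_
  · rintro _ ⟨z, rfl⟩
    rw [LinearMap.mem_ker, postcomp_mk₀_comp, S.zero, Ext.mk₀_zero, postcomp_zero]
  · obtain ⟨n, a, rfl, ha⟩ := exists_of_postcomp_eq_zero I _ _ z hz
    obtain ⟨b, hb⟩ := Ext.covariant_sequence_exact₂ _ hS a ha
    exact ⟨ι I _ i n b, by rw [postcomp_ι, hb]⟩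

lemma exact_left {S : ShortComplex (ModuleCat.{u} R)} (hS : S.ShortExact) {i k : ℕ}
    (h : i + 1 = k) (z : L I S.X₁ k) (hz : postcomp I (Ext.mk₀ S.f) (add_zero k) z = 0) :
    ∃ w : L I S.X₃ i, postcomp I hS.extClass h w = z := by
  obtain ⟨n, a, rfl, ha⟩ := exists_of_postcomp_eq_zero I _ _ z hz
  obtain ⟨b, hb⟩ := Ext.covariant_sequence_exact₁ _ hS a ha h
  exact ⟨ι I _ i n b, by rw [postcomp_ι, hb]⟩

lemma eq_zero_of_mono {M N : ModuleCat.{u} R} (f : M ⟶ N) [Mono f] (z : L I M 0)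
    (hz : postcomp I (Ext.mk₀ f) (add_zero 0) z = 0) : z = 0 := by
  obtain ⟨n, a, rfl, ha⟩ := exists_of_postcomp_eq_zero I _ _ z hz
  obtain ⟨g, rfl⟩ := (Ext.mk₀_bijective _ _).2 a
  rw [Ext.mk₀_comp_mk₀, Ext.mk₀_eq_zero_iff] at ha
  rw [(cancel_mono f).1 (ha.trans zero_comp.symm), Ext.mk₀_zero, map_zero]

lemma postcomp_smul_id {M : ModuleCat.{u} R} (i : ℕ) (r : R) (z : L I M i) :
    postcomp I (Ext.mk₀ (r • 𝟙 M)) (add_zero i) z = r • z := by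
  obtain ⟨n, a, rfl⟩ := exists_ι I M i z
  rw [postcomp_ι, ← Ext.smul_eq_comp_mk₀, map_smul]

lemma smul_eq_zero_of_mem_annihilator {M : ModuleCat.{u} R} (i : ℕ) {r : R}
    (hr : r ∈ Module.annihilator R M) (z : L I M i) : r • z = 0 := by
  have : r • 𝟙 M = 0 :=
    ModuleCat.hom_ext (LinearMap.ext (Module.mem_annihilator.1 hr))
  obtain ⟨n, a, rfl⟩ := exists_ι I M i z
  rw [← map_smul, Ext.smul_eq_comp_mk₀, this, Ext.mk₀_zero, Ext.comp_zero, map_zero]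

lemma exists_pow_smul_eq_zero {M : ModuleCat.{u} R} (i : ℕ) (z : L I M i) :
    ∃ n : ℕ, ∀ r ∈ I ^ n, r • z = 0 := by
  obtain ⟨n, a, rfl⟩ := exists_ι I M i z
  refine ⟨n, fun r hr ↦ ?_⟩
  have h : r • 𝟙 (quot I n) = 0 := by
    have hr' : r ∈ Module.annihilator R (R ⧸ I ^ n) := by rwa [Ideal.annihilator_quotient]
    exact ModuleCat.hom_ext (LinearMap.ext (Module.mem_annihilator.1 hr'))
  rw [← map_smul, ← Ext.mk₀_id_comp a, ← Ext.smul_comp, ← Ext.mk₀_smul, h]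
  simp

end ExtLimit

namespace ExtLimit

open Abelian Limits Opposite

lemma mk₀_τ₃_comp_extClass_comp_eq_zero {C : Type*} [Category* C] [Abelian C] [HasExt.{v} C]
    {S S' : ShortComplex C} (hS : S.ShortExact) (hS' : S'.ShortExact) (f : S ⟶ S') {B T : C}
    (a : S.X₁ ⟶ B) (b : B ⟶ S'.X₁) (hf : f.τ₁ = a ≫ b) {i j : ℕ} (h : 1 + i = j)
    (η : Ext S'.X₁ T i) (hη : (Ext.mk₀ b).comp η (zero_add i) = 0) :
    (Ext.mk₀ f.τ₃).comp (hS'.extClass.comp η h) (zero_add j) = 0 := by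
  rw [← Ext.comp_assoc (Ext.mk₀ f.τ₃) _ η (zero_add 1) h (by lia),
    ← ShortComplex.ShortExact.extClass_naturality hS hS' f,
    Ext.comp_assoc _ (Ext.mk₀ f.τ₁) η (add_zero 1) (zero_add i) (by lia), hf,
    ← Ext.mk₀_comp_mk₀_assoc, hη, Ext.comp_zero, Ext.comp_zero]

variable {R : Type u} [CommRing R]

lemma restrict_extClass_comp_eq_zero {F A F' A' : Type u} [AddCommGroup F] [Module R F]
    [AddCommGroup A] [Module R A] [AddCommGroup F'] [Module R F'] [AddCommGroup A'] [Module R A']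
    {π : F →ₗ[R] A} (hπ : Function.Surjective π) {π' : F' →ₗ[R] A'}
    (hπ' : Function.Surjective π') (φ : F' →ₗ[R] F) (ψ : A' →ₗ[R] A)
    (hcomm : ∀ x, ψ (π' x) = π (φ x)) (N : Submodule R (LinearMap.ker π))
    (hN : ∀ x, π' x = 0 → ∃ y ∈ N, (y : F) = φ x) {T : ModuleCat.{u} R} {i j : ℕ} (h : 1 + i = j)
    (η : Ext (ModuleCat.of R (LinearMap.ker π)) T i)
    (hη : (Ext.mk₀ (ModuleCat.ofHom N.subtype)).comp η (zero_add i) = 0) :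
    (Ext.mk₀ (ModuleCat.ofHom ψ)).comp
      ((LinearMap.shortExact_shortComplexKer hπ).extClass.comp η h) (zero_add j) = 0 := by
  have hφ : ∀ x ∈ LinearMap.ker π', φ x ∈ LinearMap.ker π := fun x hx ↦ by
    rw [LinearMap.mem_ker, ← hcomm, LinearMap.mem_ker.1 hx, map_zero]
  have hφN : ∀ x, φ.restrict hφ x ∈ N := fun x ↦ by
    obtain ⟨y, hy, hyx⟩ := hN x x.2
    convert hy
    exact Subtype.ext hyx.symm
  let f : π'.shortComplexKer ⟶ π.shortComplexKer :=
    { τ₁ := ModuleCat.ofHom (φ.restrict hφ)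
      τ₂ := ModuleCat.ofHom φ
      τ₃ := ModuleCat.ofHom ψ
      comm₁₂ := rfl
      comm₂₃ := ModuleCat.hom_ext (LinearMap.ext fun x ↦ (hcomm x).symm) }
  have hf : f.τ₁ = ModuleCat.ofHom ((φ.restrict hφ).codRestrict N hφN) ≫
      ModuleCat.ofHom N.subtype := rfl
  exact mk₀_τ₃_comp_extClass_comp_eq_zero (LinearMap.shortExact_shortComplexKer hπ')
    (LinearMap.shortExact_shortComplexKer hπ) f _ _ hf h η hη

lemma exists_extClass_comp_eq {F A : Type u} [AddCommGroup F] [Module R F]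
    [AddCommGroup A] [Module R A] [Module.Projective R F]
    {π : F →ₗ[R] A} (hπ : Function.Surjective π) {T : ModuleCat.{u} R} {i : ℕ}
    (ξ : Ext (ModuleCat.of R A) T (i + 1)) :
    ∃ η : Ext (ModuleCat.of R (LinearMap.ker π)) T i,
      (LinearMap.shortExact_shortComplexKer hπ).extClass.comp η (add_comm 1 i) = ξ := by
  have : Projective π.shortComplexKer.X₂ := inferInstanceAs (Projective (ModuleCat.of R F))
  exact Ext.contravariant_sequence_exact₃ (LinearMap.shortExact_shortComplexKer hπ) _ ξ
    (Ext.eq_zero_of_projective _) (add_comm 1 i)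

variable (I : Ideal R) [IsNoetherianRing R]

lemma exists_restrict_eq_zero {T : ModuleCat.{u} R} (hT : I ≤ Module.annihilator R T) (i : ℕ)
    (A : Type u) [AddCommGroup A] [Module R A] [Module.Finite R A]
    (ξ : Ext (ModuleCat.of R A) T i) :
    ∃ n : ℕ, (Ext.mk₀ (ModuleCat.ofHom (I ^ n • ⊤ : Submodule R A).subtype)).comp ξ
      (zero_add i) = 0 := by
  induction i generalizing A with
  | zero =>
    refine ⟨1, ?_⟩
    obtain ⟨g, rfl⟩ := (Ext.mk₀_bijective _ _).2 ξ
    rw [Ext.mk₀_comp_mk₀, Ext.mk₀_eq_zero_iff]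
    refine ModuleCat.hom_ext (LinearMap.ext fun x ↦ ?_)
    have h : (I ^ 1 • ⊤ : Submodule R A) ≤ LinearMap.ker g.hom := by
      rw [Submodule.smul_le]
      intro r hr y _
      rw [LinearMap.mem_ker, map_smul]
      exact Module.mem_annihilator.1 (hT (by simpa using hr)) _
    exact h x.2
  | succ i ih =>
    obtain ⟨m, π, hπ⟩ := Module.Finite.exists_fin' R A
    obtain ⟨η, rfl⟩ := exists_extClass_comp_eq hπ ξ
    obtain ⟨n, hn⟩ := ih (LinearMap.ker π) η
    obtain ⟨k, hk⟩ := I.exists_pow_inf_eq_pow_smul (LinearMap.ker π)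
    have hmap : ∀ x ∈ (I ^ (n + k) • ⊤ : Submodule R (Fin m → R)),
        π x ∈ (I ^ (n + k) • ⊤ : Submodule R A) := fun x hx ↦ by
      have := Submodule.mem_map_of_mem (f := π) hx
      rw [Submodule.map_smul''] at this
      exact Submodule.smul_mono le_rfl le_top this
    refine ⟨n + k, restrict_extClass_comp_eq_zero hπ (π' := π.restrict hmap) ?_
      (Submodule.subtype _) (Submodule.subtype _) (fun _ ↦ rfl) _ ?_ _ η hn⟩
    · rintro ⟨y, hy⟩
      rw [← LinearMap.range_eq_top.2 hπ, LinearMap.range_eq_map, ← Submodule.map_smul''] at hy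
      obtain ⟨x, hx, rfl⟩ := hy
      exact ⟨⟨x, hx⟩, rfl⟩
    · rintro ⟨x, hx⟩ hx'
      have hxk : x ∈ LinearMap.ker π := congrArg Subtype.val hx'
      refine ⟨⟨x, hxk⟩, ?_, rfl⟩
      have h₁ : x ∈ I ^ n • (I ^ k • ⊤ ⊓ LinearMap.ker π) := by
        have := (hk (n + k) (by lia)).le ⟨hx, hxk⟩
        rwa [Nat.add_sub_cancel] at this
      have h₂ : x ∈ (I ^ n • ⊤ : Submodule R (LinearMap.ker π)).map
          (LinearMap.ker π).subtype := by
        rw [Submodule.map_smul'', Submodule.map_subtype_top]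
        exact Submodule.smul_mono le_rfl inf_le_right h₁
      obtain ⟨y, hy, rfl⟩ := h₂
      exact hy

lemma L_succ_eq_zero {T : ModuleCat.{u} R} (hT : I ≤ Module.annihilator R T) (i : ℕ)
    (z : L I T (i + 1)) : z = 0 := by
  obtain ⟨n, a, rfl⟩ := exists_ι I _ _ z
  let π (n : ℕ) : R →ₗ[R] R ⧸ I ^ n := (I ^ n).mkQ
  have hπ (n : ℕ) : Function.Surjective (π n) := Submodule.mkQ_surjective _
  obtain ⟨η, hη⟩ := exists_extClass_comp_eq (hπ n) a
  obtain ⟨k, hk⟩ := exists_restrict_eq_zero I hT i (LinearMap.ker (π n)) η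
  rw [← ι_transition I T _ n (n + k) (by lia), transition_apply, ← hη]
  refine (congrArg (ι I T (i + 1) (n + k)) ?_).trans (map_zero _)
  refine restrict_extClass_comp_eq_zero (hπ n) (hπ (n + k)) LinearMap.id
    (Submodule.mapQ _ _ LinearMap.id (Ideal.pow_le_pow_right (by lia))) (fun _ ↦ rfl) _ ?_ _ η hk
  intro x hx
  have hx' : x ∈ I ^ (n + k) := (Submodule.Quotient.mk_eq_zero _).1 hx
  have hxk : x ∈ (I ^ k • ⊤ : Submodule R (LinearMap.ker (π n))).map
      (LinearMap.ker (π n)).subtype := by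
    rw [Submodule.map_smul'', Submodule.map_subtype_top, Submodule.ker_mkQ, smul_eq_mul, ← pow_add,
      add_comm]
    exact hx'
  obtain ⟨y, hy, rfl⟩ := hxk
  exact ⟨y, hy, rfl⟩

end ExtLimit

/-- A module whose elements are killed by powers of `x` is Artinian if the kernel of
multiplication by `x` is. -/
theorem isArtinian_of_ker_lsmul {R N : Type*} [CommRing R] [AddCommGroup N] [Module R N] (x : R)
    (hx : ∀ y : N, ∃ k : ℕ, x ^ k • y = 0) [IsArtinian R (LinearMap.ker (LinearMap.lsmul R N x))] :
    IsArtinian R N := by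
  rw [← monotone_stabilizes_iff_artinian]
  intro f
  let V (n k : ℕ) : Submodule R (LinearMap.ker (LinearMap.lsmul R N x)) :=
    ((OrderDual.ofDual (f n)).map (LinearMap.lsmul R N (x ^ k))).comap (Submodule.subtype _)
  have hf {m n : ℕ} (h : m ≤ n) : OrderDual.ofDual (f n) ≤ OrderDual.ofDual (f m) := f.mono h
  have hV {m n k l : ℕ} (h : m ≤ n) (h' : k ≤ l) : V n l ≤ V m k := by
    rintro z ⟨y, hy, hyz⟩
    refine ⟨x ^ (l - k) • y, Submodule.smul_mem _ _ (hf h hy), ?_⟩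
    rw [← hyz]
    simp only [LinearMap.lsmul_apply, smul_smul, ← pow_add, Nat.add_sub_cancel' h']
  obtain ⟨a, ha⟩ := IsArtinian.monotone_stabilizes
    (⟨fun n ↦ OrderDual.toDual (V n n), fun m n h ↦ hV h h⟩ : ℕ →o _)
  have hb (k : ℕ) : ∃ b, ∀ n ≥ b, V b k = V n k :=
    IsArtinian.monotone_stabilizes
      (⟨fun n ↦ OrderDual.toDual (V n k), fun m n h ↦ hV h le_rfl⟩ : ℕ →o _)
  choose b hb using hb
  let c := max a ((Finset.range a).sup b)
  have hc (n k : ℕ) (hn : c ≤ n) : V c k ≤ V n k := by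
    obtain hk | hk := lt_or_ge k a
    · have hbc : b k ≤ c := (Finset.le_sup (Finset.mem_range.2 hk)).trans (le_max_right _ _)
      rw [← hb k c hbc, ← hb k n (hbc.trans hn)]
    · calc V c k ≤ V a a := hV (le_max_left _ _) hk
        _ = V (max n k) (max n k) :=
          ha (max n k) ((le_max_left _ _).trans (hn.trans (le_max_left _ _)))
        _ ≤ V n k := hV (le_max_left _ _) (le_max_right _ _)
  refine ⟨c, fun n hn ↦ le_antisymm (α := Submodule R N) (fun y hy ↦ ?_) (hf hn)⟩
  obtain ⟨k, hk⟩ := hx y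
  induction k generalizing y with
  | zero =>
    rw [pow_zero, one_smul] at hk
    exact hk ▸ zero_mem (OrderDual.ofDual (f n))
  | succ k ih =>
    obtain ⟨y', hy', h⟩ := hc n k hn (x := ⟨x ^ k • y, by
      rwa [LinearMap.mem_ker, LinearMap.lsmul_apply, smul_smul, ← pow_succ']⟩) ⟨y, hy, rfl⟩
    have := ih (y - y') (sub_mem hy (hf hn hy')) (by
      rw [smul_sub, sub_eq_zero]
      exact h.symm)
    simpa using add_mem this hy'

namespace ExtLimit

open Abelian Limits Opposite

variable {R : Type u} [CommRing R] (I : Ideal R)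

/-- The class of `1` in `R ⧸ I ^ n`. -/
def one (n : ℕ) : quot I n := (Ideal.Quotient.mk (I ^ n) 1 : R ⧸ I ^ n)

lemma exists_smul_one (n : ℕ) (x : quot I n) : ∃ r : R, r • one I n = x := by
  obtain ⟨r, rfl⟩ := Submodule.Quotient.mk_surjective _ x
  exact ⟨r, congrArg (Submodule.Quotient.mk (p := I ^ n)) (mul_one r)⟩

/-- Evaluation at `1` of a homomorphism out of `R ⧸ I ^ n`. -/
def evalOne (M : ModuleCat.{u} R) (n : ℕ) : Ext (quot I n) M 0 →ₗ[R] M :=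
  (LinearMap.applyₗ (one I n)).comp
    ((ModuleCat.homLinearEquiv (S := R)).toLinearMap.comp (Ext.linearEquiv₀ (R := R)).toLinearMap)

lemma evalOne_mk₀ (M : ModuleCat.{u} R) (n : ℕ) (g : quot I n ⟶ M) :
    evalOne I M n (Ext.mk₀ g) = g.hom (one I n) := by
  have : Ext.linearEquiv₀ (R := R) (Ext.mk₀ g) = g :=
    (Ext.mk₀_bijective _ _).1 (Ext.mk₀_linearEquiv₀_apply _)
  exact congrArg (fun g ↦ g.hom (one I n)) this

/-- The embedding of `L I M 0` into `M`. -/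
def toModule (M : ModuleCat.{u} R) : L I M 0 →ₗ[R] M :=
  Module.DirectLimit.lift R ℕ _ _ (evalOne I M) (fun k n h a ↦ by
    obtain ⟨g, rfl⟩ := (Ext.mk₀_bijective _ _).2 a
    rw [transition_apply, Ext.mk₀_comp_mk₀, evalOne_mk₀, evalOne_mk₀]
    rfl)

lemma toModule_injective (M : ModuleCat.{u} R) : Function.Injective (toModule I M) := by
  rw [injective_iff_map_eq_zero]
  intro z hz
  obtain ⟨n, a, rfl⟩ := exists_ι I M 0 z
  obtain ⟨g, rfl⟩ := (Ext.mk₀_bijective _ _).2 a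
  rw [toModule, Module.DirectLimit.lift_of, evalOne_mk₀] at hz
  have : g = 0 := by
    refine ModuleCat.hom_ext (LinearMap.ext fun x ↦ ?_)
    obtain ⟨r, rfl⟩ := exists_smul_one I n x
    rw [map_smul, hz, smul_zero, ModuleCat.hom_zero, LinearMap.zero_apply]
  rw [this, Ext.mk₀_zero, map_zero]

variable [IsNoetherianRing R] [IsLocalRing R]

open IsLocalRing

lemma isArtinian_L_of_forall_eq_succ (i : ℕ)
    (ih : ∀ j, i = j + 1 → ∀ (M : Type u) [AddCommGroup M] [Module R M] [Module.Finite R M],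
      IsArtinian R (L (maximalIdeal R) (ModuleCat.of R M) j))
    (M : Type u) [AddCommGroup M] [Module R M] [Module.Finite R M] :
    IsArtinian R (L (maximalIdeal R) (ModuleCat.of R M) i) := by
  induction ‹Module.Finite R M› using
    IsNoetherianRing.induction_on_isQuotientEquivQuotientPrime R with
  | subsingleton N =>
    have h : (1 : R) ∈ Module.annihilator R N :=
      Module.mem_annihilator.2 fun _ ↦ Subsingleton.elim _ _
    have : Subsingleton (L (maximalIdeal R) (ModuleCat.of R N) i) :=
      subsingleton_of_forall_eq 0 fun z ↦ by
        simpa using smul_eq_zero_of_mem_annihilator (maximalIdeal R) (M := .of R N) i h z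
    infer_instance
  | exact N₁ N₂ N₃ f g hf hg hfg h₁ h₃ =>
    let S := ModuleCat.shortComplexOfCompEqZero f g hfg.linearMap_comp_eq_zero
    have hS : S.ShortExact := ModuleCat.shortComplex_shortExact S hfg hf hg
    exact isArtinian_of_range_eq_ker _ _ (range_postcomp_eq_ker (maximalIdeal R) hS i)
  | quotient N p e =>
    have hann : Module.annihilator R N = p.asIdeal := by
      rw [e.annihilator_eq, Ideal.annihilator_quotient]
    by_cases hp : p.asIdeal = maximalIdeal R
    · cases i with
      | zero =>
        have : IsSimpleModule R N := by
          rw [isSimpleModule_iff_quot_maximal]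
          exact ⟨p.asIdeal, hp ▸ inferInstance, ⟨e⟩⟩
        exact isArtinian_of_injective _ (toModule_injective (maximalIdeal R) (.of R N))
      | succ i =>
        have : Subsingleton (L (maximalIdeal R) (ModuleCat.of R N) (i + 1)) :=
          subsingleton_of_forall_eq 0 fun z ↦
            L_succ_eq_zero (maximalIdeal R) (T := .of R N) (by rw [← hp]; exact hann.ge) i z
        infer_instance
    · obtain ⟨x, hx, hxp⟩ := SetLike.exists_of_lt
        ((le_maximalIdeal p.isPrime.ne_top).lt_of_ne hp)
      have hinj : Function.Injective (LinearMap.lsmul R N x) := by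
        rw [injective_iff_map_eq_zero]
        intro y hy
        have hxy : x • e y = 0 := by
          rw [← map_smul]
          exact (congrArg e hy).trans (map_zero e)
        obtain ⟨r, hr⟩ := Submodule.Quotient.mk_surjective _ (e y)
        rw [← hr, ← Submodule.Quotient.mk_smul, Submodule.Quotient.mk_eq_zero] at hxy
        rw [← e.map_eq_zero_iff, ← hr, Submodule.Quotient.mk_eq_zero]
        exact (p.isPrime.mem_or_mem hxy).resolve_left hxp
      let S : ShortComplex (ModuleCat.{u} R) := ShortComplex.mk (x • 𝟙 (ModuleCat.of R N))
        (ModuleCat.ofHom (LinearMap.range (LinearMap.lsmul R N x)).mkQ)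
        (ModuleCat.hom_ext (LinearMap.range_mkQ_comp (LinearMap.lsmul R N x)))
      have hS : S.ShortExact := ModuleCat.shortComplex_shortExact S
        (LinearMap.exact_map_mkQ_range (LinearMap.lsmul R N x)) hinj (Submodule.mkQ_surjective _)
      have : IsArtinian R (LinearMap.ker
          (LinearMap.lsmul R (L (maximalIdeal R) (ModuleCat.of R N) i) x)) := by
        cases i with
        | zero =>
          have := hS.mono_f
          have : LinearMap.ker
              (LinearMap.lsmul R (L (maximalIdeal R) (ModuleCat.of R N) 0) x) = ⊥ := by
            refine (Submodule.eq_bot_iff _).2 fun z hz ↦ eq_zero_of_mono (maximalIdeal R) S.f z ?_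
            exact (postcomp_smul_id (maximalIdeal R) 0 x z).trans hz
          rw [this]
          infer_instance
        | succ j =>
          have := ih j rfl (N ⧸ LinearMap.range (LinearMap.lsmul R N x))
          refine isArtinian_of_le (t := LinearMap.range
            (postcomp (maximalIdeal R) hS.extClass (rfl : j + 1 = j + 1))) fun z hz ↦
              exact_left (maximalIdeal R) hS rfl z ?_
          exact (postcomp_smul_id (maximalIdeal R) _ x z).trans hz
      refine isArtinian_of_ker_lsmul x fun y ↦ ?_
      obtain ⟨n, hn⟩ := exists_pow_smul_eq_zero (maximalIdeal R) i y
      exact ⟨n, hn _ (Ideal.pow_mem_pow hx n)⟩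

theorem isArtinian_L (i : ℕ) (M : Type u) [AddCommGroup M] [Module R M] [Module.Finite R M] :
    IsArtinian R (L (maximalIdeal R) (ModuleCat.of R M) i) := by
  induction i generalizing M with
  | zero => exact isArtinian_L_of_forall_eq_succ 0 (by simp) M
  | succ i ih =>
    refine isArtinian_L_of_forall_eq_succ (i + 1) (fun j hj ↦ ?_) M
    obtain rfl : i = j := by lia
    exact fun M _ _ _ ↦ ih M

end ExtLimit

namespace Paper

variable {R : Type} [CommRing R] {M : Type} [AddCommGroup M] [Module R M]

lemma mem_radical_annihilator {N : Submodule R M} {r : R} :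
    r ∈ N.annihilator.radical ↔ ∃ k : ℕ, ∀ m ∈ N, r ^ k • m = 0 := by
  simp only [Ideal.mem_radical_iff, Submodule.mem_annihilator]

lemma isSecondaryFor_of_supIrred [IsArtinian R M] {N : Submodule R M} (hN : SupIrred N) :
    IsSecondaryFor R N N.annihilator.radical := by
  refine ⟨fun h ↦ hN.1 (h ▸ isMin_bot), fun r ↦ ?_, rfl⟩
  let f : ℕ →o (Submodule R M)ᵒᵈ :=
    { toFun := fun n ↦ OrderDual.toDual (N.map (LinearMap.lsmul R M (r ^ n)))
      monotone' := fun a b hab ↦ by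
        rintro _ ⟨m, hm, rfl⟩
        obtain ⟨c, rfl⟩ := Nat.exists_eq_add_of_le hab
        exact ⟨r ^ c • m, N.smul_mem _ hm, by simp [pow_add, mul_smul, smul_comm (r ^ a)]⟩ }
  obtain ⟨k, hk⟩ := IsArtinian.monotone_stabilizes f
  have hstab (c : ℕ) {m : M} (hm : m ∈ N) : ∃ n ∈ N, r ^ (k + c) • n = r ^ k • m := by
    have : N.map (LinearMap.lsmul R M (r ^ k)) = N.map (LinearMap.lsmul R M (r ^ (k + c))) :=
      hk (k + c) (Nat.le_add_right k c)
    have hm' : r ^ k • m ∈ N.map (LinearMap.lsmul R M (r ^ k)) := ⟨m, hm, rfl⟩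
    rw [this] at hm'
    exact hm'
  have hsup : N ⊓ LinearMap.ker (LinearMap.lsmul R M (r ^ k)) ⊔
      N.map (LinearMap.lsmul R M (r ^ k)) = N := by
    refine le_antisymm (sup_le inf_le_left ?_) fun m hm ↦ ?_
    · rintro _ ⟨m, hm, rfl⟩
      exact N.smul_mem _ hm
    · obtain ⟨n, hn, hnm⟩ := hstab k hm
      refine Submodule.mem_sup.2 ⟨m - r ^ k • n, ⟨N.sub_mem hm (N.smul_mem _ hn), ?_⟩,
        r ^ k • n, ⟨n, hn, rfl⟩, sub_add_cancel _ _⟩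
      simp [smul_sub, ← hnm, pow_add, mul_smul]
  rcases hN.2 hsup with h | h
  · exact .inr ⟨k, fun m hm ↦ (inf_eq_left.1 h) hm⟩
  · refine .inl fun m hm ↦ ?_
    obtain ⟨m', hm', rfl⟩ := h.ge hm
    obtain ⟨n, hn, hnm⟩ := hstab 1 hm'
    exact ⟨r ^ k • n, N.smul_mem _ hn, by
      rw [← mul_smul, ← pow_succ', hnm, LinearMap.lsmul_apply]⟩

lemma IsSecondaryFor.isPrime {N : Submodule R M} {p : Ideal R} (h : IsSecondaryFor R N p) :
    p.IsPrime := by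
  obtain ⟨hbot, hN, rfl⟩ := h
  refine ⟨fun h ↦ hbot ?_, fun {a b} hab ↦ ?_⟩
  · rw [Ideal.radical_eq_top] at h
    exact Submodule.annihilator_eq_top_iff.1 h
  · rcases hN a with ha | ha
    · right
      obtain ⟨k, hk⟩ := mem_radical_annihilator.1 hab
      have hpow (l : ℕ) : ∀ m ∈ N, ∃ n ∈ N, a ^ l • n = m := by
        induction l with
        | zero => exact fun m hm ↦ ⟨m, hm, by simp⟩
        | succ l ih =>
          intro m hm
          obtain ⟨m', hm', rfl⟩ := ha m hm
          obtain ⟨n, hn, rfl⟩ := ih m' hm'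
          exact ⟨n, hn, by rw [pow_succ', mul_smul]⟩
      refine mem_radical_annihilator.2 ⟨k, fun m hm ↦ ?_⟩
      obtain ⟨n, hn, rfl⟩ := hpow k m hm
      rw [← hk n hn, mul_pow, mul_comm, mul_smul]
    · exact .inl (mem_radical_annihilator.2 ha)

lemma IsSecondaryFor.sup {N P : Submodule R M} {p : Ideal R} (hN : IsSecondaryFor R N p)
    (hP : IsSecondaryFor R P p) : IsSecondaryFor R (N ⊔ P) p := by
  have hrad : (N ⊔ P).annihilator.radical = p := by
    rw [Submodule.annihilator_sup, Ideal.radical_inf, hN.2.2, hP.2.2, inf_idem]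
  refine ⟨fun h ↦ hN.1 (sup_eq_bot_iff.1 h).1, fun r ↦ ?_, hrad⟩
  by_cases hr : r ∈ p
  · exact .inr (mem_radical_annihilator.1 (hrad.symm ▸ hr))
  · have hN' := (hN.2.1 r).resolve_right fun h ↦ hr (hN.2.2 ▸ mem_radical_annihilator.2 h)
    have hP' := (hP.2.1 r).resolve_right fun h ↦ hr (hP.2.2 ▸ mem_radical_annihilator.2 h)
    refine .inl fun m hm ↦ ?_
    obtain ⟨a, ha, b, hb, rfl⟩ := Submodule.mem_sup.1 hm
    obtain ⟨a', ha', rfl⟩ := hN' a ha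
    obtain ⟨b', hb', rfl⟩ := hP' b hb
    exact ⟨a' + b', Submodule.add_mem_sup ha' hb', smul_add _ _ _⟩

theorem nonempty_minSecRep (R : Type) [CommRing R] (M : Type) [AddCommGroup M] [Module R M]
    [IsArtinian R M] : Nonempty (MinSecRep R M) := by
  classical
  let P (n : ℕ) : Prop := ∃ T : Finset (Submodule R M), T.card = n ∧ T.sup id = ⊤ ∧
    ∀ N ∈ T, IsSecondaryFor R N N.annihilator.radical
  have hP : ∃ n, P n := by
    obtain ⟨T, hT, h⟩ := exists_supIrred_decomposition (⊤ : Submodule R M)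
    exact ⟨_, T, rfl, hT, fun N hN ↦ isSecondaryFor_of_supIrred (h hN)⟩
  obtain ⟨T, hcard, hsup, hT⟩ := Nat.find_spec hP
  have hmin (T' : Finset (Submodule R M)) (h : T'.sup id = ⊤)
      (h' : ∀ N ∈ T', IsSecondaryFor R N N.annihilator.radical) : T.card ≤ T'.card :=
    hcard ▸ Nat.find_min' hP ⟨T', rfl, h, h'⟩
  let S (i : Fin T.card) : Submodule R M := T.equivFin.symm i
  have hS (i) : S i ∈ T := (T.equivFin.symm i).2
  have hS_inj : Function.Injective S :=
    Subtype.val_injective.comp T.equivFin.symm.injective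
  have hS_surj {N} (hN : N ∈ T) : ∃ i, S i = N := ⟨T.equivFin ⟨N, hN⟩, by simp [S]⟩
  refine ⟨{ n := T.card, S := S, p := fun i ↦ (S i).annihilator.radical,
            prime := fun i ↦ (hT _ (hS i)).isPrime, sec := fun i ↦ hT _ (hS i),
            sum := ?_, inj := fun i j hij ↦ ?_, irred := fun j hj ↦ ?_ }⟩
  · refine top_le_iff.1 (hsup.ge.trans (Finset.sup_le fun N hN ↦ ?_))
    obtain ⟨i, rfl⟩ := hS_surj hN
    exact le_iSup S i
  · by_contra hne
    have hjT : S j ∈ T.erase (S i) :=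
      Finset.mem_erase.2 ⟨fun h ↦ hne (hS_inj h).symm, hS j⟩
    have hsec := (hT _ (hS i)).sup (p := (S i).annihilator.radical)
      (by simpa only [hij] using hT _ (hS j))
    have hle := hmin (insert (S i ⊔ S j) ((T.erase (S i)).erase (S j))) ?_ ?_
    · have h₁ := Finset.card_insert_le (S i ⊔ S j) ((T.erase (S i)).erase (S j))
      have h₂ := Finset.card_erase_add_one hjT
      have h₃ := Finset.card_erase_add_one (hS i)
      lia
    · calc
        _ = S i ⊔ (insert (S j) ((T.erase (S i)).erase (S j))).sup id := by
          rw [Finset.sup_insert, Finset.sup_insert, id, id, sup_assoc]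
        _ = (insert (S i) (T.erase (S i))).sup id := by
          rw [Finset.insert_erase hjT, Finset.sup_insert, id]
        _ = ⊤ := by rw [Finset.insert_erase (hS i), hsup]
    · intro N hN
      rcases Finset.mem_insert.1 hN with rfl | hN
      · rwa [hsec.2.2]
      · exact hT _ (Finset.mem_of_mem_erase (Finset.mem_of_mem_erase hN))
  · have hle := hmin (T.erase (S j)) ?_ fun N hN ↦ hT _ (Finset.mem_of_mem_erase hN)
    · have := Finset.card_erase_add_one (hS j)
      lia
    · have hsup_le : ⨆ i ∈ ({j}ᶜ : Set (Fin T.card)), S i ≤ (T.erase (S j)).sup id :=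
        iSup₂_le fun i hi ↦ Finset.le_sup (f := id)
          (Finset.mem_erase.2 ⟨fun h ↦ hi (hS_inj h), hS i⟩)
      refine top_le_iff.1 (hsup.ge.trans ?_)
      rw [← Finset.insert_erase (hS j), Finset.sup_insert, Finset.erase_insert_eq_erase]
      simpa using hj.trans hsup_le

lemma mem_of_mem_attached {q : Ideal R} (hq : q ∈ attached R M) {x : R}
    (hx : x ∈ Module.annihilator R M) : x ∈ q := by
  obtain ⟨rep, i, rfl⟩ := hq
  rw [← (rep.sec i).2.2]
  exact Ideal.le_radical
    (Submodule.mem_annihilator.2 fun m _ ↦ Module.mem_annihilator.1 hx m)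

lemma exists_attached_le [IsArtinian R M] {q : Ideal R} [q.IsPrime]
    (hq : Module.annihilator R M ≤ q) : ∃ p ∈ attached R M, p ≤ q := by
  obtain ⟨rep⟩ := nonempty_minSecRep R M
  have h : Finset.univ.inf (fun i ↦ (rep.S i).annihilator) ≤ q := by
    refine le_trans ?_ hq
    rw [Finset.inf_univ_eq_iInf, ← Submodule.annihilator_iSup, rep.sum,
      Submodule.annihilator_top]
  obtain ⟨i, -, hi⟩ := (Ideal.IsPrime.inf_le' ‹_›).1 h
  exact ⟨rep.p i, ⟨rep, i, rfl⟩, (rep.sec i).2.2 ▸ (Ideal.IsPrime.radical_le_iff ‹_›).2 hi⟩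

section LocalCohomology

open IsLocalRing

variable [IsLocalRing R] (i : ℕ)

instance [IsNoetherianRing R] [Module.Finite R M] : IsArtinian R (H R (maximalIdeal R) i M) :=
  have := ExtLimit.isArtinian_L (R := R) i M
  isArtinian_of_surjective _ _
    (ExtLimit.toLocalCohomology_surjective (maximalIdeal R) (ModuleCat.of R M) i)

lemma annihilator_le_annihilator_localCohomology :
    Module.annihilator R M ≤ Module.annihilator R (H R (maximalIdeal R) i M) := by
  intro r hr
  refine Module.mem_annihilator.2 fun y ↦ ?_
  obtain ⟨z, rfl⟩ :=
    ExtLimit.toLocalCohomology_surjective (maximalIdeal R) (ModuleCat.of R M) i y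
  rw [← map_smul, ExtLimit.smul_eq_zero_of_mem_annihilator (maximalIdeal R) i hr z, map_zero]

end LocalCohomology

end Paper

/-- A finitely generated module `M` of dimension `d` over a Noetherian local ring has a
uniform local cohomological annihilator iff no minimal prime of `M` is attached to
`H^i_m(M)` for any `i < d`. -/
theorem hasULCA_iff_attached_inter_min_empty (R : Type) [CommRing R] [IsNoetherianRing R]
    [IsLocalRing R] (M : Type) [AddCommGroup M] [Module R M] [Module.Finite R M]
    (d : ℕ) (hdim : Paper.dimMod R M = d) :
    (∃ x : R, (∀ p ∈ Paper.minSupp R M, x ∉ p) ∧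
        ∀ i < d, ∀ y : Paper.H R (IsLocalRing.maximalIdeal R) i M, x • y = 0) ↔
      ∀ i < d,
        Paper.attached R (Paper.H R (IsLocalRing.maximalIdeal R) i M) ∩
          Paper.minSupp R M = ∅ := by
  constructor
  · rintro ⟨x, hx, hxH⟩ i hi
    refine Set.eq_empty_iff_forall_notMem.2 fun q ⟨hq, hqM⟩ ↦ hx q hqM ?_
    exact Paper.mem_of_mem_attached hq (Module.mem_annihilator.2 (hxH i hi))
  · intro h
    let J : Ideal R := (Finset.range d).inf fun i ↦
      Module.annihilator R (Paper.H R (IsLocalRing.maximalIdeal R) i M)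
    have hJ (q : Ideal R) (hq : q ∈ Paper.minSupp R M) : ¬ J ≤ q := by
      intro hJq
      have := hq.1.1
      obtain ⟨i, hi, hiq⟩ := (Ideal.IsPrime.inf_le' this).1 hJq
      obtain ⟨p, hp, hpq⟩ := Paper.exists_attached_le hiq
      have hp_prime : p.IsPrime := by
        obtain ⟨rep, j, rfl⟩ := hp
        exact rep.prime j
      have hMp : Module.annihilator R M ≤ p := fun r hr ↦ Paper.mem_of_mem_attached hp
        (Paper.annihilator_le_annihilator_localCohomology i hr)
      obtain rfl : p = q := le_antisymm hpq (hq.2 ⟨hp_prime, hMp⟩ hpq)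
      exact Set.eq_empty_iff_forall_notMem.1 (h i (Finset.mem_range.1 hi)) p ⟨hp, hq⟩
    have hfin : (Paper.minSupp R M).Finite :=
      Ideal.finite_minimalPrimes_of_isNoetherianRing R _
    have hnot : ¬ (J : Set R) ⊆ ⋃ q ∈ Paper.minSupp R M, (q : Set R) := by
      intro hsub
      obtain ⟨q, hq, hJq⟩ := (Ideal.subset_union_prime_finite hfin (f := id) ⊥ ⊥
        fun q hq _ _ ↦ hq.1.1).1 hsub
      exact hJ q hq hJq
    obtain ⟨x, hxJ, hx⟩ := Set.not_subset.1 hnot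
    refine ⟨x, fun q hq hxq ↦ hx (Set.mem_biUnion hq hxq), fun i hi ↦ ?_⟩
    exact Module.mem_annihilator.1 (Finset.inf_le (f := fun i ↦
      Module.annihilator R (Paper.H R (IsLocalRing.maximalIdeal R) i M))
      (Finset.mem_range.2 hi) hxJ)
end
end
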